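/- For every finite group G, the set {x ∈ G : for every y ∈ G, the subgroup ⟨x,y⟩ is supersoluble} is the underlying set of a subgroup of G (i.e. the class of finite supersoluble groups is semiregular). -/

import Mathlib

universe u

/-- The factor group `B / A` is cyclic, for subgroups `A ≤ B` of an ambient group
with `A` normal in the ambient group. -/
def CyclicFactor {X : Type u} [Group X] (A B : Subgroup X) (hA : A.Normal) : Prop :=
  letI : (A.subgroupOf B).Normal := hA.subgroupOf B
  IsCyclic (↥B ⧸ A.subgroupOf B)

/-- `X` is supersoluble: there is a chain `1 = H₀ ≤ H₁ ≤ … ≤ H_k = X` of subgroups,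
each normal in `X`, with all factors `H_i / H_{i-1}` cyclic. -/
def IsSupersoluble (X : Type u) [Group X] : Prop :=
  ∃ (k : ℕ) (H : Fin (k + 1) → Subgroup X) (hnorm : ∀ i, (H i).Normal),
    H 0 = ⊥ ∧ H (Fin.last k) = ⊤ ∧ (∀ i : Fin k, H i.castSucc ≤ H i.succ) ∧
    ∀ i : Fin k, CyclicFactor (H i.castSucc) (H i.succ) (hnorm i.castSucc)

section
open Subgroup
set_option linter.unusedSectionVars false
set_option linter.unusedVariables false

inductive Reach {X : Type u} [Group X] : Subgroup X → Prop
  | bot : Reach ⊥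
  | step (A B : Subgroup X) : Reach A → B.Normal → A ≤ B →
      (∃ b ∈ B, ∀ c ∈ B, ∃ n : ℤ, (b ^ n)⁻¹ * c ∈ A) → Reach B

theorem Reach.normal {X : Type u} [Group X] {A : Subgroup X} (h : Reach A) : A.Normal := by
  cases h with
  | bot => infer_instance
  | step A B h1 h2 h3 h4 => exact h2

theorem cyclicFactor_iff {X : Type u} [Group X] (A B : Subgroup X) (hA : A.Normal) :
    CyclicFactor A B hA ↔ ∃ b ∈ B, ∀ c ∈ B, ∃ n : ℤ, (b ^ n)⁻¹ * c ∈ A := by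
  unfold CyclicFactor
  let _ : (A.subgroupOf B).Normal := hA.subgroupOf B
  constructor
  · rintro ⟨g, hg⟩
    obtain ⟨b, rfl⟩ := QuotientGroup.mk_surjective g
    refine ⟨b, b.2, fun c hc => ?_⟩
    obtain ⟨n, hn⟩ := hg (QuotientGroup.mk (⟨c, hc⟩ : B))
    refine ⟨n, ?_⟩
    have hn' : (QuotientGroup.mk (b ^ n) : B ⧸ A.subgroupOf B) = QuotientGroup.mk (⟨c, hc⟩ : B) := by
      simpa using hn
    rw [QuotientGroup.eq, mem_subgroupOf] at hn'
    simpa using hn'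
  · rintro ⟨b, hb, h⟩
    refine ⟨QuotientGroup.mk (⟨b, hb⟩ : B), fun c => ?_⟩
    obtain ⟨c, rfl⟩ := QuotientGroup.mk_surjective c
    obtain ⟨n, hn⟩ := h c c.2
    refine ⟨n, ?_⟩
    have : (QuotientGroup.mk ((⟨b, hb⟩ : B) ^ n) : B ⧸ A.subgroupOf B) = QuotientGroup.mk c := by
      rw [QuotientGroup.eq, mem_subgroupOf]
      simpa using hn
    simpa using this

theorem Reach.exists {X : Type u} [Group X] {B : Subgroup X} (h : Reach B) :
    ∃ (k : ℕ) (H : ℕ → Subgroup X), (∀ i, (H i).Normal) ∧ H 0 = ⊥ ∧ H k = B ∧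
      (∀ i < k, H i ≤ H (i+1)) ∧
      ∀ i < k, ∃ b ∈ H (i+1), ∀ c ∈ H (i+1), ∃ n : ℤ, (b ^ n)⁻¹ * c ∈ H i := by
  induction h with
  | bot => exact ⟨0, fun _ => ⊥, fun _ => inferInstance, rfl, rfl, by simp, by simp⟩
  | step A B h1 h2 h3 h4 ih =>
    obtain ⟨k, H, hn, h0, hk, hm, hc⟩ := ih
    refine ⟨k+1, fun i => if i ≤ k then H i else B, ?_, by simp [h0], by simp, ?_, ?_⟩
    · intro i
      by_cases h : i ≤ k
      · simpa [h] using hn i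
      · simpa [h] using h2
    · intro i hi
      rcases Nat.lt_succ_iff_lt_or_eq.mp hi with h | rfl
      · have h' : i ≤ k := by omega
        have h'' : i + 1 ≤ k := by omega
        simpa [h', h''] using hm i h
      · simpa [hk] using h3
    · intro i hi
      rcases Nat.lt_succ_iff_lt_or_eq.mp hi with h | rfl
      · have h' : i ≤ k := by omega
        have h'' : i + 1 ≤ k := by omega
        simpa [h', h''] using hc i h
      · simpa [hk] using h4

theorem isSupersoluble_iff (X : Type u) [Group X] : IsSupersoluble X ↔ Reach (⊤ : Subgroup X) := by
  constructor
  · rintro ⟨k, H, hn, h0, hk, hm, hc⟩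
    have : ∀ i : Fin (k+1), Reach (H i) := by
      intro i
      induction i using Fin.induction with
      | zero => rw [h0]; exact Reach.bot
      | succ i ih =>
        exact Reach.step _ _ ih (hn _) (hm i) ((cyclicFactor_iff _ _ _).1 (hc i))
    rw [← hk]; exact this _
  · intro h
    obtain ⟨k, H, hn, h0, hk, hm, hc⟩ := h.exists
    refine ⟨k, fun i => H i, fun i => hn i, by simpa using h0, by simpa using hk, ?_, ?_⟩
    · intro i; simpa using hm i i.2
    · intro i
      rw [cyclicFactor_iff]
      simpa using hc i i.2

theorem Reach.map {X Y : Type u} [Group X] [Group Y] (f : X →* Y) (hf : Function.Surjective f)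
    {A : Subgroup X} (h : Reach A) : Reach (A.map f) := by
  induction h with
  | bot => rw [Subgroup.map_bot]; exact Reach.bot
  | step A B h1 h2 h3 h4 ih =>
    refine Reach.step _ _ ih (h2.map f hf) (Subgroup.map_mono h3) ?_
    obtain ⟨b, hb, h⟩ := h4
    refine ⟨f b, mem_map_of_mem f hb, ?_⟩
    rintro _ ⟨c, hc, rfl⟩
    obtain ⟨n, hn⟩ := h c hc
    exact ⟨n, _, hn, by simp⟩

theorem cyc_of_le {X : Type u} [Group X] {C B : Subgroup X} (h : C ≤ B) {b : X} (hb : ∀ c ∈ B, ∃ n : ℤ, b ^ n = c) :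
    ∃ c0 ∈ C, ∀ c ∈ C, ∃ n : ℤ, c0 ^ n = c := by
  have h1 : C ≤ zpowers b := fun c hc => by
    obtain ⟨n, hn⟩ := hb c (h hc); exact ⟨n, hn⟩
  have : IsCyclic C := Subgroup.isCyclic_of_le h1
  obtain ⟨⟨g, hg⟩, hg'⟩ := this
  refine ⟨g, hg, fun c hc => ?_⟩
  obtain ⟨n, hn⟩ := hg' ⟨c, hc⟩
  exact ⟨n, by simpa using congrArg Subtype.val hn⟩

theorem cf_comap {X Y : Type u} [Group X] [Group Y] (f : Y →* X) (A B : Subgroup X) (hA : A.Normal)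
   (C : Subgroup Y) (hC : C ≤ B.comap f)
   (h : ∃ b ∈ B, ∀ c ∈ B, ∃ n : ℤ, (b ^ n)⁻¹ * c ∈ A) :
   ∃ b ∈ C, ∀ c ∈ C, ∃ n : ℤ, f ((b ^ n)⁻¹ * c) ∈ A := by
  obtain ⟨b, hb, h⟩ := h
  let g := (QuotientGroup.mk' A).comp f
  have := cyc_of_le (C := C.map g) (B := B.map (QuotientGroup.mk' A)) (b := QuotientGroup.mk' A b) ?_ ?_
  · obtain ⟨_, ⟨c0, hc0, rfl⟩, h2⟩ := this
    refine ⟨c0, hc0, fun c hc => ?_⟩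
    obtain ⟨n, hn⟩ := h2 (g c) (mem_map_of_mem g hc)
    refine ⟨n, ?_⟩
    have : g (c0^n) = g c := by simpa using hn
    have h3 : (QuotientGroup.mk (f (c0^n)) : X ⧸ A) = QuotientGroup.mk (f c) := this
    rw [QuotientGroup.eq] at h3
    simpa using h3
  · rintro _ ⟨c, hc, rfl⟩
    exact ⟨f c, hC hc, rfl⟩
  · rintro _ ⟨c, hc, rfl⟩
    obtain ⟨n, hn⟩ := h c hc
    refine ⟨n, ?_⟩
    have : (QuotientGroup.mk (b^n) : X ⧸ A) = QuotientGroup.mk c := by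
      rw [QuotientGroup.eq]; exact hn
    simpa using this

theorem Reach.comap {X Y : Type u} [Group X] [Group Y] (f : Y →* X) (hf : Function.Injective f)
    {A : Subgroup X} (h : Reach A) : Reach (A.comap f) := by
  induction h with
  | bot =>
    have : (⊥ : Subgroup X).comap f = ⊥ := by
      rw [eq_bot_iff]; intro y hy; exact hf (by simpa using hy)
    rw [this]; exact Reach.bot
  | step A B h1 h2 h3 h4 ih =>
    exact Reach.step _ _ ih (h2.comap f) (Subgroup.comap_mono h3)
      (cf_comap f A B h1.normal _ le_rfl h4)

theorem Reach.comap_surj {X Y : Type u} [Group X] [Group Y] (f : Y →* X) (hf : Function.Surjective f)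
    (hk : Reach f.ker)
    {A : Subgroup X} (h : Reach A) : Reach (A.comap f) := by
  induction h with
  | bot => exact hk
  | step A B h1 h2 h3 h4 ih =>
    exact Reach.step _ _ ih (h2.comap f) (Subgroup.comap_mono h3)
      (cf_comap f A B h1.normal _ le_rfl h4)

theorem ss_of_injective {X Y : Type u} [Group X] [Group Y] (f : Y →* X) (hf : Function.Injective f)
    (h : IsSupersoluble X) : IsSupersoluble Y := by
  rw [isSupersoluble_iff] at *
  simpa using Reach.comap f hf h

theorem ss_of_surjective {X Y : Type u} [Group X] [Group Y] (f : X →* Y) (hf : Function.Surjective f)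
    (h : IsSupersoluble X) : IsSupersoluble Y := by
  rw [isSupersoluble_iff] at *
  simpa [Subgroup.map_top_of_surjective f hf] using Reach.map f hf h

theorem ss_of_le {X : Type u} [Group X] {A B : Subgroup X} (h : A ≤ B) (hB : IsSupersoluble B) :
    IsSupersoluble A := ss_of_injective (Subgroup.inclusion h) (Subgroup.inclusion_injective h) hB

theorem ss_of_cyclic_normal {X : Type u} [Group X] (z : X) (hz : (zpowers z).Normal)
    (h : IsSupersoluble (X ⧸ zpowers z)) : IsSupersoluble X := by
  rw [isSupersoluble_iff] at *
  have := Reach.comap_surj (QuotientGroup.mk' (zpowers z)) (QuotientGroup.mk'_surjective _) ?_ h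
  · simpa using this
  · rw [QuotientGroup.ker_mk']
    refine Reach.step ⊥ _ Reach.bot hz bot_le ⟨z, mem_zpowers z, ?_⟩
    rintro _ ⟨n, rfl⟩
    exact ⟨n, by simp⟩

theorem ss_cyclic {X : Type u} [Group X] (z : X) (hz : zpowers z = ⊤) : IsSupersoluble X := by
  rw [isSupersoluble_iff]
  refine Reach.step ⊥ _ Reach.bot inferInstance bot_le ⟨z, mem_top z, ?_⟩
  intro c _
  obtain ⟨n, rfl⟩ : c ∈ zpowers z := by rw [hz]; trivial
  exact ⟨n, by simp⟩

theorem Reach.exists_cyc {X : Type u} [Group X] {N B : Subgroup X} (hN : N.Normal)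
    (h : Reach B) (hB : N ⊓ B ≠ ⊥) : ∃ z ∈ N, z ≠ 1 ∧ (zpowers z).Normal := by
  induction h with
  | bot => simp at hB
  | step A B h1 h2 h3 h4 ih =>
    by_cases hA : N ⊓ A = ⊥
    · obtain ⟨b, hb, h⟩ := cf_comap (MonoidHom.id X) A B h1.normal (N ⊓ B) inf_le_right h4
      have key : N ⊓ B = zpowers b := by
        apply le_antisymm
        · intro c hc
          obtain ⟨n, hn⟩ := h c hc
          have : (b^n)⁻¹ * c ∈ N ⊓ A :=
            ⟨N.mul_mem (N.inv_mem (N.zpow_mem hb.1 n)) hc.1, hn⟩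
          rw [hA, mem_bot, inv_mul_eq_one] at this
          exact ⟨n, this⟩
        · rw [zpowers_le]; exact hb
      refine ⟨b, hb.1, ?_, ?_⟩
      · rintro rfl; apply hB; rw [key]; simp
      · rw [← key]; infer_instance
    · exact ih hA

theorem ss_exists_prime {X : Type u} [Group X] [Finite X] (h : IsSupersoluble X) {N : Subgroup X}
    (hN : N.Normal) (hb : N ≠ ⊥) : ∃ z ∈ N, (orderOf z).Prime ∧ (zpowers z).Normal := by
  rw [isSupersoluble_iff] at h
  obtain ⟨z, hz, h1, h2⟩ := h.exists_cyc hN (by simpa using hb)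
  have h3 : orderOf z ≠ 1 := by simpa using h1
  obtain ⟨p, hp, d, hd⟩ := Nat.exists_prime_and_dvd h3
  have hpos := orderOf_pos z
  have hd0 : d ≠ 0 := by rintro rfl; rw [mul_zero] at hd; omega
  refine ⟨z^d, N.pow_mem hz d, ?_, ?_⟩
  · rw [orderOf_pow_of_dvd hd0 ⟨p, by rw [hd, mul_comm]⟩, hd, Nat.mul_div_cancel _ (Nat.pos_of_ne_zero hd0)]
    exact hp
  · constructor
    rintro _ ⟨n, rfl⟩ g
    obtain ⟨m, hm⟩ := h2.conj_mem z (mem_zpowers z) g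
    refine ⟨m * n, ?_⟩
    simp only at hm ⊢
    have : g * (z^d)^n * g⁻¹ = (g * z * g⁻¹)^(d*n) := by
      rw [conj_zpow, zpow_mul, zpow_natCast]
    rw [this, ← hm, ← zpow_mul, ← zpow_natCast, ← zpow_mul]
    congr 1; ring

def qel {G : Type u} [Group G] (q : ℕ) (s : G) : Prop := ∃ k : ℕ, s ^ (q ^ k) = 1
def cop {G : Type u} [Group G] (q : ℕ) (s : G) : Prop := ∃ m : ℕ, m.Coprime q ∧ s ^ m = 1

section
variable {G : Type u} [Group G] {q : ℕ}

theorem qel_one : qel q (1 : G) := ⟨0, by simp⟩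
theorem qel.inv {s : G} (h : qel q s) : qel q s⁻¹ := by
  obtain ⟨k, hk⟩ := h; exact ⟨k, by simp [hk]⟩
theorem qel.pow {s : G} (h : qel q s) (n : ℕ) : qel q (s^n) := by
  obtain ⟨k, hk⟩ := h; exact ⟨k, by rw [← pow_mul, mul_comm, pow_mul, hk, one_pow]⟩
theorem qel.zpow {s : G} (h : qel q s) (n : ℤ) : qel q (s^n) := by
  obtain ⟨k, hk⟩ := h
  exact ⟨k, by rw [← zpow_natCast, ← zpow_mul, mul_comm, zpow_mul, zpow_natCast, hk, one_zpow]⟩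
theorem qel.conj {s : G} (h : qel q s) (g : G) : qel q (g * s * g⁻¹) := by
  obtain ⟨k, hk⟩ := h; exact ⟨k, by rw [conj_pow, hk]; simp⟩
theorem qel.map {H : Type*} [Group H] {s : G} (h : qel q s) (f : G →* H) : ∃ k : ℕ, f s ^ (q^k) = 1 := by
  obtain ⟨k, hk⟩ := h; exact ⟨k, by rw [← map_pow, hk, map_one]⟩
theorem qel_of_pow {s : G} {k : ℕ} (h : qel q (s^(q^k))) : qel q s := by
  obtain ⟨l, hl⟩ := h; exact ⟨k + l, by rw [pow_add, pow_mul, hl]⟩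
theorem qel.mul {s t : G} (h : qel q s) (h' : qel q t) (hc : Commute s t) : qel q (s * t) := by
  obtain ⟨k, hk⟩ := h; obtain ⟨l, hl⟩ := h'
  refine ⟨k + l, ?_⟩
  rw [hc.mul_pow, pow_add]
  nth_rewrite 2 [mul_comm]
  rw [pow_mul, pow_mul, hk, hl]; simp
theorem qel_conj_iff {s : G} (g : G) : qel q (g * s * g⁻¹) ↔ qel q s := by
  refine ⟨fun h => ?_, fun h => h.conj g⟩
  have := h.conj g⁻¹
  simpa [mul_assoc] using this

theorem cop_one : cop q (1 : G) := ⟨1, by simp⟩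
theorem cop.inv {s : G} (h : cop q s) : cop q s⁻¹ := by
  obtain ⟨k, h1, hk⟩ := h; exact ⟨k, h1, by simp [hk]⟩
theorem cop.pow {s : G} (h : cop q s) (n : ℕ) : cop q (s^n) := by
  obtain ⟨k, h1, hk⟩ := h; exact ⟨k, h1, by rw [← pow_mul, mul_comm, pow_mul, hk, one_pow]⟩
theorem cop.conj {s : G} (h : cop q s) (g : G) : cop q (g * s * g⁻¹) := by
  obtain ⟨k, h1, hk⟩ := h; exact ⟨k, h1, by rw [conj_pow, hk]; simp⟩
theorem cop.map {H : Type u} [Group H] {s : G} (h : cop q s) (f : G →* H) : cop q (f s) := by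
  obtain ⟨k, h1, hk⟩ := h; exact ⟨k, h1, by rw [← map_pow, hk, map_one]⟩
theorem qel.map' {H : Type u} [Group H] {s : G} (h : qel q s) (f : G →* H) : qel q (f s) := h.map f

theorem pow_coprime_eq_one {s : G} {m n : ℕ} (h : m.Coprime n) (h1 : s ^ m = 1) (h2 : s ^ n = 1) : s = 1 := by
  have h3 := Nat.dvd_gcd (orderOf_dvd_of_pow_eq_one h1) (orderOf_dvd_of_pow_eq_one h2)
  rw [h] at h3
  simpa using h3

theorem qel.eq_one {s : G} (h : qel q s) (h' : cop q s) : s = 1 := by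
  obtain ⟨k, hk⟩ := h; obtain ⟨m, hm, h2⟩ := h'
  exact pow_coprime_eq_one (hm.pow_right k) h2 hk

theorem cop_of_prime_pow {p : ℕ} (hp : p.Prime) (hq : q.Prime) (hpq : p ≠ q) {x : G} {k : ℕ} (h : x ^ p^k = 1) :
    cop q x := ⟨p^k, ((Nat.coprime_primes hp hq).2 hpq).pow_left k, h⟩

/-- decomposition -/
theorem exists_decomp [Finite G] (hq : q.Prime) (x : G) : ∃ m n : ℕ, qel q (x^m) ∧ cop q (x^n) ∧ x^m * x^n = x := by
  obtain ⟨k, c, hc, ho⟩ := Nat.exists_eq_pow_mul_and_not_dvd (orderOf_pos x).ne' q hq.ne_one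
  have hcop : Nat.Coprime c (q^k) := ((Nat.Prime.coprime_iff_not_dvd hq).2 hc).symm.pow_right k
  obtain ⟨m, hm1, hm2⟩ := Nat.chineseRemainder hcop 0 1
  obtain ⟨n, hn1, hn2⟩ := Nat.chineseRemainder hcop 1 0
  refine ⟨m, n, ⟨k, ?_⟩, ⟨c, ((Nat.Prime.coprime_iff_not_dvd hq).2 hc).symm, ?_⟩, ?_⟩
  · rw [← pow_mul]
    apply orderOf_dvd_iff_pow_eq_one.1
    rw [ho, mul_comm]
    exact Nat.mul_dvd_mul ((Nat.modEq_zero_iff_dvd).1 hm1) dvd_rfl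
  · rw [← pow_mul]
    apply orderOf_dvd_iff_pow_eq_one.1
    rw [ho]
    exact Nat.mul_dvd_mul ((Nat.modEq_zero_iff_dvd).1 hn2) dvd_rfl
  · rw [← pow_add]
    conv_rhs => rw [← pow_one x]
    rw [pow_eq_pow_iff_modEq, ho, mul_comm, ← Nat.modEq_and_modEq_iff_modEq_mul hcop]
    exact ⟨by simpa using hm1.add hn1, by simpa using hm2.add hn2⟩

theorem quadratic {x t : G} (hx : cop q x) (hn : qel q (x * t * x⁻¹ * t⁻¹)) (hc : Commute x (x * t * x⁻¹ * t⁻¹)) :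
    x * t * x⁻¹ * t⁻¹ = 1 := by
  obtain ⟨m, hm, h1⟩ := hx
  set n := x * t * x⁻¹ * t⁻¹ with hndef
  have h0 : x * t * x⁻¹ = n * t := by rw [hndef]; group
  have key : ∀ k : ℕ, x^k * t * (x^k)⁻¹ = n^k * t := by
    intro k
    induction k with
    | zero => simp
    | succ k ih =>
      have : x^(k+1) * t * (x^(k+1))⁻¹ = x * (x^k * t * (x^k)⁻¹) * x⁻¹ := by
        rw [pow_succ' x k]; group
      rw [this, ih]
      have h2 : x * (n^k * t) * x⁻¹ = n^k * (x * t * x⁻¹) := by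
        have := (hc.pow_right k).eq
        calc x * (n^k * t) * x⁻¹ = (x * n^k) * t * x⁻¹ := by group
          _ = _ := by rw [this]; group
      rw [h2, h0, pow_succ]; group
  have h3 := key m
  rw [h1] at h3
  have h4 : n^m = 1 := by simpa using h3
  exact qel.eq_one hn ⟨m, hm, h4⟩

theorem quadratic' {x t : G} (hx : cop q x) (hn : qel q (x * t * x⁻¹ * t⁻¹)) (hc : Commute x (x * t * x⁻¹ * t⁻¹)) :
    Commute x t := by
  have := quadratic hx hn hc
  rw [mul_inv_eq_one, mul_inv_eq_iff_eq_mul] at this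
  exact this

def QC (q : ℕ) (H : Subgroup G) : Prop := ∀ s ∈ H, ∀ t ∈ H, qel q s → qel q t → qel q (s * t)

theorem isPGroup_iff_qel [Fact q.Prime] (H : Subgroup G) : IsPGroup q H ↔ ∀ s ∈ H, qel q s := by
  constructor
  · intro h s hs
    obtain ⟨k, hk⟩ := h ⟨s, hs⟩
    exact ⟨k, by simpa using congrArg Subtype.val hk⟩
  · rintro h ⟨s, hs⟩
    obtain ⟨k, hk⟩ := h s hs
    exact ⟨k, Subtype.ext (by simpa using hk)⟩

theorem nil_qel {H : Type u} [Group H] [Finite H] (hq : q.Prime) (h : ∀ x : H, ∃ k : ℕ, ∀ y, Commute (x^(q^k)) y)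
   (s t : H) (hs : qel q s) (ht : qel q t) : qel q (s * t) := by
  have : Fact q.Prime := ⟨hq⟩
  have h1 : IsPGroup q (H ⧸ center H) := by
    intro x
    obtain ⟨x, rfl⟩ := QuotientGroup.mk_surjective x
    obtain ⟨k, hk⟩ := h x
    refine ⟨k, ?_⟩
    rw [← QuotientGroup.mk_pow, QuotientGroup.eq_one_iff, mem_center_iff]
    intro y; exact (hk y).eq.symm
  have h2 : Group.IsNilpotent (H ⧸ center H) := h1.isNilpotent
  have h3 : Group.IsNilpotent H := Group.of_quotient_center_nilpotent h2
  have h4 := (Group.isNilpotent_of_finite_tfae (G := H)).out 0 3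
  have h5 := h4.1 h3 q ⟨hq⟩
  have P : Sylow q H := default
  have h6 : ∀ s : H, qel q s → s ∈ P := by
    intro s hs
    have : IsPGroup q (zpowers s) := by
      rw [isPGroup_iff_qel]
      rintro _ ⟨n, rfl⟩; exact hs.zpow n
    obtain ⟨Q, hQ⟩ := this.exists_le_sylow
    have := h5 P
    have := Sylow.unique_of_normal P inferInstance
    rw [Subsingleton.elim P Q]
    exact hQ (mem_zpowers s)
  exact (isPGroup_iff_qel (P : Subgroup H)).1 P.isPGroup' _ (mul_mem (h6 s hs) (h6 t ht))

theorem qel_closure {S : Set G} {H : Subgroup G} (hH : QC q H) (hSH : S ⊆ H) (hS : ∀ s ∈ S, qel q s) {x : G} (hx : x ∈ closure S) : qel q x := by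
  have : x ∈ H ∧ qel q x := by
    induction hx using closure_induction with
    | mem x hx => exact ⟨hSH hx, hS x hx⟩
    | one => exact ⟨H.one_mem, qel_one⟩
    | mul x y _ _ h1 h2 => exact ⟨H.mul_mem h1.1 h2.1, hH _ h1.1 _ h2.1 h1.2 h2.2⟩
    | inv x _ h1 => exact ⟨H.inv_mem h1.1, h1.2.inv⟩
  exact this.2

theorem commute_closure {S : Set G} {n x : G} (h : ∀ s ∈ S, Commute s n) (hx : x ∈ closure S) : Commute x n := by
  induction hx using closure_induction with
  | mem x hx => exact h x hx
  | one => exact Commute.one_left n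
  | mul x y _ _ h1 h2 => exact h1.mul_left h2
  | inv x _ h1 => exact h1.inv_left

theorem CE [Finite G] (hq : q.Prime) {N : Subgroup G} [N.Normal] (hQ : QC q (⊤ : Subgroup (G ⧸ N)))
    {s t : G} (hs : qel q s) (ht : qel q t) (hsN : ∀ n ∈ N, Commute s n) (htN : ∀ n ∈ N, Commute t n) :
    qel q (s * t) := by
  set H := closure ({s, t} : Set G)
  have hsH : s ∈ H := subset_closure (by simp)
  have htH : t ∈ H := subset_closure (by simp)
  have h1 : ∀ x : H, ∃ k : ℕ, ∀ y, Commute (x^(q^k)) y := by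
    rintro ⟨x, hx⟩
    have h2 : QuotientGroup.mk' N x ∈ closure (QuotientGroup.mk' N '' {s, t}) := by
      rw [← MonoidHom.map_closure]; exact mem_map_of_mem _ hx
    have h3 := qel_closure hQ (by simp) ?_ h2
    · obtain ⟨k, hk⟩ := h3
      refine ⟨k, ?_⟩
      rw [← map_pow] at hk
      have hk' : x^(q^k) ∈ N := by
        rw [← QuotientGroup.eq_one_iff]; exact hk
      rintro ⟨y, hy⟩
      have : Commute y (x^(q^k)) := by
        refine commute_closure (S := {s,t}) ?_ hy
        rintro z (rfl | rfl)
        · exact hsN _ hk'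
        · exact htN _ hk'
      exact Subtype.ext this.eq.symm
    · rintro _ ⟨z, (rfl | rfl), rfl⟩
      · exact hs.map' _
      · exact ht.map' _
  have h2 := nil_qel hq h1 ⟨s, hsH⟩ ⟨t, htH⟩ ?_ ?_
  · obtain ⟨k, hk⟩ := h2; exact ⟨k, by simpa using congrArg Subtype.val hk⟩
  · obtain ⟨k, hk⟩ := hs; exact ⟨k, Subtype.ext (by simpa using hk)⟩
  · obtain ⟨k, hk⟩ := ht; exact ⟨k, Subtype.ext (by simpa using hk)⟩

theorem qel_commute_prime (hq : q.Prime) {z s : G} (hz : (orderOf z).Prime) (hzq : orderOf z < q)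
    (hs : qel q s) {m : ℤ} (hm : s * z * s⁻¹ = z ^ m) : Commute s z := by
  have : Fact (orderOf z).Prime := ⟨hz⟩
  have key : ∀ k : ℕ, s^k * z * (s^k)⁻¹ = z ^ (m^k) := by
    intro k
    induction k with
    | zero => simp
    | succ k ih =>
      have : s^(k+1) * z * (s^(k+1))⁻¹ = s * (s^k * z * (s^k)⁻¹) * s⁻¹ := by
        rw [pow_succ' s k]; group
      rw [this, ih, ← conj_zpow, hm, ← zpow_mul, pow_succ']
  obtain ⟨k, hk⟩ := hs
  have h1 := key (q^k)
  rw [hk] at h1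
  have h1 : z ^ (1:ℤ) = z ^ m^(q^k) := by simpa using h1
  rw [zpow_eq_zpow_iff_modEq, ← ZMod.intCast_eq_intCast_iff] at h1
  push_cast at h1
  have hm0 : (m : ZMod (orderOf z)) ≠ 0 := by
    intro h; rw [h, zero_pow (pow_ne_zero _ hq.ne_zero)] at h1; exact one_ne_zero h1
  have h2 := ZMod.pow_card_sub_one_eq_one hm0
  have hcop : Nat.Coprime (q^k) (orderOf z - 1) := by
    apply Nat.Coprime.pow_left
    rw [hq.coprime_iff_not_dvd]
    intro h
    have := Nat.le_of_dvd (by have := hz.two_le; omega) h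
    omega
  have h3 : (m : ZMod (orderOf z)) = 1 := by
    let u := Units.mk0 _ hm0
    have : u = 1 := by
      refine pow_coprime_eq_one hcop ?_ ?_
      · ext; simpa [u] using h1.symm
      · ext; simpa [u] using h2
    simpa [u] using congrArg Units.val this
  have h4 : z ^ m = z ^ (1:ℤ) := by
    rw [zpow_eq_zpow_iff_modEq, ← ZMod.intCast_eq_intCast_iff]
    simpa using h3
  rw [h4, zpow_one, mul_inv_eq_iff_eq_mul] at hm
  exact hm
end

theorem S3 {q : ℕ} (hq : q.Prime) : ∀ (n : ℕ) (X : Type u) [Group X] [Finite X], Nat.card X = n → IsSupersoluble X →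
    (∀ r : ℕ, r.Prime → r ∣ Nat.card X → r ≤ q) → QC q (⊤ : Subgroup X) := by
  intro n
  induction n using Nat.strong_induction_on with
  | _ n ih =>
  intro X _ _ hn hX hr s _ t _ hs ht
  by_cases htriv : (⊤ : Subgroup X) = ⊥
  · have : s * t ∈ (⊤ : Subgroup X) := mem_top _
    rw [htriv, mem_bot] at this
    rw [this]; exact qel_one
  obtain ⟨z, -, hz, hzn⟩ := ss_exists_prime hX inferInstance htriv
  have hcard : Nat.card (X ⧸ zpowers z) * orderOf z = Nat.card X := by
    rw [← Nat.card_zpowers]; exact (card_eq_card_quotient_mul_card_subgroup _).symm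
  have hpos : 0 < Nat.card (X ⧸ zpowers z) := Nat.card_pos
  have hlt : Nat.card (X ⧸ zpowers z) < n := by
    have := hz.two_le
    rw [← hn, ← hcard]; nlinarith
  have hQ : QC q (⊤ : Subgroup (X ⧸ zpowers z)) := by
    refine ih _ hlt _ rfl (ss_of_surjective (QuotientGroup.mk' _) (QuotientGroup.mk'_surjective _) hX) ?_
    intro r hrp hrd
    exact hr r hrp (hcard ▸ hrd.mul_right _)
  have hzq : orderOf z ≤ q := hr _ hz (hcard ▸ dvd_mul_left _ _)
  rcases hzq.lt_or_eq with h | h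
  · have hc : ∀ s : X, qel q s → ∀ n ∈ zpowers z, Commute s n := by
      rintro s hs _ ⟨n, rfl⟩
      obtain ⟨m, hm⟩ := hzn.conj_mem z (mem_zpowers z) s
      exact (qel_commute_prime hq hz h hs hm.symm).zpow_right n
    exact CE hq hQ hs ht (hc s hs) (hc t ht)
  · obtain ⟨k, hk⟩ := hQ _ (mem_top _) _ (mem_top _) (hs.map' (QuotientGroup.mk' (zpowers z))) (ht.map' (QuotientGroup.mk' (zpowers z)))
    rw [← map_mul, ← map_pow] at hk
    have hk' : (s * t)^(q^k) ∈ zpowers z := by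
      rw [← QuotientGroup.eq_one_iff]; exact hk
    obtain ⟨m, hm⟩ := hk'
    refine qel_of_pow (k := k) ?_
    rw [← hm]
    exact qel.zpow ⟨1, by rw [pow_one, ← h]; exact pow_orderOf_eq_one z⟩ m

def Egen {X : Type u} [Group X] (q : ℕ) (H : Subgroup X) : Subgroup X :=
  closure {z | ∃ a ∈ H, ∃ b ∈ H, z = a * b * a⁻¹ * b⁻¹ ∨ z = a ^ (q-1)}

theorem Egen_map {X Y : Type u} [Group X] [Group Y] {q : ℕ} (f : X →* Y) {H : Subgroup X} {e : X} (he : e ∈ Egen q H) :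
    f e ∈ Egen q (H.map f) := by
  have : (Egen q H).map f ≤ Egen q (H.map f) := by
    unfold Egen
    rw [MonoidHom.map_closure, closure_le]
    rintro _ ⟨_, ⟨a, ha, b, hb, rfl | rfl⟩, rfl⟩
    · exact subset_closure ⟨f a, mem_map_of_mem f ha, f b, mem_map_of_mem f hb, Or.inl (by simp)⟩
    · exact subset_closure ⟨f a, mem_map_of_mem f ha, f b, mem_map_of_mem f hb, Or.inr (by simp)⟩
  exact this (mem_map_of_mem f he)

theorem Egen_mono {X : Type u} [Group X] {q : ℕ} {H K : Subgroup X} (h : H ≤ K) : Egen q H ≤ Egen q K := by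
  apply Subgroup.closure_mono
  rintro _ ⟨a, ha, b, hb, hh⟩
  exact ⟨a, h ha, b, h hb, hh⟩

theorem Egen_commute {X : Type u} [Group X] {q : ℕ} (hq : q.Prime) {z : X} (hz : orderOf z = q) {H : Subgroup X}
    (hH : ∀ h ∈ H, h * z * h⁻¹ ∈ zpowers z) {e : X} (he : e ∈ Egen q H) : Commute e z := by
  have : Fact q.Prime := ⟨hq⟩
  have conjm : ∀ a m (_ : a * z * a⁻¹ = z^m) (n : ℤ), a * z^n * a⁻¹ = z^(m * n) := by
    intro a m h n
    rw [← conj_zpow, h, zpow_mul]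
  refine commute_closure ?_ he
  rintro _ ⟨a, ha, b, hb, rfl | rfl⟩
  · obtain ⟨m, hm⟩ := hH a ha
    obtain ⟨l, hl⟩ := hH b hb
    have h1 := conjm a m hm.symm l
    have h2 := conjm b l hl.symm m
    have hl' : b * z * b⁻¹ = z^l := hl.symm
    have hm' : a * z * a⁻¹ = z^m := hm.symm
    have h3 : (a * b) * z * (a * b)⁻¹ = (b * a) * z * (b * a)⁻¹ := by
      calc (a * b) * z * (a * b)⁻¹ = a * (b * z * b⁻¹) * a⁻¹ := by group
        _ = b * (a * z * a⁻¹) * b⁻¹ := by rw [hl', hm', h1, h2, mul_comm]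
        _ = _ := by group
    rw [commute_iff_eq]
    have h4 : z = (b*a)⁻¹ * ((a * b) * z * (a * b)⁻¹) * (b * a) := by rw [h3]; group
    have : (a * b * a⁻¹ * b⁻¹) = (a*b)*(b*a)⁻¹ := by group
    have h5 : (a*b) * z * (a * b)⁻¹ * (b * a) = (b * a) * z := by rw [h3]; group
    have h6 : (b*a)⁻¹ * ((a*b) * z) = z * ((b*a)⁻¹ * (a * b)) := by
      have : (a*b) * z = (b*a) * z * (b*a)⁻¹ * (a*b) := by rw [← h3]; group
      rw [this]; group
    -- centralizes after commuting
    have h7 : ∀ n : ℤ, (b*a)⁻¹ * (a*b) * z^n = z^n * ((b*a)⁻¹ * (a*b)) := by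
      intro n
      have : Commute ((b*a)⁻¹ * (a*b)) z := by rw [commute_iff_eq, mul_assoc, h6]
      exact (this.zpow_right n).eq
    have hz2 : ∃ n : ℤ, (b*a)⁻¹ * z * (b * a) = z^n := by
      have e1 : (b*a) * z * (b*a)⁻¹ = z^(l * m) := by
        rw [← h2, ← hm']; group
      -- conj by b*a injective on finite set: use order
      have hlm : ((l * m : ℤ) : ZMod q) ≠ 0 := by
        intro h
        rw [ZMod.intCast_zmod_eq_zero_iff_dvd, ← hz] at h
        rw [orderOf_dvd_iff_zpow_eq_one.1 h] at e1
        have : z = 1 := by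
          have h9 : z = (b*a)⁻¹ * 1 * (b*a) := by rw [← e1]; group
          simpa using h9
        rw [this, orderOf_one] at hz
        exact hq.ne_one hz.symm
      obtain ⟨n, hn⟩ := ZMod.intCast_surjective ((l * m : ℤ) : ZMod q)⁻¹
      refine ⟨n, ?_⟩
      have : z = (z^(l*m))^n := by
        rw [← zpow_mul]
        conv_lhs => rw [← zpow_one z]
        rw [zpow_eq_zpow_iff_modEq, hz, ← ZMod.intCast_eq_intCast_iff]
        push_cast at hlm ⊢
        rw [hn]
        push_cast
        exact (mul_inv_cancel₀ hlm).symm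
      have e2 : (b*a)⁻¹ * z^(l*m) * (b*a) = z := by rw [← e1]; group
      calc (b*a)⁻¹ * z * (b * a) = (b*a)⁻¹ * (z^(l*m))^n * (b * a) := by rw [← this]
        _ = ((b*a)⁻¹ * z^(l*m) * (b*a))^n := by
            have := conj_zpow (a := (b*a)⁻¹) (b := z^(l*m)) (i := n)
            simpa using this.symm
        _ = z^n := by rw [e2]
    obtain ⟨n, hn⟩ := hz2
    have h8 := h7 n
    rw [this]
    rw [← hn] at h8
    have : (a*b) * (b*a)⁻¹ * z = (b*a) * ((b*a)⁻¹ * (a*b) * ((b*a)⁻¹ * z * (b*a))) * (b*a)⁻¹ := by group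
    rw [this, h8]; group
  · obtain ⟨m, hm⟩ := hH a ha
    have hm' : a * z * a⁻¹ = z^m := hm.symm
    have key : ∀ k : ℕ, a^k * z * (a^k)⁻¹ = z ^ (m^k) := by
      intro k
      induction k with
      | zero => simp
      | succ k ih =>
        have : a^(k+1) * z * (a^(k+1))⁻¹ = a * (a^k * z * (a^k)⁻¹) * a⁻¹ := by
          rw [pow_succ' a k]; group
        rw [this, ih, ← conj_zpow, hm', ← zpow_mul, pow_succ']
    have hm0 : (m : ZMod q) ≠ 0 := by
      intro h
      rw [ZMod.intCast_zmod_eq_zero_iff_dvd, ← hz] at h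
      rw [orderOf_dvd_iff_zpow_eq_one.1 h] at hm'
      have : z = 1 := by simpa using hm'
      rw [this, orderOf_one] at hz
      exact hq.ne_one hz.symm
    have h1 := key (q-1)
    have h2 : z ^ m^(q-1) = z ^ (1:ℤ) := by
      rw [zpow_eq_zpow_iff_modEq, hz, ← ZMod.intCast_eq_intCast_iff]
      push_cast
      exact ZMod.pow_card_sub_one_eq_one hm0
    rw [h2, zpow_one, mul_inv_eq_iff_eq_mul] at h1
    exact h1

theorem S4 {q : ℕ} (hq : q.Prime) : ∀ (n : ℕ) (X : Type u) [Group X] [Finite X], Nat.card X = n → IsSupersoluble X →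
    ∀ N : Subgroup X, N.Normal → (∀ s ∈ N, qel q s) → ∀ e ∈ Egen q (⊤ : Subgroup X), cop q e → ∀ s ∈ N, Commute e s := by
  intro n
  induction n using Nat.strong_induction_on with
  | _ n ih =>
  intro X _ _ hn hX N hN hNq e he hec s hs
  by_cases htriv : N = ⊥
  · rw [htriv, mem_bot] at hs
    rw [hs]; exact Commute.one_right e
  obtain ⟨z, hzN, hz, hzn⟩ := ss_exists_prime hX hN htriv
  have hzq : orderOf z = q := by
    obtain ⟨k, hk⟩ := hNq z hzN
    have := orderOf_dvd_of_pow_eq_one hk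
    exact (Nat.prime_dvd_prime_iff_eq hz hq).1 (hz.dvd_of_dvd_pow this)
  have hcard : Nat.card (X ⧸ zpowers z) * orderOf z = Nat.card X := by
    rw [← Nat.card_zpowers]; exact (card_eq_card_quotient_mul_card_subgroup _).symm
  have hpos : 0 < Nat.card (X ⧸ zpowers z) := Nat.card_pos
  have hlt : Nat.card (X ⧸ zpowers z) < n := by
    have := hz.two_le
    rw [← hn, ← hcard]; nlinarith
  have hsurj := QuotientGroup.mk'_surjective (zpowers z)
  have h1 := ih _ hlt (X ⧸ zpowers z) rfl (ss_of_surjective _ hsurj hX) (N.map (QuotientGroup.mk' (zpowers z)))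
    (hN.map _ hsurj) (by rintro _ ⟨s, hs, rfl⟩; exact (hNq s hs).map' _) (QuotientGroup.mk' _ e)
    (by simpa [Subgroup.map_top_of_surjective _ hsurj] using Egen_map (QuotientGroup.mk' (zpowers z)) he) (hec.map _)
    (QuotientGroup.mk' _ s) (mem_map_of_mem _ hs)
  have h2 : e * s * e⁻¹ * s⁻¹ ∈ zpowers z := by
    rw [← QuotientGroup.eq_one_iff]
    have : QuotientGroup.mk' (zpowers z) (e * s * e⁻¹ * s⁻¹) = 1 := by
      rw [map_mul, map_mul, map_mul, h1.eq]; simp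
    exact this
  have h3 : Commute e z := Egen_commute hq hzq (fun h _ => hzn.conj_mem z (mem_zpowers z) h) he
  obtain ⟨m, hm⟩ := h2
  refine quadratic' hec ?_ ?_
  · rw [← hm]; exact (hNq z hzN).zpow m
  · rw [← hm]; exact h3.zpow_right m

section
variable {G : Type u} [Group G] {q : ℕ}

abbrev Nm (H : Subgroup G) : Subgroup G := normalizer (H : Set G)

theorem mem_Nm [Finite G] {H : Subgroup G} {g : G} : g ∈ Nm H ↔ ∀ h ∈ H, g * h * g⁻¹ ∈ H := by
  rw [mem_normalizer_iff]
  constructor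
  · intro h x hx; exact (h x).1 hx
  · intro h x
    refine ⟨h x, fun hx => ?_⟩
    have hk : ∀ k : ℕ, ∀ x ∈ H, g^k * x * (g^k)⁻¹ ∈ H := by
      intro k
      induction k with
      | zero => intro x hx; simpa using hx
      | succ k ih =>
        intro x hx
        have := h _ (ih x hx)
        have e : g^(k+1) * x * (g^(k+1))⁻¹ = g * (g^k * x * (g^k)⁻¹) * g⁻¹ := by rw [pow_succ' g k]; group
        rw [e]; exact this
    have h1 := hk (orderOf g - 1) _ hx
    have h2 : g^(orderOf g - 1) = g⁻¹ := by
      rw [eq_inv_iff_mul_eq_one, ← pow_succ, Nat.sub_add_cancel (orderOf_pos g), pow_orderOf_eq_one]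
    rw [h2] at h1
    simpa [mul_assoc] using h1

theorem Nm_conj {H : Subgroup G} {g x : G} (hg : g ∈ Nm H) (hx : x ∈ H) : g * x * g⁻¹ ∈ H :=
  (mem_normalizer_iff.1 hg x).1 hx
theorem Nm_conj' {H : Subgroup G} {g x : G} (hg : g ∈ Nm H) (hx : x ∈ H) : g⁻¹ * x * g ∈ H := by
  have := Nm_conj ((Nm H).inv_mem hg) hx
  simpa using this
theorem le_Nm (H : Subgroup G) : H ≤ Nm H := le_normalizer

theorem Nm_top {H : Subgroup G} (h : Nm H = ⊤) : H.Normal := by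
  rwa [normalizer_eq_top_iff] at h

def QG (q : ℕ) (H : Subgroup G) : Prop := ∀ s ∈ H, qel q s
def Syl (q : ℕ) (Q : Subgroup G) : Prop := QG q Q ∧ ∀ R : Subgroup G, QG q R → Q ≤ R → R = Q
def cj (g : G) (H : Subgroup G) : Subgroup G := H.map (MulAut.conj g).toMonoidHom

theorem mem_cj {g x : G} {H : Subgroup G} : x ∈ cj g H ↔ g⁻¹ * x * g ∈ H := by
  unfold cj
  constructor
  · rintro ⟨y, hy, rfl⟩; simpa [mul_assoc] using hy
  · intro h; exact ⟨_, h, by simp [mul_assoc]⟩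
theorem conj_mem_cj {g x : G} {H : Subgroup G} : g * x * g⁻¹ ∈ cj g H ↔ x ∈ H := by
  rw [mem_cj]; simp [mul_assoc]
theorem cj_cj (g h : G) (H : Subgroup G) : cj g (cj h H) = cj (g * h) H := by
  ext x; simp [mem_cj, mul_assoc]
theorem cj_one (H : Subgroup G) : cj 1 H = H := by
  ext x; simp [mem_cj]
theorem cj_mono {g : G} {H K : Subgroup G} (h : H ≤ K) : cj g H ≤ cj g K := by
  intro x hx; rw [mem_cj] at *; exact h hx
theorem cj_eq_iff {g : G} {H : Subgroup G} : cj g H = H ↔ g ∈ Nm H := by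
  rw [mem_normalizer_iff]
  constructor
  · intro h x
    conv_rhs => rw [← SetLike.mem_coe, SetLike.mem_coe, ← h]
    exact conj_mem_cj.symm
  · intro h; ext x
    rw [mem_cj, h]; simp [mul_assoc]
theorem cj_le_iff {g : G} {H K : Subgroup G} : cj g H ≤ K ↔ H ≤ cj g⁻¹ K := by
  constructor
  · intro h; have := cj_mono (g := g⁻¹) h; rwa [cj_cj, inv_mul_cancel, cj_one] at this
  · intro h; have := cj_mono (g := g) h; rwa [cj_cj, mul_inv_cancel, cj_one] at this
theorem mem_Nm_cj {g x : G} {H : Subgroup G} : g * x * g⁻¹ ∈ Nm (cj g H) ↔ x ∈ Nm H := by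
  rw [← cj_eq_iff, ← cj_eq_iff, cj_cj]
  have : g * x * g⁻¹ * g = g * x := by group
  rw [this, ← cj_cj]
  constructor
  · intro h; have := congrArg (cj g⁻¹) h; simpa [cj_cj, cj_one] using this
  · intro h; rw [h]
theorem cj_bot (g : G) : cj g (⊥ : Subgroup G) = ⊥ := by
  simp [cj]
theorem cj_inf (g : G) (H K : Subgroup G) : cj g (H ⊓ K) = cj g H ⊓ cj g K := by
  ext x; simp [mem_cj, mem_inf]
theorem QG.cj {H : Subgroup G} (h : QG q H) (g : G) : QG q (cj g H) := by
  intro s hs; rw [mem_cj] at hs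
  have := (h _ hs).conj g
  simpa [mul_assoc] using this
theorem Syl.cj {H : Subgroup G} (h : Syl q H) (g : G) : Syl q (_root_.cj g H) := by
  refine ⟨h.1.cj g, fun R hR hle => ?_⟩
  rw [cj_le_iff] at hle
  have := h.2 _ (hR.cj g⁻¹) hle
  rw [← this, cj_cj]; simp [cj_one]
theorem QG.mono {H K : Subgroup G} (hK : QG q K) (h : H ≤ K) : QG q H := fun s hs => hK s (h hs)
theorem QG_bot : QG q (⊥ : Subgroup G) := by intro s hs; rw [mem_bot] at hs; rw [hs]; exact qel_one

theorem QG.sup (hq : q.Prime) {H K : Subgroup G} (hH : QG q H) (hK : QG q K) (h : K ≤ Nm H) : QG q (H ⊔ K) := by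
  have : Fact q.Prime := ⟨hq⟩
  rw [QG, ← isPGroup_iff_qel] at *
  exact hH.to_sup_of_normal_left' hK h

theorem QG_zpowers {s : G} (h : qel q s) : QG q (zpowers s) := by
  rintro _ ⟨n, rfl⟩; exact h.zpow n

theorem exists_Syl [Finite G] {H : Subgroup G} (hH : QG q H) : ∃ Q, Syl q Q ∧ H ≤ Q := by
  obtain ⟨m, h1, h2⟩ := (Set.toFinite {K : Subgroup G | QG q K}).exists_le_maximal (show H ∈ _ from hH)
  exact ⟨m, ⟨h2.1, fun R hR hle => le_antisymm (h2.2 hR hle) hle⟩, h1⟩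

theorem Syl.eq_of_le {Q R : Subgroup G} (hQ : Syl q Q) (hR : QG q R) (h : Q ≤ R) : Q = R := (hQ.2 R hR h).symm

theorem Syl.exists_sylow [Fact q.Prime] {Q : Subgroup G} (h : Syl q Q) : ∃ P : Sylow q G, (P : Subgroup G) = Q :=
  ⟨⟨Q, (isPGroup_iff_qel Q).2 h.1, fun {R} hR hle => h.2 R ((isPGroup_iff_qel R).1 hR) hle⟩, rfl⟩

theorem Syl.conj [Finite G] (hq : q.Prime) {Q R : Subgroup G} (hQ : Syl q Q) (hR : Syl q R) : ∃ g, _root_.cj g Q = R := by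
  have : Fact q.Prime := ⟨hq⟩
  obtain ⟨P, rfl⟩ := hQ.exists_sylow
  obtain ⟨P', rfl⟩ := hR.exists_sylow
  obtain ⟨g, hg⟩ := MulAction.exists_smul_eq G P P'
  refine ⟨g, ?_⟩
  rw [← hg]
  rfl

/-- conjugacy of maximal q-subgroups in a subgroup -/
theorem max_conj [Finite G] (hq : q.Prime) {K A B : Subgroup G} (hA : QG q A) (hB : QG q B) (hAK : A ≤ K) (hBK : B ≤ K)
    (hAm : ∀ R, QG q R → R ≤ K → A ≤ R → R = A) (hBm : ∀ R, QG q R → R ≤ K → B ≤ R → R = B) : ∃ g ∈ K, cj g A = B := by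
  have key : ∀ A : Subgroup G, QG q A → A ≤ K → (∀ R, QG q R → R ≤ K → A ≤ R → R = A) → Syl q (A.subgroupOf K) := by
    intro A hA hAK hAm
    refine ⟨?_, ?_⟩
    · rintro ⟨s, hs⟩ h
      rw [mem_subgroupOf] at h
      obtain ⟨k, hk⟩ := hA s h
      exact ⟨k, Subtype.ext (by simpa using hk)⟩
    · intro R hR hle
      have := hAm (R.map K.subtype) ?_ ?_ ?_
      · rw [← this]
        ext x
        simp [mem_subgroupOf]
      · rintro _ ⟨s, hs, rfl⟩
        exact (hR s hs).map' _
      · rintro _ ⟨s, hs, rfl⟩; exact s.2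
      · intro a ha
        exact ⟨⟨a, hAK ha⟩, hle (by simpa [mem_subgroupOf] using ha), rfl⟩
  obtain ⟨g, hg⟩ := (key A hA hAK hAm).conj hq (key B hB hBK hBm)
  refine ⟨g, g.2, ?_⟩
  ext x
  constructor
  · intro hx
    have hxK : x ∈ K := by
      rw [mem_cj] at hx
      have := K.mul_mem (K.mul_mem g.2 (hAK hx)) (K.inv_mem g.2)
      simpa [mul_assoc] using this
    have : (⟨x, hxK⟩ : K) ∈ cj g (A.subgroupOf K) := by
      rw [mem_cj, mem_subgroupOf]; rw [mem_cj] at hx; simpa using hx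
    rw [hg, mem_subgroupOf] at this
    exact this
  · intro hx
    have : (⟨x, hBK hx⟩ : K) ∈ B.subgroupOf K := by rw [mem_subgroupOf]; exact hx
    rw [← hg, mem_cj, mem_subgroupOf] at this
    rw [mem_cj]; simpa using this

theorem exists_norm [Finite G] (hq : q.Prime) {Q R : Subgroup G} (hQ : QG q Q) (hlt : R < Q) : ∃ g ∈ Q, g ∉ R ∧ g ∈ Nm R := by
  have : Fact q.Prime := ⟨hq⟩
  have h1 : IsPGroup q Q := (isPGroup_iff_qel Q).2 hQ
  have h2 : Group.IsNilpotent Q := h1.isNilpotent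
  have h3 := Group.normalizerCondition_of_isNilpotent (G := Q)
  have h4 : R.subgroupOf Q < ⊤ := by
    rw [lt_top_iff_ne_top]
    intro h
    rw [subgroupOf_eq_top] at h
    exact hlt.not_ge h
  have h5 := h3 _ h4
  obtain ⟨⟨g, hg⟩, h6, h7⟩ := SetLike.exists_of_lt h5
  refine ⟨g, hg, by simpa [mem_subgroupOf] using h7, ?_⟩
  rw [mem_Nm]
  intro r hr
  have := (mem_normalizer_iff.1 h6 ⟨r, hlt.le hr⟩).1 (by simpa [mem_subgroupOf] using hr)
  simpa [mem_subgroupOf] using this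

theorem Syl.mem_of_Nm (hq : q.Prime) {Q : Subgroup G} (hQ : Syl q Q) {s : G} (hs : qel q s) (hn : s ∈ Nm Q) : s ∈ Q := by
  have := hQ.eq_of_le (hQ.1.sup hq (QG_zpowers hs) (by rwa [zpowers_le])) le_sup_left
  rw [this]; exact mem_sup_right (mem_zpowers s)

theorem exists_center [Finite G] (hq : q.Prime) {Q : Subgroup G} (hQ : QG q Q) (hb : Q ≠ ⊥) : ∃ z ∈ Q, z ≠ 1 ∧ ∀ s ∈ Q, Commute z s := by
  have : Fact q.Prime := ⟨hq⟩
  have h1 : IsPGroup q Q := (isPGroup_iff_qel Q).2 hQ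
  have : Nontrivial Q := (nontrivial_iff_ne_bot Q).2 hb
  have h2 := h1.center_nontrivial
  obtain ⟨⟨⟨z, hz⟩, h3⟩, h4⟩ := exists_ne (1 : center Q)
  refine ⟨z, hz, fun h => h4 (by ext; simpa using h), fun s hs => ?_⟩
  have := (mem_center_iff.1 h3 ⟨s, hs⟩)
  exact (congrArg Subtype.val this).symm

theorem QG.card [Finite G] (hq : q.Prime) {D : Subgroup G} (hD : QG q D) : ∃ n, Nat.card D = q ^ n := by
  have : Fact q.Prime := ⟨hq⟩
  exact IsPGroup.iff_card.1 ((isPGroup_iff_qel D).2 hD)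

theorem fixedpt [Finite G] {p : ℕ} (hp : p.Prime) {S : Set G} (hS : ¬ p ∣ S.ncard) (f : G → G) (hf : ∀ s ∈ S, f s ∈ S) {k : ℕ}
    (hk : ∀ s ∈ S, f^[p^k] s = s) : ∃ s ∈ S, f s = s := by
  classical
  have : Fact p.Prime := ⟨hp⟩
  have : Fintype S := Fintype.ofFinite S
  let F : Function.End S := fun s => ⟨f s, hf s s.2⟩
  have hF : ∀ n (s : S), ((F ^ n) s : G) = f^[n] s := by
    intro n
    induction n with
    | zero => intro s; rfl
    | succ n ih => intro s; rw [pow_succ']; show f ((F^n) s) = _; rw [ih, Function.iterate_succ_apply']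
  have h1 : F ^ p^k = 1 := by
    funext s; apply Subtype.ext; rw [hF, hk s s.2]; rfl
  have h2 := Equiv.Perm.card_fixedPoints_modEq h1
  by_contra hcon
  push Not at hcon
  have h3 : Fintype.card (Function.fixedPoints F) = 0 := by
    rw [Fintype.card_eq_zero_iff]
    constructor
    rintro ⟨s, hs⟩
    exact hcon s s.2 (congrArg Subtype.val hs)
  rw [h3, Nat.modEq_zero_iff_dvd] at h2
  apply hS
  rwa [← Nat.card_coe_set_eq, Nat.card_eq_fintype_card]

theorem coset_ncard [Finite G] {p : ℕ} (hp : p.Prime) (hq : q.Prime) (hpq : p ≠ q) {D : Subgroup G} (hD : QG q D) (s : G) :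
    ¬ p ∣ ((fun d => s * d) '' (D : Set G)).ncard := by
  rw [Set.ncard_image_of_injective _ (mul_right_injective s), ← Nat.card_coe_set_eq]
  obtain ⟨n, hn⟩ := hD.card hq
  have : Nat.card (D : Set G) = q^n := hn
  rw [this]
  intro h
  exact hpq ((Nat.prime_dvd_prime_iff_eq hp hq).1 (hp.dvd_of_dvd_pow h))

theorem FP [Finite G] {p : ℕ} (hp : p.Prime) (hq : q.Prime) (hpq : p ≠ q) {D : Subgroup G} (hD : QG q D) {x s : G} (hx : qel p x)
    (hxD : x ∈ Nm D) (hs : s⁻¹ * (x * s * x⁻¹) ∈ D) : ∃ d ∈ D, Commute x (s * d) := by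
  obtain ⟨k, hk⟩ := hx
  have key := fixedpt hp (coset_ncard hp hq hpq hD s) (fun g => x * g * x⁻¹) (k := k) ?_ ?_
  · obtain ⟨_, ⟨d, hd, rfl⟩, h⟩ := key
    refine ⟨d, hd, ?_⟩
    exact mul_inv_eq_iff_eq_mul.1 h
  · rintro _ ⟨d, hd, rfl⟩
    refine ⟨s⁻¹ * (x * s * x⁻¹) * (x * d * x⁻¹), D.mul_mem hs (Nm_conj hxD hd), by simp only; group⟩
  · rintro g -
    have : ∀ n, (fun g => x * g * x⁻¹)^[n] g = x^n * g * (x^n)⁻¹ := by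
      intro n
      induction n with
      | zero => simp
      | succ n ih => rw [Function.iterate_succ_apply', ih, pow_succ' x]; group
    rw [this, hk]; simp

theorem CONJP [Finite G] {p : ℕ} (hp : p.Prime) (hq : q.Prime) (hpq : p ≠ q) {V : Subgroup G} (hV : QG q V) {x y : G} (hx : qel p x)
    (hy : qel p y) (hxV : x ∈ Nm V) (hs : x⁻¹ * y ∈ V) : ∃ t ∈ V, y = t * x * t⁻¹ := by
  obtain ⟨k, hk⟩ := hx
  obtain ⟨l, hl⟩ := hy
  have hk' : x^(p^(k+l)) = 1 := by rw [pow_add, pow_mul, hk, one_pow]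
  have hl' : y^(p^(k+l)) = 1 := by rw [add_comm, pow_add, pow_mul, hl, one_pow]
  have key := fixedpt hp (coset_ncard hp hq hpq hV 1) (fun g => y * g * x⁻¹) (k := k+l) ?_ ?_
  · obtain ⟨_, ⟨d, hd, rfl⟩, h⟩ := key
    refine ⟨d, hd, ?_⟩
    simp only [one_mul] at h
    have := mul_inv_eq_iff_eq_mul.1 h
    rw [← this]; group
  · rintro _ ⟨d, hd, rfl⟩
    refine ⟨x * (x⁻¹ * y * d) * x⁻¹, Nm_conj hxV (V.mul_mem hs hd), by simp only; group⟩
  · rintro g -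
    have : ∀ n, (fun g => y * g * x⁻¹)^[n] g = y^n * g * (x^n)⁻¹ := by
      intro n
      induction n with
      | zero => simp
      | succ n ih => rw [Function.iterate_succ_apply', ih, pow_succ' y, pow_succ x]; group
    rw [this, hk', hl']; simp

end

def S4c {G : Type u} [Group G] (q : ℕ) (H : Subgroup G) : Prop :=
  ∀ e ∈ Egen q H, cop q e → ∀ s ∈ H, qel q s → Commute e s

structure Hyp (G : Type u) [Group G] (q : ℕ) (I : Set G) : Prop where
  hq : q.Prime
  conj : ∀ x ∈ I, ∀ g, g * x * g⁻¹ ∈ I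
  pow : ∀ x ∈ I, ∀ n : ℕ, x ^ n ∈ I
  pair : ∀ x ∈ I, ∀ g, QC q (closure {x, g}) ∧ S4c q (closure {x, g})
  prop : ∀ A ⊆ I, ∀ y, closure (insert y A) ≠ ⊤ → QC q (closure (insert y A)) ∧ S4c q (closure (insert y A))
  ch : ∀ x ∈ I, ∀ y, ∀ N1 N2 : Subgroup G, N1 < N2 → N2 ≤ closure {x, y} → x ∈ Nm N1 → y ∈ Nm N1 → x ∈ Nm N2 → y ∈ Nm N2 →
    ∃ w ∈ N2, w ∉ N1 ∧ x ∈ Nm (N1 ⊔ zpowers w)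
  hN : ∀ N : Subgroup G, N.Normal → QG q N → N = ⊥
  hCK : ∀ k : G, (∀ s, qel q s → Commute k s) → k = 1
  ne : ∃ s : G, qel q s ∧ s ≠ 1

section
variable {G : Type u} [Group G] {q : ℕ} {I : Set G}

def Oq (q : ℕ) (H : Subgroup G) : Subgroup G := closure {s | s ∈ H ∧ qel q s}

theorem mem_Oq {H : Subgroup G} (hH : QC q H) {s : G} : s ∈ Oq q H ↔ s ∈ H ∧ qel q s := by
  constructor
  · intro h
    refine ⟨?_, qel_closure hH (fun s hs => hs.1) (fun s hs => hs.2) h⟩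
    exact (closure_le H).2 (fun s hs => hs.1) h
  · intro h; exact subset_closure h

theorem Oq_QG {H : Subgroup G} (hH : QC q H) : QG q (Oq q H) := fun s hs => ((mem_Oq hH).1 hs).2
theorem Oq_le {H : Subgroup G} : Oq q H ≤ H := (closure_le H).2 (fun _ hs => hs.1)

theorem Oq_Nm [Finite G] {H : Subgroup G} (hH : QC q H) {g : G} (hg : g ∈ Nm H) : g ∈ Nm (Oq q H) := by
  rw [mem_Nm]; intro s hs
  rw [mem_Oq hH] at *
  exact ⟨Nm_conj hg hs.1, hs.2.conj g⟩

theorem Nm_iff_cj [Finite G] {g : G} {H : Subgroup G} : g ∈ Nm H ↔ cj g H ≤ H := by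
  rw [mem_Nm]
  constructor
  · intro h x hx; rw [mem_cj] at hx
    have := h _ hx; simpa [mul_assoc] using this
  · intro h x hx; exact h (conj_mem_cj.2 hx)

theorem cj_sup (g : G) (H K : Subgroup G) : cj g (H ⊔ K) = cj g H ⊔ cj g K := Subgroup.map_sup _ _ _
theorem cj_zpowers (g s : G) : cj g (zpowers s) = zpowers (g * s * g⁻¹) := by
  unfold cj; rw [MonoidHom.map_zpowers]; rfl

theorem Nm_sup [Finite G] {g : G} {H K : Subgroup G} (h1 : g ∈ Nm H) (h2 : g ∈ Nm K) : g ∈ Nm (H ⊔ K) := by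
  rw [← cj_eq_iff] at *; rw [cj_sup, h1, h2]
theorem Nm_inf [Finite G] {g : G} {H K : Subgroup G} (h1 : g ∈ Nm H) (h2 : g ∈ Nm K) : g ∈ Nm (H ⊓ K) := by
  rw [← cj_eq_iff] at *; rw [cj_inf, h1, h2]
theorem Nm_sup_zpowers [Finite G] {g s : G} {H : Subgroup G} (h1 : g ∈ Nm H) (h2 : g * s * g⁻¹ ∈ H ⊔ zpowers s) : g ∈ Nm (H ⊔ zpowers s) := by
  rw [Nm_iff_cj, cj_sup, cj_eq_iff.2 h1, cj_zpowers]
  refine sup_le le_sup_left ?_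
  rwa [zpowers_le]

def LM (I : Set G) (M : Subgroup G) : Subgroup G := closure (I ∩ M)
def TM (q : ℕ) (I : Set G) (M : Subgroup G) : Subgroup G := Oq q (LM I M)

theorem LM_le {M : Subgroup G} : LM I M ≤ M := (closure_le M).2 (fun _ hs => hs.2)
theorem TM_le {M : Subgroup G} : TM q I M ≤ M := Oq_le.trans LM_le

variable (h : Hyp G q I)
include h

theorem insert_ne {M : Subgroup G} (hM : M ≠ ⊤) {s : G} (hs : s ∈ M) : closure (insert s (I ∩ M)) ≠ ⊤ := by
  intro hh
  have : closure (insert s (I ∩ M)) ≤ M := by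
    rw [closure_le]; rintro x (rfl | hx)
    · exact hs
    · exact hx.2
  rw [hh, top_le_iff] at this
  exact hM this

theorem QC_LMs {M : Subgroup G} (hM : M ≠ ⊤) {s : G} (hs : s ∈ M) :
    QC q (closure (insert s (I ∩ M))) ∧ S4c q (closure (insert s (I ∩ M))) :=
  h.prop _ (fun _ hx => hx.1) s (insert_ne h hM hs)

theorem QC_LM {M : Subgroup G} (hM : M ≠ ⊤) : QC q (LM I M) := by
  have h1 := (QC_LMs h hM M.one_mem).1
  have h2 : LM I M ≤ closure (insert 1 (I ∩ M)) := Subgroup.closure_mono (Set.subset_insert _ _)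
  intro s hs t ht
  exact h1 s (h2 hs) t (h2 ht)

theorem mem_TM {M : Subgroup G} (hM : M ≠ ⊤) {s : G} : s ∈ TM q I M ↔ s ∈ LM I M ∧ qel q s := mem_Oq (QC_LM h hM)
theorem TM_QG {M : Subgroup G} (hM : M ≠ ⊤) : QG q (TM q I M) := Oq_QG (QC_LM h hM)

theorem LM_Nm [Finite G] {M : Subgroup G} : M ≤ Nm (LM I M) := by
  intro g hg
  rw [Nm_iff_cj, cj_le_iff, LM, closure_le]
  rintro x ⟨hx, hx'⟩
  rw [SetLike.mem_coe, mem_cj, inv_inv]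
  exact subset_closure ⟨h.conj x hx g, M.mul_mem (M.mul_mem hg hx') (M.inv_mem hg)⟩

theorem TM_Nm [Finite G] {M : Subgroup G} (hM : M ≠ ⊤) : M ≤ Nm (TM q I M) := fun _ hg =>
  Oq_Nm (QC_LM h hM) (LM_Nm h hg)

theorem comm_TM [Finite G] {M : Subgroup G} (hM : M ≠ ⊤) {l s : G} (hl : l ∈ LM I M) (hs : s ∈ M) (hsq : qel q s) :
    l * s * l⁻¹ * s⁻¹ ∈ TM q I M := by
  rw [mem_TM h hM]
  constructor
  · have : s * l⁻¹ * s⁻¹ ∈ LM I M := Nm_conj (LM_Nm h hs) (inv_mem hl)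
    have := mul_mem hl this
    simpa [mul_assoc] using this
  · have h1 := (QC_LMs h hM hs).1
    have h2 : LM I M ≤ closure (insert s (I ∩ M)) := Subgroup.closure_mono (Set.subset_insert _ _)
    have h3 : s ∈ closure (insert s (I ∩ M)) := subset_closure (Set.mem_insert _ _)
    exact h1 _ (mul_mem (mul_mem (h2 hl) h3) (inv_mem (h2 hl))) _ (inv_mem h3) (hsq.conj l) hsq.inv

theorem comm_TM' [Finite G] {M : Subgroup G} (hM : M ≠ ⊤) {l s : G} (hl : l ∈ LM I M) (hs : s ∈ M) (hsq : qel q s) :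
    s⁻¹ * (l * s * l⁻¹) ∈ TM q I M := by
  have := inv_mem (comm_TM h hM hl (inv_mem hs) hsq.inv)
  simpa [mul_assoc] using this

theorem Nm_ne_top [Finite G] {W : Subgroup G} (hW : QG q W) (hb : W ≠ ⊥) : Nm W ≠ ⊤ := fun hh => hb (h.hN W (Nm_top hh) hW)

theorem mem_LM {M : Subgroup G} {x : G} (hx : x ∈ I) (hxM : x ∈ M) : x ∈ LM I M := subset_closure ⟨hx, hxM⟩

theorem Fact1 [Finite G] {W : Subgroup G} (hW : QG q W) (hb : W ≠ ⊥) {A : Set G} (hA : A ⊆ I) (hAW : A ⊆ Nm W) :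
    ∃ Q, Syl q Q ∧ W ≤ Q ∧ A ⊆ Nm Q := by
  obtain ⟨W', h1, h2⟩ := (Set.toFinite {K : Subgroup G | QG q K ∧ W ≤ K ∧ A ⊆ Nm K}).exists_le_maximal
    (show W ∈ _ from ⟨hW, le_rfl, hAW⟩)
  obtain ⟨hW'q, hWW', hAW'⟩ := h2.1
  have hb' : W' ≠ ⊥ := by rintro rfl; exact hb (le_bot_iff.1 hWW')
  refine ⟨W', ?_, hWW', hAW'⟩
  by_contra hns
  obtain ⟨R, hR, hle⟩ := exists_Syl hW'q
  have hlt : W' < R := lt_of_le_of_ne hle (by rintro rfl; exact hns hR)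
  obtain ⟨g, hgR, hgW, hgN⟩ := exists_norm h.hq hR.1 hlt
  have hM := Nm_ne_top h hW'q hb'
  have hT : TM q I (Nm W') ≤ W' := by
    have hU : QG q (W' ⊔ TM q I (Nm W')) := hW'q.sup h.hq (TM_QG h hM) TM_le
    have := h2.2 (y := W' ⊔ TM q I (Nm W')) ⟨hU, hWW'.trans le_sup_left, fun a ha => Nm_sup (hAW' ha) (TM_Nm h hM (hAW' ha))⟩ le_sup_left
    exact le_sup_right.trans this
  have := h2.2 (y := W' ⊔ zpowers g) ⟨hW'q.sup h.hq (QG_zpowers (hR.1 g hgR)) (by rwa [zpowers_le]), hWW'.trans le_sup_left, ?_⟩ le_sup_left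
  · exact hgW (this (mem_sup_right (mem_zpowers g)))
  · intro a ha
    refine Nm_sup_zpowers (hAW' ha) ?_
    have h3 := hT (comm_TM h hM (mem_LM h (hA ha) (hAW' ha)) hgN (hR.1 g hgR))
    have h4 : a * g * a⁻¹ = (a * g * a⁻¹ * g⁻¹) * g := by group
    rw [h4]
    exact mul_mem (mem_sup_left h3) (mem_sup_right (mem_zpowers g))

theorem Fact2 [Finite G] {x s : G} (hx : x ∈ I) (hs : qel q s) : ∃ Q, Syl q Q ∧ x ∈ Nm Q ∧ s ∈ Q := by
  have key : ∀ s, qel q s → s ≠ 1 → ∃ Q, Syl q Q ∧ x ∈ Nm Q ∧ s ∈ Q := by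
    intro s hs h1
    have hX := (h.pair x hx s).1
    have hxX : x ∈ closure ({x, s} : Set G) := subset_closure (by simp)
    have hsX : s ∈ Oq q (closure ({x, s} : Set G)) := (mem_Oq hX).2 ⟨subset_closure (by simp), hs⟩
    obtain ⟨Q, hQ, hWQ, hA⟩ := Fact1 h (Oq_QG hX) (fun hb => h1 (by rwa [hb, mem_bot] at hsX)) (A := {x}) (by simpa using hx)
      (by simpa using Oq_Nm hX (le_Nm _ hxX))
    exact ⟨Q, hQ, hA rfl, hWQ hsX⟩
  by_cases h1 : s = 1
  · obtain ⟨t, ht, ht1⟩ := h.ne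
    obtain ⟨Q, hQ, hxQ, -⟩ := key t ht ht1
    exact ⟨Q, hQ, hxQ, by rw [h1]; exact one_mem _⟩
  · exact key s hs h1

omit h in
theorem split_comm {x y : G} (hx : cop q x) (hy : qel q y) (hc : Commute x y) : x ∈ zpowers (x * y) ∧ y ∈ zpowers (x * y) := by
  have key : ∀ (m n : ℕ), m.Coprime n → ∀ x y : G, x^m = 1 → y^n = 1 → Commute x y → x ∈ zpowers (x * y) := by
    intro m n hmn x y hx hy hc
    obtain ⟨a, ha1, ha2⟩ := Nat.chineseRemainder hmn 1 0
    refine ⟨a, ?_⟩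
    have e1 : x^a = x := by
      conv_rhs => rw [← pow_one x]
      rw [pow_eq_pow_iff_modEq]
      exact ha1.of_dvd (orderOf_dvd_of_pow_eq_one hx)
    have e2 : y^a = 1 := by
      obtain ⟨c, rfl⟩ := (Nat.modEq_zero_iff_dvd).1 ha2
      rw [pow_mul, hy, one_pow]
    simp only [zpow_natCast]
    rw [hc.mul_pow, e1, e2, mul_one]
  obtain ⟨m, hm, hxm⟩ := hx
  obtain ⟨k, hk⟩ := hy
  have h1 := hm.pow_right k
  refine ⟨key m (q^k) h1 x y hxm hk hc, ?_⟩
  rw [hc.eq]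
  exact key _ _ h1.symm y x hk hxm hc.symm

theorem Fact2' [Finite G] {x x' y : G} (hx : x ∈ I) (hx' : x' ∈ I) (hc : cop q x) (hy : qel q y) (hy1 : y ≠ 1) (hxy : Commute x y) :
    ∃ Q, Syl q Q ∧ x ∈ Nm Q ∧ x' ∈ Nm Q ∧ y ∈ Q := by
  have hX := (h.pair x' hx' (x * y)).1
  have hx'X : x' ∈ closure ({x', x * y} : Set G) := subset_closure (by simp)
  have hz : zpowers (x * y) ≤ closure ({x', x * y} : Set G) := by
    rw [zpowers_le]; exact subset_closure (by simp)
  obtain ⟨h1, h2⟩ := split_comm hc hy hxy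
  have hyX : y ∈ Oq q (closure ({x', x * y} : Set G)) := (mem_Oq hX).2 ⟨hz h2, hy⟩
  obtain ⟨Q, hQ, hWQ, hA⟩ := Fact1 h (Oq_QG hX) (fun hb => hy1 (by rwa [hb, mem_bot] at hyX)) (A := {x, x'})
    (by rintro a (rfl | rfl) <;> assumption)
    (by
      rintro a (rfl | rfl)
      · exact Oq_Nm hX (le_Nm _ (hz h1))
      · exact Oq_Nm hX (le_Nm _ hx'X))
  exact ⟨Q, hQ, hA (by simp), hA (by simp), hWQ hyX⟩

omit h in
theorem Nm_Nm [Finite G] {x : G} {R : Subgroup G} (hx : x ∈ Nm R) : x ∈ Nm (Nm R) := le_Nm _ hx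

omit h in
theorem card_lt_of_lt [Finite G] {R S : Subgroup G} (hlt : R < S) : Nat.card R < Nat.card S := by
  have := Set.ncard_lt_ncard (s := (R : Set G)) (t := (S : Set G)) (SetLike.coe_ssubset_coe.2 hlt)
  rw [← Nat.card_coe_set_eq, ← Nat.card_coe_set_eq] at this
  exact this

theorem L2' [Finite G] {p : ℕ} (hp : p.Prime) (hpq : p ≠ q) {x : G} (hx : x ∈ I) (hxp : qel p x) :
    ∀ (n : ℕ) (Q1 Q2 : Subgroup G), Nat.card G - Nat.card (Q1 ⊓ Q2 : Subgroup G) = n → Syl q Q1 → Syl q Q2 → x ∈ Nm Q1 → x ∈ Nm Q2 → Q1 ⊓ Q2 ≠ ⊥ →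
    (∀ c ∈ Q1, Commute x c → c ∈ Q2) → Q1 = Q2 := by
  intro n
  induction n using Nat.strong_induction_on with
  | _ n ih =>
  intro Q1 Q2 hn hQ1 hQ2 hx1 hx2 hb hC
  by_contra hne
  set R := Q1 ⊓ Q2 with hR
  have hR1 : R < Q1 := lt_of_le_of_ne inf_le_left (fun hh => hne (hQ1.eq_of_le hQ2.1 (by rw [← hh]; exact inf_le_right)))
  have hR2 : R < Q2 := lt_of_le_of_ne inf_le_right (fun hh => hne (hQ2.eq_of_le hQ1.1 (by rw [← hh]; exact inf_le_left)).symm)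
  have hRq : QG q R := hQ1.1.mono inf_le_left
  have hM := Nm_ne_top h hRq hb
  have hxM : x ∈ Nm R := Nm_inf hx1 hx2
  set M := Nm R with hMdef
  set T := TM q I M with hT
  have hTq : QG q T := TM_QG h hM
  have hRM : R ≤ M := le_Nm R
  obtain ⟨Q4, hQ4, hle, hxQ4⟩ := Fact1 h (W := T ⊔ (Q2 ⊓ M)) (hTq.sup h.hq (hQ2.1.mono inf_le_left) (inf_le_right.trans (TM_Nm h hM)))
    (fun hh => hb (le_bot_iff.1 (by rw [← hh]; exact (le_inf inf_le_right hRM).trans le_sup_right))) (A := {x}) (by simpa using hx)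
    (by
      rintro _ rfl
      exact Nm_sup (TM_Nm h hM hxM) (Nm_inf hx2 (Nm_Nm hxM)))
  have hxQ4 : x ∈ Nm Q4 := hxQ4 rfl
  have hN1 : Q1 ⊓ M ≤ Q4 := by
    rintro s ⟨hs1, hsM⟩
    have hsM : s ∈ M := hsM
    have h1 := comm_TM' h hM (mem_LM h hx hxM) hsM (hQ1.1 s hs1)
    obtain ⟨d, hd, hcd⟩ := FP hp h.hq hpq (D := T ⊓ Q1) (hTq.mono inf_le_left) hxp (Nm_inf (TM_Nm h hM hxM) hx1) (s := s)
      ⟨h1, Q1.mul_mem (Q1.inv_mem hs1) (Nm_conj hx1 hs1)⟩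
    have h2 : s * d ∈ Q2 := hC _ (mul_mem hs1 hd.2) hcd
    have h3 : s * d ∈ Q4 := hle (mem_sup_right ⟨h2, mul_mem hsM (TM_le hd.1)⟩)
    have h4 : d ∈ Q4 := hle (mem_sup_left hd.1)
    have := mul_mem h3 (inv_mem h4)
    simpa using this
  obtain ⟨g1, hg1, hg1R, hg1M⟩ := exists_norm h.hq hQ1.1 hR1
  have hlt : R < Q1 ⊓ Q4 := by
    refine lt_of_le_of_ne (le_inf inf_le_left ((le_inf inf_le_left hRM).trans hN1)) ?_
    intro hh
    apply hg1R; rw [hh]; exact ⟨hg1, hN1 ⟨hg1, hg1M⟩⟩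
  have hcard : Nat.card R < Nat.card (Q1 ⊓ Q4 : Subgroup G) := card_lt_of_lt hlt
  have hcG : Nat.card (Q1 ⊓ Q4 : Subgroup G) ≤ Nat.card G := card_le_card_group _
  have hQ14 : Q1 = Q4 := by
    refine ih _ ?_ Q1 Q4 rfl hQ1 hQ4 hx1 hxQ4 (fun hh => ?_) ?_
    · omega
    · rw [hh] at hlt; exact not_lt_bot hlt
    · intro c hc hcx
      exact hN1 ⟨hc, hRM ⟨hc, hC c hc hcx⟩⟩
  obtain ⟨g2, hg2, hg2R, hg2M⟩ := exists_norm h.hq hQ2.1 hR2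
  apply hg2R
  refine ⟨?_, hg2⟩
  rw [hQ14]; exact hle (mem_sup_right ⟨hg2, hg2M⟩)

theorem normal_inter [Finite G] {n : G} (hn : ∀ R, Syl q R → n ∈ R) : n = 1 := by
  let N : Subgroup G := sInf {R | Syl q R}
  have h1 : N.Normal := by
    constructor
    intro n hn g
    rw [mem_sInf] at *
    intro R hR
    have := hn (cj g⁻¹ R) (Syl.cj hR g⁻¹)
    rw [mem_cj] at this
    simpa using this
  have h2 : QG q N := by
    obtain ⟨Q, hQ, -⟩ := exists_Syl (QG_bot (G := G) (q := q))
    exact hQ.1.mono (sInf_le hQ)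
  have := h.hN N h1 h2
  have h3 : n ∈ N := by rw [mem_sInf]; exact hn
  rwa [this, mem_bot] at h3

theorem END' [Finite G] {x : G} (hx : ∀ R, Syl q R → x ∈ Nm R) : x = 1 := by
  apply h.hCK
  intro s hs
  obtain ⟨Q, hQ, hsQ⟩ := exists_Syl (QG_zpowers hs)
  have hsQ := hsQ (mem_zpowers s)
  have h1 : x * s * x⁻¹ * s⁻¹ ∈ Q := mul_mem (Nm_conj (hx Q hQ) hsQ) (inv_mem hsQ)
  have := normal_inter h (n := x * s * x⁻¹ * s⁻¹) ?_
  · rw [mul_inv_eq_one, mul_inv_eq_iff_eq_mul] at this; exact this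
  · intro R hR
    refine hR.mem_of_Nm h.hq (hQ.1 _ h1) ?_
    have h2 : s * x⁻¹ * s⁻¹ ∈ Nm R := by
      have := mem_Nm_cj (g := s) (x := x⁻¹) (H := cj s⁻¹ R)
      rw [cj_cj, mul_inv_cancel, cj_one] at this
      exact this.2 (inv_mem (hx _ (Syl.cj hR s⁻¹)))
    have := mul_mem (hx R hR) h2
    simpa [mul_assoc] using this

theorem END [Finite G] {x : G} {Q0 : Subgroup G} (hQ0 : Syl q Q0) (hx : ∀ g, g * x * g⁻¹ ∈ Nm Q0) : x = 1 := by
  apply END' h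
  intro R hR
  obtain ⟨g, rfl⟩ := hQ0.conj h.hq hR
  have := mem_Nm_cj (g := g) (x := g⁻¹ * x * g) (H := Q0)
  have h2 := hx g⁻¹
  rw [inv_inv] at h2
  have := this.2 h2
  simpa [mul_assoc] using this
end

section
variable {G : Type u} [Group G] [Finite G] {q : ℕ} {I : Set G}

theorem BS_half (hq : q.Prime) {D : Set G} (hD : ∀ d ∈ D, ∀ g, g * d * g⁻¹ ∈ D) {Q1 Q2 : Subgroup G} (hQ1 : QG q Q1)
    (hex : ∃ d ∈ D, d ∈ Q1 ∧ d ∉ Q2) :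
    ∃ d ∈ D, d ∈ Q1 ∧ d ∉ Q2 ∧ d ∈ Nm (closure (D ∩ (Q1 ⊓ Q2 : Subgroup G))) := by
  set W := closure (D ∩ (Q1 ⊓ Q2 : Subgroup G)) with hW
  have hWle : W ≤ Q1 ⊓ Q2 := (closure_le _).2 (fun _ hx => hx.2)
  obtain ⟨V, hWV, hV⟩ := (Set.toFinite {V : Subgroup G | W ≤ V ∧ V ≤ Q1 ∧ ∀ d ∈ D, d ∈ V → d ∈ W}).exists_le_maximal
    (show W ∈ _ from ⟨le_rfl, hWle.trans inf_le_left, fun _ _ h => h⟩)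
  obtain ⟨_, hVQ, hDV⟩ := hV.1
  obtain ⟨d, hd, hd1, hd2⟩ := hex
  have hlt : V < Q1 := by
    refine lt_of_le_of_ne hVQ ?_
    rintro rfl
    exact hd2 (hWle (hDV d hd hd1)).2
  obtain ⟨g, hg1, hgV, hgN⟩ := exists_norm hq hQ1 hlt
  have hle' : V ⊔ zpowers g ≤ Q1 := sup_le hVQ (by rwa [zpowers_le])
  have hN' : V ⊔ zpowers g ≤ Nm V := sup_le (le_Nm V) (by rwa [zpowers_le])
  have : ¬ ∀ d ∈ D, d ∈ V ⊔ zpowers g → d ∈ W := by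
    intro hh
    have := hV.2 (y := V ⊔ zpowers g) ⟨hWV.trans le_sup_left, hle', hh⟩ le_sup_left
    exact hgV (this (mem_sup_right (mem_zpowers g)))
  push Not at this
  obtain ⟨e, he, heV, heW⟩ := this
  refine ⟨e, he, hle' heV, fun h2 => heW (subset_closure ⟨he, hle' heV, h2⟩), ?_⟩
  rw [Nm_iff_cj, cj_le_iff, hW, closure_le]
  rintro y ⟨hy, hy'⟩
  rw [SetLike.mem_coe, mem_cj, inv_inv]
  exact hDV _ (hD y hy e) (Nm_conj (hN' heV) (hWV (subset_closure ⟨hy, hy'⟩)))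

theorem BS (h : Hyp G q I) {x : G} (hx : x ∈ I) (hxq : qel q x) : x = 1 := by
  set D : Set G := {d | ∃ g, d = g * x * g⁻¹} with hDdef
  have hDc : ∀ d ∈ D, ∀ g, g * d * g⁻¹ ∈ D := by
    rintro _ ⟨g, rfl⟩ g'
    exact ⟨g' * g, by group⟩
  have hDI : ∀ d ∈ D, d ∈ I := by rintro _ ⟨g, rfl⟩; exact h.conj x hx g
  have hDq : ∀ d ∈ D, qel q d := by rintro _ ⟨g, rfl⟩; exact hxq.conj g
  have key : ∀ (n : ℕ) (Q1 Q2 : Subgroup G), Nat.card G - (D ∩ (Q1 ⊓ Q2 : Subgroup G)).ncard = n → Syl q Q1 → Syl q Q2 → D ∩ Q1 = D ∩ Q2 := by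
    intro n
    induction n using Nat.strong_induction_on with
    | _ n ih =>
    intro Q1 Q2 hn hQ1 hQ2
    have hcard : (D ∩ (Q1 : Set G)).ncard = (D ∩ (Q2 : Set G)).ncard := by
      obtain ⟨g, rfl⟩ := hQ1.conj h.hq hQ2
      have : D ∩ (cj g Q1 : Set G) = (fun y => g * y * g⁻¹) '' (D ∩ (Q1 : Set G)) := by
        ext y; constructor
        · rintro ⟨h1, h2⟩
          refine ⟨g⁻¹ * y * g, ⟨by simpa using hDc y h1 g⁻¹, mem_cj.1 h2⟩, by simp only; group⟩
        · rintro ⟨z, ⟨h1, h2⟩, rfl⟩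
          exact ⟨hDc z h1 g, conj_mem_cj.2 h2⟩
      rw [this, Set.ncard_image_of_injective]
      intro a b hab; simpa using hab
    by_contra hne
    have e1 : ∃ d ∈ D, d ∈ Q1 ∧ d ∉ Q2 := by
      by_contra hcon
      push Not at hcon
      exact hne (Set.eq_of_subset_of_ncard_le (fun d hd => ⟨hd.1, hcon d hd.1 hd.2⟩) hcard.ge (Set.toFinite _))
    have e2 : ∃ d ∈ D, d ∈ Q2 ∧ d ∉ Q1 := by
      by_contra hcon
      push Not at hcon
      have hs : D ∩ (Q2 : Set G) ⊆ D ∩ (Q1 : Set G) := fun d hd => ⟨hd.1, hcon d hd.1 hd.2⟩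
      exact hne (Set.eq_of_subset_of_ncard_le hs hcard.le (Set.toFinite _)).symm
    obtain ⟨x1, hx1, hx1Q, hx1Q', hx1N⟩ := BS_half h.hq hDc hQ1.1 e1
    obtain ⟨x2, hx2, hx2Q, hx2Q', hx2N⟩ := BS_half h.hq hDc hQ2.1 e2
    rw [inf_comm Q2 Q1] at hx2N
    set W := closure (D ∩ (Q1 ⊓ Q2 : Subgroup G)) with hW
    have hWle : W ≤ Q1 ⊓ Q2 := (closure_le _).2 (fun _ hx => hx.2)
    have hP := (h.pair x1 (hDI x1 hx1) x2).1
    have hPq : QG q (closure {x1, x2}) := fun s hs => qel_closure hP subset_closure (by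
      rintro y (rfl | rfl)
      · exact hDq _ hx1
      · exact hDq _ hx2) hs
    have hU : QG q (W ⊔ closure {x1, x2}) := by
      refine (hQ1.1.mono (hWle.trans inf_le_left)).sup h.hq hPq ?_
      rw [closure_le]; rintro y (rfl | rfl) <;> assumption
    obtain ⟨Q3, hQ3, hle⟩ := exists_Syl hU
    have hx13 : x1 ∈ Q3 := hle (mem_sup_right (subset_closure (by simp)))
    have hx23 : x2 ∈ Q3 := hle (mem_sup_right (subset_closure (by simp)))
    have hD3 : ∀ d ∈ D, d ∈ Q1 → d ∈ Q2 → d ∈ Q3 := fun d hd h1 h2 => hle (mem_sup_left (subset_closure ⟨hd, h1, h2⟩))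
    have hG : ∀ S : Set G, S.ncard ≤ Nat.card G := fun S => Set.ncard_le_card S
    have c1 : (D ∩ (Q1 ⊓ Q2 : Subgroup G)).ncard < (D ∩ (Q1 ⊓ Q3 : Subgroup G)).ncard := by
      refine Set.ncard_lt_ncard ?_ (Set.toFinite _)
      refine ⟨fun d hd => ⟨hd.1, hd.2.1, hD3 d hd.1 hd.2.1 hd.2.2⟩, fun hh => hx1Q' (hh ⟨hx1, hx1Q, hx13⟩).2.2⟩
    have c2 : (D ∩ (Q1 ⊓ Q2 : Subgroup G)).ncard < (D ∩ (Q2 ⊓ Q3 : Subgroup G)).ncard := by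
      refine Set.ncard_lt_ncard ?_ (Set.toFinite _)
      refine ⟨fun d hd => ⟨hd.1, hd.2.2, hD3 d hd.1 hd.2.1 hd.2.2⟩, fun hh => hx2Q' (hh ⟨hx2, hx2Q, hx23⟩).2.1⟩
    have i1 := ih _ (by have := hG (D ∩ (Q1 ⊓ Q3 : Subgroup G)); omega) Q1 Q3 rfl hQ1 hQ3
    have i2 := ih _ (by have := hG (D ∩ (Q2 ⊓ Q3 : Subgroup G)); omega) Q2 Q3 rfl hQ2 hQ3
    exact hne (i1.trans i2.symm)
  apply normal_inter h
  intro R hR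
  obtain ⟨Q, hQ, hxQ⟩ := exists_Syl (QG_zpowers hxq)
  have : x ∈ D ∩ (Q : Set G) := ⟨⟨1, by simp⟩, hxQ (mem_zpowers x)⟩
  rw [key _ Q R rfl hQ hR] at this
  exact this.2
end

theorem gen_top {C : Type u} [Group C] [Finite C] {q : ℕ} (hq : q.Prime) {P K : Subgroup C} (hP : Syl q P) (hPK : P ≤ K)
    (hK : ∀ c : C, cop q c → c ∈ K) : K = ⊤ := by
  have : Fact q.Prime := ⟨hq⟩
  rw [← index_eq_one]
  by_contra hne
  obtain ⟨r, hr, hrd⟩ := Nat.exists_prime_and_dvd hne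
  have : Fact r.Prime := ⟨hr⟩
  by_cases hrq : r = q
  · subst hrq
    obtain ⟨P', rfl⟩ := hP.exists_sylow
    exact P'.not_dvd_index (hrd.trans (index_dvd_of_le hPK))
  · obtain ⟨R⟩ : Nonempty (Sylow r C) := inferInstance
    have : (R : Subgroup C) ≤ K := by
      intro c hc
      obtain ⟨k, hk⟩ := (isPGroup_iff_qel (R : Subgroup C)).1 R.isPGroup' c hc
      exact hK c (cop_of_prime_pow hr hq hrq hk)
    exact R.not_dvd_index (hrd.trans (index_dvd_of_le this))

section
variable {G : Type u} [Group G] [Finite G] {q : ℕ} {I : Set G}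

structure CA (q : ℕ) (I : Set G) (p : ℕ) (x : G) : Prop where
  hp : p.Prime
  hpq : p ≠ q
  mem : x ∈ I
  pel : qel p x
  fr : ∀ c, qel q c → Commute x c → c = 1

def Sy (q : ℕ) (y : G) : Set (Subgroup G) := {Q | Syl q Q ∧ y ∈ Q}
def Dd (q : ℕ) (y : G) : Subgroup G := sInf (Sy q y)

omit [Finite G] in
theorem mem_Dd {y u : G} : u ∈ Dd q y ↔ ∀ Q, Syl q Q → y ∈ Q → u ∈ Q := by
  unfold Dd Sy; rw [mem_sInf]
  exact ⟨fun h Q h1 h2 => h Q ⟨h1, h2⟩, fun h Q hQ => h Q hQ.1 hQ.2⟩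

theorem Sy_sub_iff {y u : G} : Sy q y ⊆ Sy q u ↔ u ∈ Dd q y := by
  rw [mem_Dd]
  exact ⟨fun h Q h1 h2 => (h ⟨h1, h2⟩).2, fun h Q hQ => ⟨hQ.1, h Q hQ.1 hQ.2⟩⟩

theorem cj_mem_Sy {y g : G} {Q : Subgroup G} : cj g Q ∈ Sy q (g * y * g⁻¹) ↔ Q ∈ Sy q y := by
  unfold Sy
  constructor
  · rintro ⟨h1, h2⟩
    refine ⟨?_, conj_mem_cj.1 h2⟩
    have := Syl.cj h1 g⁻¹
    rwa [cj_cj, inv_mul_cancel, cj_one] at this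
  · rintro ⟨h1, h2⟩; exact ⟨Syl.cj h1 g, conj_mem_cj.2 h2⟩

theorem Sy_conj_sub {y u g : G} (h : Sy q y ⊆ Sy q u) : Sy q (g * y * g⁻¹) ⊆ Sy q (g * u * g⁻¹) := by
  intro Q hQ
  have hQ' : cj g⁻¹ Q ∈ Sy q y := by
    rw [← cj_mem_Sy (g := g), cj_cj, mul_inv_cancel, cj_one]; exact hQ
  have h2 := (cj_mem_Sy (g := g)).2 (h hQ')
  rwa [cj_cj, mul_inv_cancel, cj_one] at h2

theorem Sy_conj_eq {y u g : G} (h : Sy q y = Sy q u) : Sy q (g * y * g⁻¹) = Sy q (g * u * g⁻¹) :=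
  Set.Subset.antisymm (Sy_conj_sub h.subset) (Sy_conj_sub h.superset)

theorem Dd_Nm {y g : G} (h : Sy q y ⊆ Sy q (g * y * g⁻¹)) (hh : Sy q (g * y * g⁻¹) ⊆ Sy q y) : g ∈ Nm (Dd q y) := by
  rw [mem_Nm]
  intro u hu
  rw [← Sy_sub_iff] at *
  exact h.trans (Sy_conj_sub hu)

variable (h : Hyp G q I) {p : ℕ} {x : G}
include h

theorem CA.conj (hx : CA q I p x) (g : G) : CA q I p (g * x * g⁻¹) := by
  refine ⟨hx.hp, hx.hpq, h.conj _ hx.mem g, hx.pel.conj g, fun c hc hcom => ?_⟩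
  have h1 : Commute x (g⁻¹ * c * g) := by
    have h2 : g * x * g⁻¹ * c = c * (g * x * g⁻¹) := hcom
    show x * (g⁻¹ * c * g) = (g⁻¹ * c * g) * x
    calc x * (g⁻¹ * c * g) = g⁻¹ * (g * x * g⁻¹ * c) * g := by group
      _ = _ := by rw [h2]; group
  have h2 := hx.fr _ (by simpa using hc.conj g⁻¹) h1
  calc c = g * (g⁻¹ * c * g) * g⁻¹ := by group
    _ = 1 := by rw [h2]; simp

theorem A1 (hx : CA q I p x) {Q1 Q2 : Subgroup G} (h1 : Syl q Q1) (h2 : Syl q Q2) (hx1 : x ∈ Nm Q1) (hx2 : x ∈ Nm Q2)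
    {y : G} (hy : y ≠ 1) (hy1 : y ∈ Q1) (hy2 : y ∈ Q2) : Q1 = Q2 := by
  refine L2' h hx.hp hx.hpq hx.mem hx.pel _ Q1 Q2 rfl h1 h2 hx1 hx2 (fun hb => hy ?_) ?_
  · have : y ∈ Q1 ⊓ Q2 := ⟨hy1, hy2⟩
    rwa [hb, mem_bot] at this
  · intro c hc hcx; rw [hx.fr c (h1.1 c hc) hcx]; exact one_mem _

omit h in
theorem exists_ne_one' {W : Subgroup G} (hb : W ≠ ⊥) : ∃ y ∈ W, y ≠ 1 := by
  by_contra hcon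
  push Not at hcon
  exact hb ((eq_bot_iff_forall W).2 hcon)

theorem A2 (hx : CA q I p x) {Q : Subgroup G} (hQ : Syl q Q) (hxQ : x ∈ Nm Q) :
    ∀ (n : ℕ) (W : Subgroup G), Nat.card G - Nat.card W = n → W ≠ ⊥ → W ≤ Q → x ∈ Nm W → Nm W ≤ Nm Q := by
  intro n
  induction n using Nat.strong_induction_on with
  | _ n ih =>
  intro W hn hb hWQ hxW
  have hWq : QG q W := hQ.1.mono hWQ
  have hM := Nm_ne_top h hWq hb
  set M := Nm W with hMd
  set T := TM q I M with hT
  have hTq : QG q T := TM_QG h hM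
  have hxT : x ∈ Nm T := TM_Nm h hM hxW
  have h1 : Q ⊓ M ≤ T := by
    rintro s ⟨hs, hsM⟩
    have hsM : s ∈ M := hsM
    obtain ⟨d, hd, hcd⟩ := FP hx.hp h.hq hx.hpq hTq hx.pel hxT (comm_TM' h hM (mem_LM h hx.mem hxW) hsM (hQ.1 s hs))
    have h2 : QG q (T ⊔ (Q ⊓ M)) := hTq.sup h.hq (hQ.1.mono inf_le_left) (inf_le_right.trans (TM_Nm h hM))
    have h3 : s * d = 1 := hx.fr _ (h2 _ (mul_mem (mem_sup_right ⟨hs, hsM⟩) (mem_sup_left hd))) hcd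
    rw [mul_eq_one_iff_eq_inv] at h3
    rw [h3]; exact inv_mem hd
  have hWT : W ≤ T := (le_inf hWQ (le_Nm W)).trans h1
  obtain ⟨y, hyW, hy1⟩ := exists_ne_one' hb
  have hTQ : T ≤ Q := by
    obtain ⟨Q', hQ', hTQ', hxQ'⟩ := Fact1 h hTq (fun hh => hb (le_bot_iff.1 (hh ▸ hWT))) (A := {x}) (by simpa using hx.mem) (by simpa using hxT)
    rwa [A1 h hx hQ hQ' hxQ (hxQ' rfl) hy1 (hWQ hyW) (hTQ' (hWT hyW))]
  rcases eq_or_lt_of_le hWT with heq | hlt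
  · rcases eq_or_lt_of_le hWQ with heq' | hlt'
    · rw [hMd, heq']
    · obtain ⟨g, hg, hgW, hgN⟩ := exists_norm h.hq hQ.1 hlt'
      exact absurd (by rw [heq]; exact h1 ⟨hg, hgN⟩) hgW
  · have hc := card_lt_of_lt hlt
    have hc2 : Nat.card T ≤ Nat.card G := card_le_card_group _
    exact (TM_Nm h hM).trans (ih _ (by omega) T rfl (fun hh => by rw [hh] at hlt; exact not_lt_bot hlt) hTQ hxT)

theorem exCA (hx : CA q I p x) {R : Subgroup G} (hR : Syl q R) : ∃ x', CA q I p x' ∧ x' ∈ Nm R := by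
  obtain ⟨Q, hQ, hxQ, -⟩ := Fact2 h hx.mem (qel_one (G := G) (q := q))
  obtain ⟨g, rfl⟩ := hQ.conj h.hq hR
  exact ⟨g * x * g⁻¹, CA.conj h hx g, mem_Nm_cj.2 hxQ⟩

theorem A3 (hx : CA q I p x) {y y' : G} (hy : qel q y) (hy' : y' ≠ 1) (hs : Sy q y ⊆ Sy q y') : Sy q y = Sy q y' := by
  refine Set.Subset.antisymm hs ?_
  rintro Q' ⟨hQ', hyQ'⟩
  obtain ⟨x', hx', hxQ'⟩ := exCA h hx hQ'
  obtain ⟨Q, hQ, hxQ, hyQ⟩ := Fact2 h hx'.mem hy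
  have := A1 h hx' hQ hQ' hxQ hxQ' hy' (hs ⟨hQ, hyQ⟩).2 hyQ'
  rw [this] at hyQ
  exact ⟨hQ', hyQ⟩

theorem A4 (hx : CA q I p x) {y c : G} (hy : qel q y) (hy1 : y ≠ 1) (hc : cop q c) (hcy : Commute c y) {Q : Subgroup G} (hQ : Syl q Q) (hyQ : y ∈ Q) :
    c ∈ Nm Q := by
  obtain ⟨x', hx', hxQ⟩ := exCA h hx hQ
  have hX := (h.pair x' hx'.mem (c * y)).1
  have hx'X : x' ∈ closure ({x', c * y} : Set G) := subset_closure (by simp)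
  have hz : zpowers (c * y) ≤ closure ({x', c * y} : Set G) := by
    rw [zpowers_le]; exact subset_closure (by simp)
  obtain ⟨h1, h2⟩ := split_comm hc hy hcy
  have hyX : y ∈ Oq q (closure ({x', c * y} : Set G)) := (mem_Oq hX).2 ⟨hz h2, hy⟩
  have hb : Oq q (closure ({x', c * y} : Set G)) ≠ ⊥ := (fun hb => hy1 (by rwa [hb, mem_bot] at hyX))
  have hxW := Oq_Nm hX (le_Nm _ hx'X)
  obtain ⟨Q', hQ', hWQ', hA⟩ := Fact1 h (Oq_QG hX) hb (A := {x'}) (by simpa using hx'.mem) (by simpa using hxW)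
  have : Q' = Q := A1 h hx' hQ' hQ (hA rfl) hxQ hy1 (hWQ' hyX) hyQ
  rw [this] at hWQ'
  exact A2 h hx' hQ hxQ _ _ rfl hb hWQ' hxW (Oq_Nm hX (le_Nm _ (hz h1)))

theorem A5 (hx : CA q I p x) {y : G} (hy : qel q y) (hy1 : y ≠ 1) : ∃ Q, Syl q Q ∧ y ∈ Q ∧ ∀ s, qel q s → Commute s y → s ∈ Q := by
  set C := centralizer ({y} : Set G) with hC
  have hmem : ∀ s, s ∈ C ↔ Commute s y := by
    intro s; rw [hC, mem_centralizer_singleton_iff]; exact Iff.rfl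
  have hyC : y ∈ C := (hmem y).2 (Commute.refl y)
  have hyq : qel q (⟨y, hyC⟩ : C) := by
    obtain ⟨k, hk⟩ := hy; exact ⟨k, Subtype.ext (by simpa using hk)⟩
  obtain ⟨P, hP, hyP⟩ := exists_Syl (QG_zpowers hyq)
  have hPq : QG q (P.map C.subtype) := by
    rintro _ ⟨s, hs, rfl⟩; exact (hP.1 s hs).map' _
  obtain ⟨Q, hQ, hPQ⟩ := exists_Syl hPq
  have hyQ : y ∈ Q := hPQ ⟨⟨y, hyC⟩, hyP (mem_zpowers _), rfl⟩
  have := gen_top h.hq (K := (Nm Q).subgroupOf C) hP ?_ ?_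
  · refine ⟨Q, hQ, hyQ, fun s hs hsy => hQ.mem_of_Nm h.hq hs ?_⟩
    have h1 : (⟨s, (hmem s).2 hsy⟩ : C) ∈ (Nm Q).subgroupOf C := by rw [this]; trivial
    exact mem_subgroupOf.1 h1
  · intro s hs
    rw [mem_subgroupOf]
    exact le_Nm Q (hPQ ⟨s, hs, rfl⟩)
  · rintro ⟨c, hcC⟩ hc
    rw [mem_subgroupOf]
    exact A4 h hx hy hy1 (hc.map C.subtype) ((hmem c).1 hcC) hQ hyQ

theorem Zc (hx : CA q I p x) {Q : Subgroup G} (hQ : Syl q Q) {z : G} (hz : z ∈ Q) (hz1 : z ≠ 1) (hzc : ∀ s ∈ Q, Commute z s)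
    {s : G} (hs : qel q s) (hsz : Commute s z) : s ∈ Q := by
  obtain ⟨Q', hQ', -, h1⟩ := A5 h hx (hQ.1 z hz) hz1
  have : Q = Q' := hQ.eq_of_le hQ'.1 (fun t ht => h1 t (hQ.1 t ht) (hzc t ht).symm)
  rw [this]; exact h1 s hs hsz

theorem Syl_ne_bot {Q : Subgroup G} (hQ : Syl q Q) : Q ≠ ⊥ := by
  rintro rfl
  obtain ⟨s, hs, h1⟩ := h.ne
  have := hQ.2 _ (QG_zpowers hs) bot_le
  exact h1 (by simpa using this)

theorem Sy_center (hx : CA q I p x) {Q : Subgroup G} (hQ : Syl q Q) {z z' : G} (hz : z ∈ Q) (hz1 : z ≠ 1) (hzc : ∀ s ∈ Q, Commute z s)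
    (hz' : z' ∈ Q) (hzc' : ∀ s ∈ Q, Commute z' s) : Sy q z ⊆ Sy q z' := by
  rintro R ⟨hR, hzR⟩
  obtain ⟨y, hy, hy1, hyc⟩ := exists_center h.hq hR.1 (Syl_ne_bot h hR)
  have h1 : y ∈ Q := Zc h hx hQ hz hz1 hzc (hR.1 y hy) (hyc z hzR)
  exact ⟨hR, Zc h hx hR hy hy1 hyc (hQ.1 z' hz') (hzc' y h1)⟩

theorem A6 (hx : CA q I p x) {y : G} (hy : qel q y) (hy1 : y ≠ 1) : ∃ Q z, Syl q Q ∧ y ∈ Q ∧ (∀ s, qel q s → Commute s y → s ∈ Q) ∧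
    z ∈ Q ∧ z ≠ 1 ∧ (∀ s ∈ Q, Commute z s) ∧ Sy q y = Sy q z := by
  obtain ⟨Q, hQ, hyQ, hall⟩ := A5 h hx hy hy1
  obtain ⟨z, hz, hz1, hzc⟩ := exists_center h.hq hQ.1 (Syl_ne_bot h hQ)
  refine ⟨Q, z, hQ, hyQ, hall, hz, hz1, hzc, A3 h hx hy hz1 ?_⟩
  rintro R ⟨hR, hyR⟩
  obtain ⟨y', hy', hy1', hyc'⟩ := exists_center h.hq hR.1 (Syl_ne_bot h hR)
  have h1 : y' ∈ Q := hall y' (hR.1 y' hy') (hyc' y hyR)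
  exact ⟨hR, Zc h hx hR hy' hy1' hyc' (hQ.1 z hz) (hzc y' h1)⟩

theorem Dd_center_Nm (hx : CA q I p x) {Q : Subgroup G} (hQ : Syl q Q) {z : G} (hz : z ∈ Q) (hz1 : z ≠ 1) (hzc : ∀ s ∈ Q, Commute z s) :
    Nm Q ≤ Nm (Dd q z) := by
  intro n hn
  have h1 : n * z * n⁻¹ ∈ Q := Nm_conj hn hz
  have h2 : ∀ s ∈ Q, Commute (n * z * n⁻¹) s := by
    intro s hs
    have := hzc _ (Nm_conj' hn hs)
    show n * z * n⁻¹ * s = s * (n * z * n⁻¹)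
    have h3 : z * (n⁻¹ * s * n) = n⁻¹ * s * n * z := this
    calc n * z * n⁻¹ * s = n * (z * (n⁻¹ * s * n)) * n⁻¹ := by group
      _ = _ := by rw [h3]; group
  have h3 : n * z * n⁻¹ ≠ 1 := by simpa using hz1
  exact Dd_Nm (Sy_center h hx hQ hz hz1 hzc h1 h2) (Sy_center h hx hQ h1 h3 h2 hz hzc)

theorem Dd_inter (hx : CA q I p x) {y z u : G} (hy : qel q y) (hz : qel q z) (huy : u ∈ Dd q y) (huz : u ∈ Dd q z) (hu1 : u ≠ 1) : Sy q y = Sy q z :=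
  (A3 h hx hy hu1 (Sy_sub_iff.2 huy)).trans (A3 h hx hz hu1 (Sy_sub_iff.2 huz)).symm

omit h in
theorem Dd_le {y : G} {Q : Subgroup G} (hQ : Syl q Q) (hy : y ∈ Q) : Dd q y ≤ Q := sInf_le ⟨hQ, hy⟩
omit h in
theorem self_mem_Dd {y : G} : y ∈ Dd q y := mem_Dd.2 (fun _ _ h => h)

theorem A7 (hx : CA q I p x) {Q : Subgroup G} (hQ : Syl q Q) {z : G} (hz : z ∈ Q) (hz1 : z ≠ 1) (hzc : ∀ s ∈ Q, Commute z s)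
    (hne : Dd q z ≠ Q) : ∀ d ∈ Dd q z, ∀ s ∈ Q, Commute d s := by
  have key : ∀ d ∈ Dd q z, ∀ y ∈ Q, y ∉ Dd q z → Commute d y := by
    intro d hd y hy hyD
    have hy1 : y ≠ 1 := by rintro rfl; exact hyD (one_mem _)
    obtain ⟨Q0, z0, hQ0, hyQ0, hall, hz0, hz01, hz0c, hS⟩ := A6 h hx (hQ.1 y hy) hy1
    have hdQ0 : d ∈ Q0 := Dd_le hQ0 (hall z (hQ.1 z hz) (hzc y hy)) hd
    have hN := Dd_center_Nm h hx hQ0 hz0 hz01 hz0c (le_Nm _ hdQ0)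
    have hDD : Dd q y = Dd q z0 := by unfold Dd; rw [hS]
    rw [← hDD] at hN
    have h1 : d * y * d⁻¹ * y⁻¹ ∈ Dd q y := mul_mem (Nm_conj hN self_mem_Dd) (inv_mem self_mem_Dd)
    have h2 : d * y * d⁻¹ * y⁻¹ ∈ Dd q z := by
      have := mul_mem hd (Nm_conj (Dd_center_Nm h hx hQ hz hz1 hzc (le_Nm _ hy)) (inv_mem hd))
      simpa [mul_assoc] using this
    have h3 : d * y * d⁻¹ * y⁻¹ = 1 := by
      by_contra hne1
      have := Dd_inter h hx (hQ.1 y hy) (hQ.1 z hz) h1 h2 hne1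
      exact hyD (Sy_sub_iff.1 this.superset)
    rw [mul_inv_eq_one, mul_inv_eq_iff_eq_mul] at h3
    exact h3
  obtain ⟨y0, hy0, hy0D⟩ := SetLike.exists_of_lt (lt_of_le_of_ne (Dd_le hQ hz) hne)
  intro d hd s hs
  by_cases hsD : s ∈ Dd q z
  · have h1 := key d hd (s * y0) (mul_mem hs hy0) (fun hh => hy0D (by
      have := mul_mem (inv_mem hsD) hh; simpa using this))
    have h2 := key d hd y0 hy0 hy0D
    have := h1.mul_right h2.inv_right
    simpa using this
  · exact key d hd s hs hsD

theorem A8 (hx : CA q I p x) {Q : Subgroup G} (hQ : Syl q Q) (hxQ : x ∈ Nm Q) {z : G} (hz : z ∈ Q) (hz1 : z ≠ 1) (hzc : ∀ s ∈ Q, Commute z s) :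
    Dd q z = Q := by
  by_contra hne
  have hcen := A7 h hx hQ hz hz1 hzc hne
  have hDQ : Dd q z ≤ Q := Dd_le hQ hz
  have hNN := Dd_center_Nm h hx hQ hz hz1 hzc
  set D := Dd q z with hD
  obtain ⟨y0, hy0, hy0D⟩ := SetLike.exists_of_lt (lt_of_le_of_ne hDQ hne)
  set X := closure ({x, y0} : Set G) with hX
  have hxX : x ∈ X := subset_closure (by simp)
  have hyX : y0 ∈ X := subset_closure (by simp)
  obtain ⟨w, hw2, hw1, hwN⟩ := h.ch x hx.mem y0 (X ⊓ D) (X ⊓ Q)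
    (lt_of_le_of_ne (inf_le_inf_left X hDQ) (fun hh => hy0D (by
      have : y0 ∈ X ⊓ D := by rw [hh]; exact ⟨hyX, hy0⟩
      exact this.2))) inf_le_left
    (Nm_inf (le_Nm _ hxX) (hNN hxQ)) (Nm_inf (le_Nm _ hyX) (hNN (le_Nm _ hy0))) (Nm_inf (le_Nm _ hxX) hxQ) (Nm_inf (le_Nm _ hyX) (le_Nm _ hy0))
  have hwQ : w ∈ Q := hw2.2
  have hwD : w ∉ D := fun hh => hw1 ⟨hw2.1, hh⟩
  have hrel : ∃ k : ℤ, w⁻¹ * (x * w * x⁻¹)^k ∈ D := by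
    have h1 := Nm_conj' hwN (mem_sup_right (mem_zpowers w))
    have h2 : X ⊓ D ⊔ zpowers w ≤ D ⊔ zpowers w := sup_le_sup_right inf_le_right _
    have hwND : zpowers w ≤ Nm D := by rw [zpowers_le]; exact hNN (le_Nm _ hwQ)
    have h3 := h2 h1
    rw [← SetLike.mem_coe, Subgroup.coe_mul_of_right_le_normalizer_left D (zpowers w) hwND, Set.mem_mul] at h3
    obtain ⟨d, hd, _, ⟨k, rfl⟩, hk⟩ := h3
    refine ⟨k, ?_⟩
    have e1 : x⁻¹ * w * x = d * w^k := hk.symm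
    have e2 : (x * w * x⁻¹)^k = (x * d * x⁻¹)⁻¹ * w := by
      have : w = x * (x⁻¹ * w * x) * x⁻¹ := by group
      rw [e1] at this
      rw [conj_zpow]
      conv_rhs => rw [this]
      group
    rw [e2]
    have := Nm_conj' (hNN (le_Nm _ hwQ)) (inv_mem (Nm_conj (hNN hxQ) hd))
    simpa [mul_assoc] using this
  obtain ⟨k, hk⟩ := hrel
  set S : Set G := (fun d => w * d) '' (D : Set G) with hS
  have hSQ : ∀ e ∈ S, e ∈ Q ∧ e ∉ D ∧ w⁻¹ * e ∈ D := by
    rintro _ ⟨d, hd, rfl⟩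
    refine ⟨mul_mem hwQ (hDQ hd), fun hh => hwD ?_, by simpa using hd⟩
    have := mul_mem hh (inv_mem hd); simpa using this
  have hf : ∀ e ∈ S, (x * e * x⁻¹)^k ∈ S := by
    rintro _ ⟨d, hd, rfl⟩
    have hxd := Nm_conj (hNN hxQ) hd
    have e1 : x * (w * d) * x⁻¹ = (x * w * x⁻¹) * (x * d * x⁻¹) := by group
    have hcm : Commute (x * w * x⁻¹) (x * d * x⁻¹) := (hcen _ hxd _ (Nm_conj hxQ hwQ)).symm
    refine ⟨w⁻¹ * (x * (w * d) * x⁻¹)^k, ?_, by simp⟩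
    rw [e1, hcm.mul_zpow, ← mul_assoc]
    exact mul_mem hk (zpow_mem hxd k)
  have hne1 : ∀ e ∈ S, e ≠ 1 := fun e he h1 => (hSQ e he).2.1 (by rw [h1]; exact one_mem _)
  have hSy : ∀ e ∈ S, Sy q (x * e * x⁻¹) = Sy q ((x * e * x⁻¹)^k) := by
    intro e he
    refine A3 h hx ((hQ.1 _ (hSQ e he).1).conj x) (hne1 _ (hf e he)) ?_
    rintro R ⟨hR, hh⟩; exact ⟨hR, zpow_mem hh k⟩
  have huniq : ∀ e ∈ S, ∀ e' ∈ S, Sy q e = Sy q e' → e = e' := by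
    intro e he e' he' hee
    by_contra hne'
    have h1 : e⁻¹ * e' ∈ D := by
      have := mul_mem (inv_mem (hSQ e he).2.2) (hSQ e' he').2.2
      simpa [mul_assoc] using this
    have h2 : e⁻¹ * e' ∈ Dd q e := mul_mem (inv_mem self_mem_Dd) (Sy_sub_iff.1 hee.subset)
    have := Dd_inter h hx (hQ.1 z hz) (hQ.1 e (hSQ e he).1) h1 h2 (fun hh => hne' (inv_mul_eq_one.1 hh))
    exact (hSQ e he).2.1 (Sy_sub_iff.1 this.subset)
  obtain ⟨l, hl⟩ := hx.pel
  have hit : ∀ n : ℕ, ∀ e ∈ S, (fun g => (x * g * x⁻¹)^k)^[n] e ∈ S ∧ Sy q ((fun g => (x * g * x⁻¹)^k)^[n] e) = Sy q (x^n * e * (x^n)⁻¹) := by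
    intro n e he
    induction n with
    | zero => simpa using he
    | succ n ih =>
      rw [Function.iterate_succ_apply']
      refine ⟨hf _ ih.1, ?_⟩
      have h1 := hSy _ ih.1
      have h2 := Sy_conj_eq (g := x) ih.2
      have e3 : x^(n+1) * e * (x^(n+1))⁻¹ = x * (x^n * e * (x^n)⁻¹) * x⁻¹ := by rw [pow_succ' x]; group
      rw [e3, ← h2, h1]
  obtain ⟨e, he, hfe⟩ := fixedpt hx.hp (coset_ncard hx.hp h.hq hx.hpq (hQ.1.mono hDQ) w) (fun g => (x * g * x⁻¹)^k) (k := l) hf (by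
    intro e he
    refine huniq _ (hit _ e he).1 _ he ?_
    rw [(hit _ e he).2, hl]; simp)
  have heq : Sy q (x * e * x⁻¹) = Sy q e := by
    rw [hSy e he]; exact congrArg _ hfe
  have hxDe : x ∈ Nm (Dd q e) := Dd_Nm heq.superset heq.subset
  have heQ := (hSQ e he).1
  have h1 := A2 h hx hQ hxQ _ (Dd q e) rfl (fun hh => hne1 e he (by
    have : e ∈ Dd q e := self_mem_Dd
    rwa [hh, mem_bot] at this)) (Dd_le hQ heQ) hxDe
  obtain ⟨Q0, z0, hQ0, hyQ0, hall, hz0, hz01, hz0c, hS0⟩ := A6 h hx (hQ.1 e heQ) (hne1 e he)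
  have hDD : Dd q e = Dd q z0 := by unfold Dd; rw [hS0]
  have h2 := Dd_center_Nm h hx hQ0 hz0 hz01 hz0c
  rw [← hDD] at h2
  have h3 : Q0 = Q := hQ0.eq_of_le hQ.1 (fun s hs => hQ.mem_of_Nm h.hq (hQ0.1 s hs) (h1 (h2 (le_Nm _ hs))))
  subst h3
  have h4 := Sy_center h hx hQ hz hz1 hzc hz0 hz0c
  apply (hSQ e he).2.1
  rw [hD, ← Sy_sub_iff, hS0]
  exact h4

theorem caseA (hx : CA q I p x) : x = 1 := by
  apply END' h
  intro R hR
  obtain ⟨y, hy, hy1⟩ := exists_ne_one' (Syl_ne_bot h hR)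
  obtain ⟨Q, hQ, hxQ, hyQ⟩ := Fact2 h hx.mem (hR.1 y hy)
  obtain ⟨Q0, z0, hQ0, hyQ0, hall, hz0, hz01, hz0c, hS0⟩ := A6 h hx (hR.1 y hy) hy1
  obtain ⟨x', hx', hxQ'⟩ := exCA h hx hQ0
  have h1 := A8 h hx' hQ0 hxQ' hz0 hz01 hz0c
  have key : ∀ R, Syl q R → y ∈ R → R = Q0 := by
    intro R hR hyR
    have : R ∈ Sy q z0 := by rw [← hS0]; exact ⟨hR, hyR⟩
    exact (hQ0.eq_of_le hR.1 (by rw [← h1]; exact sInf_le this)).symm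
  rw [key R hR hy, ← key Q hQ hyQ]
  exact hxQ
end

section
variable {G : Type u} [Group G] [Finite G] {q : ℕ}

theorem SZ (hq : q.Prime) {X : Subgroup G} (hX : QC q X) :
    ∃ B ≤ X, (∀ b ∈ B, cop q b) ∧ ∀ x ∈ X, ∃ b ∈ B, x⁻¹ * b ∈ Oq q X := by
  have : Fact q.Prime := ⟨hq⟩
  set N := (Oq q X).subgroupOf X with hN
  have hNn : N.Normal := by
    constructor
    intro n hn g
    rw [hN, mem_subgroupOf] at *
    exact Nm_conj (Oq_Nm hX (le_Nm _ g.2)) hn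
  have hNq : QG q N := by
    intro s hs
    rw [hN, mem_subgroupOf] at hs
    obtain ⟨k, hk⟩ := Oq_QG hX _ hs
    exact ⟨k, Subtype.ext (by simpa using hk)⟩
  have hcop : q.Coprime N.index := by
    rw [Nat.Prime.coprime_iff_not_dvd hq]
    intro hd
    obtain ⟨g, hg⟩ := exists_prime_orderOf_dvd_card' (G := X ⧸ N) q hd
    obtain ⟨s, rfl⟩ := QuotientGroup.mk_surjective g
    have h1 : (s^q : X) ∈ N := by
      rw [← QuotientGroup.eq_one_iff, QuotientGroup.mk_pow, ← hg, pow_orderOf_eq_one]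
    have h2 : s ∈ N := by
      rw [hN, mem_subgroupOf, mem_Oq hX]
      refine ⟨s.2, ?_⟩
      obtain ⟨k, hk⟩ := hNq _ h1
      refine ⟨1 + k, ?_⟩
      rw [← pow_mul] at hk
      rw [pow_add, pow_one]
      simpa using congrArg Subtype.val hk
    rw [(QuotientGroup.eq_one_iff s).2 h2, orderOf_one] at hg
    exact hq.one_lt.ne hg
  obtain ⟨n, hn⟩ := hNq.card hq
  obtain ⟨H, hH⟩ := exists_right_complement'_of_coprime (N := N) (by rw [hn]; exact hcop.pow_left n)
  refine ⟨H.map X.subtype, ?_, ?_, ?_⟩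
  · rintro _ ⟨b, -, rfl⟩; exact b.2
  · rintro _ ⟨b, hb, rfl⟩
    have hc := hH.index_eq_card
    have : cop q b := ⟨Nat.card H, by rw [← hH.symm.index_eq_card]; exact hcop.symm, by
      have := pow_card_eq_one' (x := (⟨b, hb⟩ : H))
      exact congrArg Subtype.val this⟩
    exact this.map X.subtype
  · intro x hx
    obtain ⟨⟨n, b⟩, hnb⟩ := hH.2 ⟨x, hx⟩
    refine ⟨b, ⟨b, b.2, rfl⟩, ?_⟩
    have e : x = n * b := (congrArg Subtype.val hnb).symm
    rw [e]
    have hn2 : ((n : X) : G) ∈ Oq q X := mem_subgroupOf.1 n.2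
    have := Nm_conj' (Oq_Nm hX (le_Nm _ (b : X).2)) (inv_mem hn2)
    simpa [mul_assoc] using this

theorem SZp (hq : q.Prime) {X : Subgroup G} (hX : QC q X) :
    ∃ B ≤ X, (∀ b ∈ B, cop q b) ∧ ∀ p : ℕ, p.Prime → p ≠ q → ∀ x ∈ X, qel p x → ∃ t ∈ Oq q X, t * x * t⁻¹ ∈ B := by
  obtain ⟨B, hB, hc, hs⟩ := SZ hq hX
  refine ⟨B, hB, hc, ?_⟩
  intro p hp hpq x hx hxp
  obtain ⟨b, hb, hxb⟩ := hs x hx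
  have hxN := Oq_Nm hX (le_Nm _ hx)
  have hbp : qel p b := by
    obtain ⟨k, hk⟩ := hxp
    refine ⟨k, ?_⟩
    have h1 : ∀ n : ℕ, (x^n)⁻¹ * b^n ∈ Oq q X := by
      intro n
      induction n with
      | zero => simp
      | succ n ih =>
        have h2 := mul_mem (Nm_conj' hxN ih) hxb
        have e : (x^(n+1))⁻¹ * b^(n+1) = x⁻¹ * ((x^n)⁻¹ * b^n) * x * (x⁻¹ * b) := by rw [pow_succ, pow_succ]; group
        rwa [e]
    have h2 := h1 (p^k)
    rw [hk, inv_one, one_mul] at h2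
    exact (Oq_QG hX _ h2).eq_one (hc _ (pow_mem hb _))
  obtain ⟨t, ht, rfl⟩ := CONJP hp hq hpq (Oq_QG hX) hxp hbp hxN hxb
  exact ⟨t, ht, hb⟩

theorem orbit_card (T : Subgroup G) (x : G) :
    ((fun t => t * x * t⁻¹) '' (T : Set G)).ncard * Nat.card (T ⊓ centralizer {x} : Subgroup G) = Nat.card T := by
  set C := (centralizer ({x} : Set G)).subgroupOf T with hC
  have h1 : Nat.card C = Nat.card (T ⊓ centralizer {x} : Subgroup G) := by
    rw [hC, ← inf_subgroupOf_left]
    exact Nat.card_congr (subgroupOfEquivOfLe inf_le_left).toEquiv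
  have h2 : C.index = ((fun t => t * x * t⁻¹) '' (T : Set G)).ncard := by
    rw [index, ← Nat.card_coe_set_eq]
    have hiff : ∀ a b : T, a⁻¹ * b ∈ C ↔ (a : G) * x * (a : G)⁻¹ = b * x * (b : G)⁻¹ := by
      intro a b
      rw [hC, mem_subgroupOf, mem_centralizer_singleton_iff]
      constructor
      · intro hh
        have hh : ((a : G)⁻¹ * b) * x = x * ((a : G)⁻¹ * b) := by simpa using hh
        have : (a : G) * x * (a : G)⁻¹ = a * (x * ((a : G)⁻¹ * b)) * (b : G)⁻¹ := by group
        rw [this, ← hh]; group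
      · intro hh
        have : x * ((a : G)⁻¹ * b) = (a : G)⁻¹ * (a * x * (a : G)⁻¹) * b := by group
        simp only [coe_mul, coe_inv]
        rw [this, hh]; group
    refine Nat.card_congr (Equiv.ofBijective (Quotient.lift (fun t : T => (⟨t * x * (t : G)⁻¹, t, t.2, rfl⟩ : ((fun t => t * x * t⁻¹) '' (T : Set G)))) ?_) ⟨?_, ?_⟩)
    · intro a b hab
      have := QuotientGroup.leftRel_apply.1 hab
      exact Subtype.ext ((hiff a b).1 this)
    · intro a b hab
      induction a using Quotient.inductionOn
      induction b using Quotient.inductionOn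
      rename_i a b
      apply Quotient.sound
      refine QuotientGroup.leftRel_apply.2 ((hiff a b).2 ?_)
      exact congrArg Subtype.val hab
    · rintro ⟨_, t, ht, rfl⟩
      exact ⟨Quotient.mk _ ⟨t, ht⟩, rfl⟩
  rw [← h1, ← h2, mul_comm, card_mul_index]

variable {I : Set G} (h : Hyp G q I) {p : ℕ} {x : G}
include h

omit h in
theorem mem_Cz {x s : G} : s ∈ centralizer ({x} : Set G) ↔ Commute x s := by
  rw [mem_centralizer_singleton_iff]; exact ⟨fun h => h.symm, fun h => h.symm⟩

theorem B2 (hp : p.Prime) (hpq : p ≠ q) (hx : x ∈ I) (hxp : qel p x) {Q : Subgroup G} (hQ : Syl q Q) (hxQ : x ∈ Nm Q)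
    (hb : Q ⊓ centralizer {x} ≠ ⊥) (R : Subgroup G) (hR : QG q R) (hRC : R ≤ centralizer {x}) (hle : Q ⊓ centralizer {x} ≤ R) :
    R = Q ⊓ centralizer {x} := by
  refine le_antisymm (le_inf ?_ hRC) hle
  obtain ⟨Q', hQ', hRQ', hxQ'⟩ := Fact1 h hR (fun hh => hb (le_bot_iff.1 (hh ▸ hle))) (A := {x}) (by simpa using hx) (by
    rintro _ rfl
    rw [SetLike.mem_coe, mem_Nm]
    intro s hs
    have := mem_Cz.1 (hRC hs)
    rw [this.eq]; simpa using hs)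
  have := L2' h hp hpq hx hxp _ Q Q' rfl hQ hQ' hxQ (hxQ' rfl) (fun hh => hb (le_bot_iff.1 (by
    rw [← hh]; exact le_inf inf_le_left (hle.trans hRQ')))) (fun c hc hcx => hRQ' (hle ⟨hc, mem_Cz.2 hcx⟩))
  rw [this]; exact hRQ'

theorem B3 (hp : p.Prime) (hpq : p ≠ q) (hx : x ∈ I) (hxp : qel p x) {Q1 Q2 : Subgroup G} (hQ1 : Syl q Q1) (hQ2 : Syl q Q2)
    (hx1 : x ∈ Nm Q1) (hx2 : x ∈ Nm Q2) (hb1 : Q1 ⊓ centralizer {x} ≠ ⊥) (hb2 : Q2 ⊓ centralizer {x} ≠ ⊥) :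
    ∃ c ∈ closure {s | qel q s ∧ Commute x s}, cj c Q2 = Q1 := by
  set K := closure {s | qel q s ∧ Commute x s} with hK
  have hKC : K ≤ centralizer {x} := by
    rw [hK, closure_le]; rintro s ⟨-, hs⟩; exact mem_Cz.2 hs
  have key : ∀ Q, Syl q Q → Q ⊓ centralizer {x} ≤ K := fun Q hQ s hs => subset_closure ⟨hQ.1 s hs.1, mem_Cz.1 hs.2⟩
  obtain ⟨g, hg, hgc⟩ := max_conj h.hq (hQ2.1.mono inf_le_left) (hQ1.1.mono inf_le_left) (key Q2 hQ2) (key Q1 hQ1)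
    (fun R hR hRK hle => B2 h hp hpq hx hxp hQ2 hx2 hb2 R hR (hRK.trans hKC) hle)
    (fun R hR hRK hle => B2 h hp hpq hx hxp hQ1 hx1 hb1 R hR (hRK.trans hKC) hle)
  refine ⟨g, hg, ?_⟩
  have hgx := mem_Cz.1 (hKC hg)
  have hle : Q1 ⊓ centralizer {x} ≤ cj g Q2 := by rw [← hgc]; exact cj_mono inf_le_left
  have hxg : x ∈ Nm (cj g Q2) := by
    have := (mem_Nm_cj (g := g)).2 hx2
    rwa [← hgx.eq, mul_inv_cancel_right] at this
  exact (L2' h hp hpq hx hxp _ Q1 (cj g Q2) rfl hQ1 (hQ2.cj g) hx1 hxg (fun hh => hb1 (le_bot_iff.1 (by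
    rw [← hh]; exact le_inf inf_le_left hle))) (fun c hc hcx => hle ⟨hc, mem_Cz.2 hcx⟩)).symm
end

section
variable {G : Type u} [Group G] [Finite G] {q : ℕ}
variable {I : Set G} (h : Hyp G q I) {p : ℕ} {x : G}
include h

/-- a coprime element generated appropriately centralises `Q` -/
theorem cent_Q {Q : Subgroup G} (hQ : Syl q Q) {n k : G} (hn : n ∈ Nm Q) (hk : k ∈ LM I (Nm Q))
    (hkE : k ∈ Egen q (closure (insert n (I ∩ (Nm Q : Subgroup G))))) (hc : cop q k) : ∀ s ∈ Q, Commute k s := by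
  have hM := Nm_ne_top h hQ.1 (Syl_ne_bot h hQ)
  have hS := (QC_LMs h hM hn).2
  intro s hs
  have h1 := comm_TM h hM hk (le_Nm _ hs) (hQ.1 s hs)
  have h2 := (mem_TM h hM).1 h1
  exact quadratic' hc h2.2 (hS k hkE hc _ (Subgroup.closure_mono (Set.subset_insert _ _) h2.1) h2.2)

theorem mixed (hp : p.Prime) (hpq : p ≠ q) {x x' : G} (hx : x ∈ I) (hx' : x' ∈ I) (hxp : qel p x) (hxp' : qel p x')
    {Q : Subgroup G} (hQ : Syl q Q) (hxQ : x ∈ Nm Q) (hxQ' : x' ∈ Nm Q) (hb : Q ⊓ centralizer {x} ≠ ⊥)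
    (hb' : ∀ s ∈ Q, Commute x' s → s = 1) (hB : ∀ b ∈ closure {x, x'}, cop q b) : x = 1 := by
  set B := closure ({x, x'} : Set G) with hBd
  have hxB : x ∈ B := subset_closure (by simp)
  have hxB' : x' ∈ B := subset_closure (by simp)
  set F := closure {z | ∃ a ∈ B, ∃ b ∈ B, z = a * b * a⁻¹ * b⁻¹} with hF
  have hFE : F ≤ Egen q B := by
    rw [hF]; unfold Egen
    apply Subgroup.closure_mono
    rintro z ⟨a, ha, b, hb, rfl⟩; exact ⟨a, ha, b, hb, Or.inl rfl⟩
  have hFB : F ≤ B := by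
    rw [hF, closure_le]; rintro z ⟨a, ha, b, hb, rfl⟩
    exact mul_mem (mul_mem (mul_mem ha hb) (inv_mem ha)) (inv_mem hb)
  have hFm : ∀ f ∈ F, ∀ m, qel q m → Commute x m → Commute f m := by
    intro f hf m hm hxm
    have hS := (h.pair x' hx' (x * m)).2
    obtain ⟨h1, h2⟩ := split_comm (hB x hxB) hm hxm
    have hz : zpowers (x * m) ≤ closure ({x', x * m} : Set G) := by
      rw [zpowers_le]; exact subset_closure (by simp)
    have hBX : B ≤ closure ({x', x * m} : Set G) := by
      rw [hBd, closure_le]; rintro z (rfl | rfl)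
      · exact hz h1
      · exact subset_closure (by simp)
    exact hS f (Egen_mono hBX (hFE hf)) (hB f (hFB hf)) m (hz h2) hm
  have hBL : B ≤ LM I (Nm Q) := by
    rw [hBd, closure_le]; rintro z (rfl | rfl)
    · exact mem_LM h hx hxQ
    · exact mem_LM h hx' hxQ'
  have hFQ : ∀ f ∈ F, ∀ s ∈ Q, Commute f s := by
    intro f hf
    refine cent_Q h hQ (one_mem _) (hBL (hFB hf)) (Egen_mono (hBL.trans ?_) (hFE hf)) (hB f (hFB hf))
    exact Subgroup.closure_mono (Set.subset_insert _ _)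
  have hcomF : ∀ a ∈ B, ∀ b ∈ B, a * b * a⁻¹ * b⁻¹ ∈ F := fun a ha b hb => subset_closure ⟨a, ha, b, hb, rfl⟩
  by_contra hx1
  have hM : ∃ M : Subgroup G, M ≠ ⊤ ∧ x ∈ M ∧ x' ∈ M ∧ ∀ m, qel q m → Commute x m → m ∈ M := by
    by_cases hF1 : F = ⊥
    · refine ⟨centralizer {x}, ?_, mem_Cz.2 (Commute.refl x), ?_, fun m _ hm => mem_Cz.2 hm⟩
      · intro hh
        exact hx1 (h.hCK x (fun s _ => mem_Cz.1 (by rw [hh]; trivial)))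
      · have := hcomF x hxB x' hxB'
        rw [hF1, mem_bot, mul_inv_eq_one, mul_inv_eq_iff_eq_mul] at this
        exact mem_Cz.2 this
    · have hBN : B ≤ Nm F := by
        intro b hb
        rw [mem_Nm]; intro f hf
        have := mul_mem (hcomF b hb f (hFB hf)) hf
        simpa using this
      refine ⟨Nm F, ?_, hBN hxB, hBN hxB', ?_⟩
      · intro hh
        apply hF1
        rw [eq_bot_iff_forall]
        intro f hf
        apply h.hCK
        intro s hs
        obtain ⟨R, hR, hsR⟩ := exists_Syl (QG_zpowers hs)
        obtain ⟨g, rfl⟩ := hQ.conj h.hq hR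
        have h1 := mem_cj.1 (hsR (mem_zpowers s))
        have hg : g ∈ Nm F := by rw [hh]; trivial
        have h2 := hFQ _ (Nm_conj' hg hf) _ h1
        have h3 : g⁻¹ * f * g * (g⁻¹ * s * g) = g⁻¹ * s * g * (g⁻¹ * f * g) := h2
        have h4 : g⁻¹ * (f * s) * g = g⁻¹ * (s * f) * g := by
          calc g⁻¹ * (f * s) * g = g⁻¹ * f * g * (g⁻¹ * s * g) := by group
            _ = _ := by rw [h3]; group
        exact mul_left_cancel (mul_right_cancel h4)
      · intro m hm hxm
        rw [mem_Nm]; intro f hf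
        have := hFm f hf m hm hxm
        rw [← this.eq]; simpa using hf
  obtain ⟨M, hMt, hxM, hxM', hmM⟩ := hM
  set A := Q ⊓ centralizer {x} with hA
  have hAx : x' ∈ Nm A := by
    rw [mem_Nm]; rintro a ⟨ha, hac⟩
    have h1 := Nm_conj hxQ' ha
    refine ⟨h1, mem_Cz.2 ?_⟩
    have h2 : Commute (x * x' * x⁻¹ * x'⁻¹) (x' * a * x'⁻¹) := hFQ _ (hcomF x hxB x' hxB') _ h1
    have h3 : Commute x a := mem_Cz.1 hac
    have h4 : x = (x * x' * x⁻¹ * x'⁻¹) * (x' * x * x'⁻¹) := by group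
    rw [h4]
    refine h2.mul_left ?_
    show x' * x * x'⁻¹ * (x' * a * x'⁻¹) = x' * a * x'⁻¹ * (x' * x * x'⁻¹)
    calc x' * x * x'⁻¹ * (x' * a * x'⁻¹) = x' * (x * a) * x'⁻¹ := by group
      _ = _ := by rw [h3.eq]; group
  set T := TM q I M with hT
  have hTq : QG q T := TM_QG h hMt
  have hTN : M ≤ Nm T := TM_Nm h hMt
  have hAM : A ≤ M := fun a ha => hmM a (hQ.1 a ha.1) (mem_Cz.1 ha.2)
  have hAT : A ≤ T := by
    intro s hs
    have h1 := comm_TM' h hMt (mem_LM h hx' hxM') (hAM hs) (hQ.1 s hs.1)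
    obtain ⟨d, hd, hcd⟩ := FP hp h.hq hpq (D := T ⊓ A) (hTq.mono inf_le_left) hxp' (Nm_inf (hTN hxM') hAx) (s := s)
      ⟨h1, A.mul_mem (A.inv_mem hs) (Nm_conj hAx hs)⟩
    have h3 := hb' _ (Q.mul_mem hs.1 hd.2.1) hcd
    rw [mul_eq_one_iff_eq_inv] at h3
    rw [h3]; exact inv_mem hd.1
  have hTA : T ⊓ centralizer {x} = A :=
    B2 h hp hpq hx hxp hQ hxQ hb _ (hTq.mono inf_le_left) inf_le_right (le_inf hAT inf_le_right)
  have hall : ∀ m, qel q m → Commute x m → m ∈ A := by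
    intro m hm hxm
    have hmC := mem_Cz.2 hxm
    have hmA : m ∈ Nm A := by
      rw [← hTA]; exact Nm_inf (hTN (hmM m hm hxm)) (le_Nm _ hmC)
    have h1 : QG q (A ⊔ zpowers m) := (hQ.1.mono inf_le_left).sup h.hq (QG_zpowers hm) (by rwa [zpowers_le])
    have h2 := B2 h hp hpq hx hxp hQ hxQ hb _ h1 (sup_le inf_le_right (by rwa [zpowers_le])) le_sup_left
    have h3 : m ∈ A ⊔ zpowers m := mem_sup_right (mem_zpowers m)
    rw [h2] at h3; exact h3
  obtain ⟨a, ha, ha1⟩ := exists_ne_one' hb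
  apply hx1
  apply END h hQ
  intro g
  obtain ⟨Q', hQ', h1, h2, h3⟩ := Fact2' h hx (h.conj x hx g) (hB x hxB) (hQ.1 a ha.1) ha1 (mem_Cz.1 ha.2)
  have := L2' h hp hpq hx hxp _ Q' Q rfl hQ' hQ h1 hxQ (fun hh => ha1 (by
    have : a ∈ Q' ⊓ Q := ⟨h3, ha.1⟩
    rwa [hh, mem_bot] at this)) (fun c hc hcx => (hall c (hQ'.1 c hc) hcx).1)
  rw [← this]; exact h2

omit h in
theorem Commute.conj2 {a b : G} (hc : Commute a b) (g : G) : Commute (g * a * g⁻¹) (g * b * g⁻¹) := by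
  show g * a * g⁻¹ * (g * b * g⁻¹) = g * b * g⁻¹ * (g * a * g⁻¹)
  calc g * a * g⁻¹ * (g * b * g⁻¹) = g * (a * b) * g⁻¹ := by group
    _ = _ := by rw [hc.eq]; group

theorem mixed' (hp : p.Prime) (hpq : p ≠ q) {x : G} (hx : x ∈ I) (hxp : qel p x)
    {Q Q1 : Subgroup G} (hQ : Syl q Q) (hxQ : x ∈ Nm Q) (hb : Q ⊓ centralizer {x} ≠ ⊥) (hQ1 : Syl q Q1) (hxQ1 : x ∈ Nm Q1)
    (hb' : Q1 ⊓ centralizer {x} = ⊥) : x = 1 := by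
  obtain ⟨g, hg⟩ := hQ1.conj h.hq hQ
  set x' := g * x * g⁻¹ with hx'
  have hxQ' : x' ∈ Nm Q := by rw [← hg]; exact mem_Nm_cj.2 hxQ1
  have hxI' : x' ∈ I := h.conj x hx g
  have hc' : ∀ s ∈ Q, Commute x' s → s = 1 := by
    intro s hs hcs
    rw [← hg, mem_cj] at hs
    have h1 := hcs.conj2 g⁻¹
    have e : g⁻¹ * x' * g⁻¹⁻¹ = x := by rw [hx']; group
    rw [e, inv_inv] at h1
    have h2 : g⁻¹ * s * g ∈ Q1 ⊓ centralizer {x} := ⟨hs, mem_Cz.2 h1⟩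
    rw [hb', mem_bot] at h2
    calc s = g * (g⁻¹ * s * g) * g⁻¹ := by group
      _ = 1 := by rw [h2]; simp
  have hX := (h.pair x hx x').1
  obtain ⟨B, hBX, hBc, hBt⟩ := SZp h.hq hX
  have hOQ : Oq q (closure {x, x'}) ≤ Q := by
    intro s hs
    refine hQ.mem_of_Nm h.hq (Oq_QG hX s hs) ((?_ : closure {x, x'} ≤ Nm Q) (Oq_le hs))
    rw [closure_le]; rintro z (rfl | rfl) <;> assumption
  obtain ⟨t, ht, htB⟩ := hBt p hp hpq x (subset_closure (by simp)) hxp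
  obtain ⟨t', ht', htB'⟩ := hBt p hp hpq x' (subset_closure (by simp)) (hxp.conj g)
  have htQ := le_Nm _ (hOQ ht)
  have htQ' := le_Nm _ (hOQ ht')
  have := mixed h hp hpq (h.conj x hx t) (h.conj x' hxI' t') (hxp.conj t) ((hxp.conj g).conj t') hQ
    (mul_mem (mul_mem htQ hxQ) (inv_mem htQ)) (mul_mem (mul_mem htQ' hxQ') (inv_mem htQ')) ?_ ?_ ?_
  · simpa using this
  · obtain ⟨a, ha, ha1⟩ := exists_ne_one' hb
    intro hh
    have : t * a * t⁻¹ ∈ Q ⊓ centralizer {t * x * t⁻¹} := ⟨Nm_conj htQ ha.1, mem_Cz.2 ((mem_Cz.1 ha.2).conj2 t)⟩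
    rw [hh, mem_bot] at this
    exact ha1 (by simpa using this)
  · intro s hs hcs
    have h1 := hcs.conj2 t'⁻¹
    have e : t'⁻¹ * (t' * x' * t'⁻¹) * t'⁻¹⁻¹ = x' := by group
    rw [e, inv_inv] at h1
    have h2 := hc' _ (Nm_conj' htQ' hs) h1
    calc s = t' * (t'⁻¹ * s * t') * t'⁻¹ := by group
      _ = 1 := by rw [h2]; simp
  · intro b hb
    refine hBc b ((closure_le B).2 ?_ hb)
    rintro z (rfl | rfl) <;> assumption
end

section
variable {G : Type u} [Group G] [Finite G] {q : ℕ}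
variable {I : Set G} (h : Hyp G q I) {p : ℕ} {x : G}
include h

structure Pu (q : ℕ) (I : Set G) (p : ℕ) (x : G) : Prop where
  hp : p.Prime
  hpq : p ≠ q
  mem : x ∈ I
  pel : qel p x
  pu : ∀ Q, Syl q Q → x ∈ Nm Q → Q ⊓ centralizer {x} ≠ ⊥

omit h in
theorem Pu.cop' (hq : q.Prime) (hx : Pu q I p x) : cop q x := by
  obtain ⟨k, hk⟩ := hx.pel
  exact cop_of_prime_pow hx.hp hq hx.hpq hk

theorem Pu.conj (hx : Pu q I p x) (g : G) : Pu q I p (g * x * g⁻¹) := by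
  refine ⟨hx.hp, hx.hpq, h.conj _ hx.mem g, hx.pel.conj g, fun Q hQ hxQ => ?_⟩
  have h1 := mem_Nm_cj (g := g⁻¹) |>.2 hxQ
  have e : g⁻¹ * (g * x * g⁻¹) * g⁻¹⁻¹ = x := by group
  rw [e] at h1
  obtain ⟨a, ha, ha1⟩ := exists_ne_one' (hx.pu _ (hQ.cj g⁻¹) h1)
  intro hh
  have h2 : a ∈ _root_.cj g⁻¹ Q := ha.1
  rw [mem_cj, inv_inv] at h2
  have : g * a * g⁻¹ ∈ Q ⊓ centralizer {g * x * g⁻¹} := ⟨h2, mem_Cz.2 ((mem_Cz.1 ha.2).conj2 g)⟩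
  rw [hh, mem_bot] at this
  exact ha1 (by simpa using this)

theorem pu_eq {x1 g : G} (hx : Pu q I p x1) (hB : ∀ b ∈ closure {x1, g * x1 * g⁻¹}, cop q b) : g * x1 * g⁻¹ = x1 := by
  set x2 := g * x1 * g⁻¹ with hx2
  have hP2 : Pu q I p x2 := Pu.conj h hx g
  have h1B : x1 ∈ closure ({x1, x2} : Set G) := subset_closure (by simp)
  have h2B : x2 ∈ closure ({x1, x2} : Set G) := subset_closure (by simp)
  set k := x2 * x1⁻¹ with hk
  have hkc : cop q k := hB _ (mul_mem h2B (inv_mem h1B))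
  have key : ∀ Q, Syl q Q → x1 ∈ Nm Q → x2 ∈ Nm Q → ∀ s ∈ Q, Commute k s := by
    intro Q hQ hxQ1 hxQ2
    have h1 := mem_Nm_cj (g := g⁻¹) |>.2 hxQ2
    have e : g⁻¹ * x2 * g⁻¹⁻¹ = x1 := by rw [hx2]; group
    rw [e] at h1
    obtain ⟨c, hc, hcc⟩ := B3 h hx.hp hx.hpq hx.mem hx.pel hQ (hQ.cj g⁻¹) hxQ1 h1 (hx.pu _ hQ hxQ1) (hx.pu _ (hQ.cj g⁻¹) h1)
    have hcx : Commute x1 c := by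
      refine mem_Cz.1 ((closure_le _).2 ?_ hc)
      rintro s ⟨-, hs⟩; exact mem_Cz.2 hs
    have hn : g * c⁻¹ ∈ Nm Q := by
      have : c * g⁻¹ ∈ Nm Q := by rw [← cj_eq_iff, ← cj_cj]; exact hcc
      have := inv_mem this; simpa using this
    refine cent_Q h hQ hn (mul_mem (mem_LM h hP2.mem hxQ2) (inv_mem (mem_LM h hx.mem hxQ1))) ?_ hkc
    refine subset_closure ⟨g * c⁻¹, subset_closure (Set.mem_insert _ _), x1, subset_closure (Set.mem_insert_of_mem _ ⟨hx.mem, hxQ1⟩), Or.inl ?_⟩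
    have h3 : c⁻¹ * x1 * c = x1 := by rw [mul_assoc, hcx.eq]; simp
    rw [hk, hx2]
    congr 1
    calc g * x1 * g⁻¹ = g * (c⁻¹ * x1 * c) * g⁻¹ := by rw [h3]
      _ = _ := by group
  have hm : ∀ m, qel q m → Commute x1 m → Commute k m := by
    intro m hm hxm
    by_cases h1 : m = 1
    · rw [h1]; exact Commute.one_right _
    · obtain ⟨Q, hQ, ha, hb, hc⟩ := Fact2' h hx.mem hP2.mem (hx.cop' h.hq) hm h1 hxm
      exact key Q hQ ha hb m hc
  have hk1 : k = 1 := by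
    obtain ⟨Q0, hQ0, hxQ0, -⟩ := Fact2 h hx.mem (qel_one (G := G) (q := q))
    obtain ⟨a, ha, ha1⟩ := exists_ne_one' (hx.pu Q0 hQ0 hxQ0)
    obtain ⟨Q, hQ, hxQ, hx2Q, -⟩ := Fact2' h hx.mem hP2.mem (hx.cop' h.hq) (hQ0.1 a ha.1) ha1 (mem_Cz.1 ha.2)
    apply h.hCK
    intro s hs
    obtain ⟨Q', hQ', hxQ', hsQ'⟩ := Fact2 h hx.mem hs
    obtain ⟨c, hc, hcc⟩ := B3 h hx.hp hx.hpq hx.mem hx.pel hQ hQ' hxQ hxQ' (hx.pu _ hQ hxQ) (hx.pu _ hQ' hxQ')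
    have hkc' : Commute k c := by
      refine mem_Cz.1 ((closure_le _).2 ?_ hc)
      rintro s ⟨h1, h2⟩; exact mem_Cz.2 (hm s h1 h2)
    have h1 := key Q hQ hxQ hx2Q (c * s * c⁻¹) (by rw [← hcc]; exact conj_mem_cj.2 hsQ')
    have h2 := (hkc'.inv_right.mul_right h1).mul_right hkc'
    have e : c⁻¹ * (c * s * c⁻¹) * c = s := by group
    rwa [e] at h2
  exact mul_inv_eq_one.1 hk1

theorem pu_comm (hx : Pu q I p x) {r : ℕ} (hr : r.Prime) (hrq : r ≠ q) {y : G} (hy : qel r y) : ∃ g, Commute y (g * x * g⁻¹) := by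
  have hX := (h.pair x hx.mem y).1
  obtain ⟨B, hBX, hBc, hBt⟩ := SZp h.hq hX
  obtain ⟨t, ht, htB⟩ := hBt p hx.hp hx.hpq x (subset_closure (by simp)) hx.pel
  obtain ⟨s, hs, hsB⟩ := hBt r hr hrq y (subset_closure (by simp)) hy
  have h1 := pu_eq h (Pu.conj h hx t) (g := s * y * s⁻¹) (by
    intro b hb
    refine hBc b ((closure_le B).2 ?_ hb)
    rintro z (rfl | rfl)
    · exact htB
    · exact B.mul_mem (B.mul_mem hsB htB) (B.inv_mem hsB))
  have h2 : Commute (s * y * s⁻¹) (t * x * t⁻¹) := by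
    rw [mul_inv_eq_iff_eq_mul] at h1; exact h1
  refine ⟨s⁻¹ * t, ?_⟩
  have h3 := h2.conj2 s⁻¹
  have e1 : s⁻¹ * (s * y * s⁻¹) * s⁻¹⁻¹ = y := by group
  have e2 : s⁻¹ * (t * x * t⁻¹) * s⁻¹⁻¹ = (s⁻¹ * t) * x * (s⁻¹ * t)⁻¹ := by group
  rwa [e1, e2] at h3

theorem pu_orb {M : Subgroup G} (hM : M ≠ ⊤) {x1 g : G} (hx : Pu q I p x1) (h1 : x1 ∈ M) (h2 : g * x1 * g⁻¹ ∈ M) :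
    ∃ t ∈ TM q I M, g * x1 * g⁻¹ = t * x1 * t⁻¹ := by
  set x2 := g * x1 * g⁻¹ with hx2
  have hP2 : Pu q I p x2 := Pu.conj h hx g
  have hX := (h.pair x1 hx.mem x2).1
  have hOT : Oq q (closure {x1, x2}) ≤ TM q I M := by
    intro s hs
    rw [mem_TM h hM]
    refine ⟨(closure_le _).2 ?_ (Oq_le hs), Oq_QG hX s hs⟩
    rintro z (rfl | rfl)
    · exact mem_LM h hx.mem h1
    · exact mem_LM h hP2.mem h2
  obtain ⟨B, hBX, hBc, hBt⟩ := SZp h.hq hX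
  obtain ⟨t, ht, htB⟩ := hBt p hx.hp hx.hpq x1 (subset_closure (by simp)) hx.pel
  obtain ⟨s, hs, hsB⟩ := hBt p hx.hp hx.hpq x2 (subset_closure (by simp)) hP2.pel
  have e : (s * g * t⁻¹) * (t * x1 * t⁻¹) * (s * g * t⁻¹)⁻¹ = s * x2 * s⁻¹ := by rw [hx2]; group
  have h3 := pu_eq h (Pu.conj h hx t) (g := s * g * t⁻¹) (by
    intro b hb
    refine hBc b ((closure_le B).2 ?_ hb)
    rintro z (rfl | rfl)
    · exact htB
    · rw [e]; exact hsB)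
  rw [e] at h3
  refine ⟨s⁻¹ * t, mul_mem (inv_mem (hOT hs)) (hOT ht), ?_⟩
  calc x2 = s⁻¹ * (s * x2 * s⁻¹) * s := by group
    _ = _ := by rw [h3]; group

theorem pu_card (hx : Pu q I p x) {r : ℕ} (hr : r.Prime) (hrq : r ≠ q) : ¬ r ∣ ((fun t => t * x * t⁻¹) '' ((⊤ : Subgroup G) : Set G)).ncard := by
  intro hd
  have : Fact r.Prime := ⟨hr⟩
  set J := (fun t => t * x * t⁻¹) '' ((⊤ : Subgroup G) : Set G) with hJ
  have hdG : r ∣ Nat.card G := by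
    have := orbit_card (⊤ : Subgroup G) x
    rw [card_top] at this
    rw [← this]; exact hd.mul_right _
  obtain ⟨y, hy⟩ := exists_prime_orderOf_dvd_card' (G := G) r hdG
  have hyr : y ^ r = 1 := by rw [← hy]; exact pow_orderOf_eq_one y
  have hy1 : y ≠ 1 := by rintro rfl; rw [orderOf_one] at hy; exact hr.one_lt.ne hy
  have hyq : qel r y := ⟨1, by simpa using hyr⟩
  set M := centralizer ({y} : Set G) with hMd
  have hM : M ≠ ⊤ := fun hh => hy1 (h.hCK y (fun s _ => mem_Cz.1 (by rw [← hMd, hh]; trivial)))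
  obtain ⟨g, hg⟩ := pu_comm h hx hr hrq hyq
  set x1 := g * x * g⁻¹ with hx1
  have hP1 : Pu q I p x1 := Pu.conj h hx g
  have hJM : J ∩ M = (fun t => t * x1 * t⁻¹) '' (TM q I M : Set G) := by
    ext z
    constructor
    · rintro ⟨⟨a, -, rfl⟩, ha⟩
      have e : a * x * a⁻¹ = (a * g⁻¹) * x1 * (a * g⁻¹)⁻¹ := by rw [hx1]; group
      simp only at ha ⊢
      rw [e] at ha ⊢
      obtain ⟨t, ht, hte⟩ := pu_orb h hM hP1 (mem_Cz.2 hg) ha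
      exact ⟨t, ht, hte.symm⟩
    · rintro ⟨t, ht, rfl⟩
      refine ⟨⟨t * g, trivial, by simp only [hx1]; group⟩, ?_⟩
      have := TM_le ht
      exact M.mul_mem (M.mul_mem this (mem_Cz.2 hg)) (M.inv_mem this)
  have hc1 : ¬ r ∣ (J ∩ M).ncard := by
    intro hh
    obtain ⟨n, hn⟩ := (TM_QG h hM).card h.hq
    have := orbit_card (TM q I M) x1
    rw [← hJM, hn] at this
    have h2 : r ∣ q ^ n := by rw [← this]; exact hh.mul_right _
    exact hrq ((Nat.prime_dvd_prime_iff_eq hr h.hq).1 (hr.dvd_of_dvd_pow h2))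
  have hc2 : ¬ r ∣ (J \ M).ncard := by
    intro hh
    apply hc1
    have := Set.ncard_inter_add_ncard_sdiff_eq_ncard J M (Set.toFinite _)
    rw [← this] at hd
    exact (Nat.dvd_add_left hh).1 hd
  have key := fixedpt hr hc2 (fun z => y * z * y⁻¹) (k := 1) ?_ ?_
  · obtain ⟨z, hz, hfz⟩ := key
    apply hz.2
    have hfz : y * z * y⁻¹ = z := hfz
    rw [mul_inv_eq_iff_eq_mul] at hfz
    exact mem_Cz.2 hfz
  · rintro z ⟨⟨a, -, rfl⟩, hz⟩
    refine ⟨⟨y * a, trivial, by simp only; group⟩, fun hh => hz ?_⟩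
    have hyM : y ∈ M := mem_Cz.2 (Commute.refl y)
    have := M.mul_mem (M.mul_mem (M.inv_mem hyM) hh) hyM
    simpa [mul_assoc] using this
  · intro z _
    have : ∀ n : ℕ, (fun z => y * z * y⁻¹)^[n] z = y^n * z * (y^n)⁻¹ := by
      intro n
      induction n with
      | zero => simp
      | succ n ih => rw [Function.iterate_succ_apply', ih, pow_succ' y]; group
    rw [this, pow_one, hyr]; simp

theorem pure_case (hx : Pu q I p x) : x = 1 := by
  have : Fact q.Prime := ⟨h.hq⟩
  obtain ⟨Q, hQ, hxQ, -⟩ := Fact2 h hx.mem (qel_one (G := G) (q := q))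
  set J := (fun t => t * x * t⁻¹) '' ((⊤ : Subgroup G) : Set G) with hJ
  set O := (fun t => t * x * t⁻¹) '' (Q : Set G) with hO
  have hJc := orbit_card (⊤ : Subgroup G) x
  rw [card_top, top_inf_eq, ← hJ] at hJc
  have hJne : J.ncard ≠ 0 := by
    intro h0; rw [h0, zero_mul] at hJc; exact Nat.card_pos.ne hJc
  obtain ⟨k, hk⟩ : ∃ k, J.ncard = q ^ k :=
    ⟨_, Nat.eq_prime_pow_of_unique_prime_dvd hJne (fun {r} hr hd => by
      by_contra hne
      exact pu_card h hx hr hne hd)⟩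
  have hOc := orbit_card Q x
  rw [← hO] at hOc
  obtain ⟨m, hm⟩ := QG.card h.hq (hQ.1.mono (inf_le_left : Q ⊓ centralizer {x} ≤ Q))
  obtain ⟨n, hn⟩ := hQ.1.card h.hq
  have hdv : q ^ (k + m) ∣ Nat.card G := by
    rw [← hJc, hk, pow_add]
    refine mul_dvd_mul_left _ ?_
    rw [← hm]
    exact card_dvd_of_le inf_le_right
  have hle : k + m ≤ n := by
    obtain ⟨R, hR⟩ := Sylow.exists_subgroup_card_pow_prime q hdv
    have hRq : QG q R := by
      intro s hs
      refine ⟨k + m, ?_⟩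
      have := pow_card_eq_one' (x := (⟨s, hs⟩ : R))
      rw [hR] at this
      exact congrArg Subtype.val this
    obtain ⟨R', hR', hRR'⟩ := exists_Syl hRq
    obtain ⟨g, rfl⟩ := hQ.conj h.hq hR'
    have h1 := card_dvd_of_le hRR'
    have h2 : Nat.card (cj g Q) = Nat.card Q := Nat.card_congr (Q.equivMapOfInjective _ (MulAut.conj g).injective).toEquiv.symm
    rw [h2, hR, hn] at h1
    exact (Nat.pow_dvd_pow_iff_le_right h.hq.one_lt).1 h1
  have hOJ : O ⊆ J := by rintro _ ⟨t, -, rfl⟩; exact ⟨t, trivial, rfl⟩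
  have hcard : J.ncard ≤ O.ncard := by
    rw [hk]
    rw [hm, hn] at hOc
    have h1 : q ^ k * q ^ m ≤ O.ncard * q ^ m := by
      rw [hOc, ← pow_add]; exact Nat.pow_le_pow_right h.hq.pos hle
    exact Nat.le_of_mul_le_mul_right h1 (pow_pos h.hq.pos m)
  have hJO : O = J := Set.eq_of_subset_of_ncard_le hOJ hcard
  apply END h hQ
  intro g
  have : g * x * g⁻¹ ∈ O := by rw [hJO]; exact ⟨g, trivial, rfl⟩
  obtain ⟨t, ht, hte⟩ := this
  simp only at hte
  rw [← hte]
  have := le_Nm _ ht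
  exact mul_mem (mul_mem this hxQ) (inv_mem this)

theorem prime_case (hp : p.Prime) (hx : x ∈ I) (hxp : qel p x) : x = 1 := by
  by_cases hpq : p = q
  · subst hpq; exact BS h hx hxp
  by_cases hA : ∀ c, qel q c → Commute x c → c = 1
  · exact caseA h ⟨hp, hpq, hx, hxp, hA⟩
  push Not at hA
  obtain ⟨c, hc, hxc, hc1⟩ := hA
  obtain ⟨k, hk⟩ := hxp
  obtain ⟨Q, hQ, hxQ, -, hcQ⟩ := Fact2' h hx hx (cop_of_prime_pow hp h.hq hpq hk) hc hc1 hxc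
  have hb : Q ⊓ centralizer {x} ≠ ⊥ := by
    intro hh
    have : c ∈ Q ⊓ centralizer {x} := ⟨hcQ, mem_Cz.2 hxc⟩
    rw [hh, mem_bot] at this; exact hc1 this
  by_cases hpu : ∀ Q, Syl q Q → x ∈ Nm Q → Q ⊓ centralizer {x} ≠ ⊥
  · exact pure_case h ⟨hp, hpq, hx, ⟨k, hk⟩, hpu⟩
  push Not at hpu
  obtain ⟨Q1, h1, h2, h3⟩ := hpu
  exact mixed' h hp hpq hx ⟨k, hk⟩ hQ hxQ hb h1 h2 h3

theorem partH (hx : x ∈ I) : x = 1 := by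
  by_contra h1
  have h2 : orderOf x ≠ 1 := fun hh => h1 (orderOf_eq_one_iff.1 hh)
  obtain ⟨p, hp, c, hc⟩ := Nat.exists_prime_and_dvd h2
  have hpos := orderOf_pos x
  have := prime_case h hp (h.pow x hx c) ⟨1, by rw [pow_one, ← pow_mul, mul_comm, ← hc, pow_orderOf_eq_one]⟩
  have h3 := orderOf_dvd_of_pow_eq_one this
  have h4 : 0 < c := Nat.pos_of_ne_zero (by rintro rfl; omega)
  have h5 := Nat.le_of_dvd h4 h3
  have := hp.two_le
  nlinarith
end

section
variable {G : Type u} [Group G] [Finite G] {q : ℕ}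

def Ic (G : Type u) [Group G] : Set G := {x | ∀ y, IsSupersoluble (closure ({x, y} : Set G))}

omit [Finite G] in
theorem ss_map {Y : Type u} [Group Y] (f : G →* Y) {H : Subgroup G} (h : IsSupersoluble H) : IsSupersoluble (H.map f) :=
  ss_of_surjective (f.subgroupMap H) (f.subgroupMap_surjective H) h

omit [Finite G] in
theorem map_pair {Y : Type u} [Group Y] (f : G →* Y) (x y : G) : (closure ({x, y} : Set G)).map f = closure {f x, f y} := by
  rw [MonoidHom.map_closure, Set.image_pair]

omit [Finite G] in
theorem Ic_map {Y : Type u} [Group Y] (f : G →* Y) (hf : Function.Surjective f) {x : G} (hx : x ∈ Ic G) : f x ∈ Ic Y := by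
  intro y
  obtain ⟨y, rfl⟩ := hf y
  rw [← map_pair]; exact ss_map f (hx y)

omit [Finite G] in
theorem Ic_conj {x : G} (hx : x ∈ Ic G) (g : G) : g * x * g⁻¹ ∈ Ic G := by
  have := Ic_map (MulAut.conj g).toMonoidHom (MulAut.conj g).surjective hx
  simpa using this

omit [Finite G] in
theorem Ic_pow {x : G} (hx : x ∈ Ic G) (n : ℕ) : x ^ n ∈ Ic G := by
  intro y
  refine ss_of_le ?_ (hx y)
  rw [closure_le]; rintro z (rfl | rfl)
  · exact pow_mem (subset_closure (by simp)) n
  · exact subset_closure (by simp)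

omit [Finite G] in
theorem Ic_sub {H : Subgroup G} {x : H} (hx : (x : G) ∈ Ic G) : x ∈ Ic H := by
  intro y
  have h1 := hx y
  have h2 : IsSupersoluble ((closure ({x, y} : Set H)).map H.subtype) := by
    rw [map_pair]; exact h1
  exact ss_of_injective ((closure ({x, y} : Set H)).equivMapOfInjective H.subtype H.subtype_injective).toMonoidHom
    (MulEquiv.injective _) h2

theorem Egen_sub {H : Subgroup G} : Egen q H ≤ (Egen q (⊤ : Subgroup H)).map H.subtype := by
  conv_lhs => unfold Egen
  rw [closure_le]
  rintro z ⟨a, ha, b, hb, hz⟩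
  have : ∃ z' : H, z = z' ∧ (z' = ⟨a, ha⟩ * ⟨b, hb⟩ * ⟨a, ha⟩⁻¹ * ⟨b, hb⟩⁻¹ ∨ z' = ⟨a, ha⟩ ^ (q - 1)) := by
    rcases hz with rfl | rfl
    · exact ⟨_, rfl, Or.inl rfl⟩
    · exact ⟨_, rfl, Or.inr rfl⟩
  obtain ⟨z', rfl, hz'⟩ := this
  exact ⟨z', subset_closure ⟨_, trivial, _, trivial, hz'⟩, rfl⟩

omit [Finite G] in
theorem qel_sub {H : Subgroup G} {s : H} : qel q (s : G) ↔ qel q s := by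
  constructor
  · rintro ⟨k, hk⟩; exact ⟨k, Subtype.ext (by simpa using hk)⟩
  · rintro ⟨k, hk⟩; exact ⟨k, by simpa using congrArg Subtype.val hk⟩

omit [Finite G] in
theorem cop_sub {H : Subgroup G} {s : H} : cop q (s : G) ↔ cop q s := by
  constructor
  · rintro ⟨k, h1, hk⟩; exact ⟨k, h1, Subtype.ext (by simpa using hk)⟩
  · rintro ⟨k, h1, hk⟩; exact ⟨k, h1, by simpa using congrArg Subtype.val hk⟩

theorem Oq_normal (hX : QC q (⊤ : Subgroup G)) : (Oq q (⊤ : Subgroup G)).Normal := by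
  constructor
  intro n hn g
  exact Nm_conj (Oq_Nm hX (le_Nm _ (mem_top g))) hn

theorem ss_QCS (hq : q.Prime) {H : Subgroup G} (hH : IsSupersoluble H) (hr : ∀ r : ℕ, r.Prime → r ∣ Nat.card G → r ≤ q) :
    QC q H ∧ S4c q H := by
  have h1 : QC q (⊤ : Subgroup H) := S3 hq _ H rfl hH (fun r hrp hd => hr r hrp (hd.trans (card_subgroup_dvd_card H)))
  constructor
  · intro s hs t ht hsq htq
    exact qel_sub.2 (h1 ⟨s, hs⟩ trivial ⟨t, ht⟩ trivial (qel_sub.1 hsq) (qel_sub.1 htq))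
  · intro e he hec s hs hsq
    obtain ⟨e, he', rfl⟩ := Egen_sub he
    have := S4 hq _ H rfl hH (Oq q ⊤) (Oq_normal h1) (Oq_QG h1) e he' (cop_sub.1 hec) ⟨s, hs⟩ ((mem_Oq h1).2 ⟨trivial, qel_sub.1 hsq⟩)
    exact congrArg Subtype.val this

theorem ss_line {H : Subgroup G} (hH : IsSupersoluble H) {N : Subgroup G} (hN : N ≤ H) (hn : H ≤ Nm N) (hb : N ≠ ⊥) :
    ∃ z ∈ N, (orderOf z).Prime ∧ H ≤ Nm (zpowers z) := by
  have h1 : (N.subgroupOf H).Normal := by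
    constructor
    intro n hn' g
    rw [mem_subgroupOf] at *
    exact Nm_conj (hn g.2) hn'
  obtain ⟨z, hz, hzp, hzn⟩ := ss_exists_prime hH h1 (fun hh => hb (by
    rw [subgroupOf_eq_bot, disjoint_iff, inf_eq_left.2 hN] at hh; exact hh))
  refine ⟨z, mem_subgroupOf.1 hz, by rwa [orderOf_coe], ?_⟩
  intro g hg
  rw [mem_Nm]
  rintro _ ⟨k, rfl⟩
  have := hzn.conj_mem (z ^ k) (zpow_mem (mem_zpowers z) k) ⟨g, hg⟩
  obtain ⟨m, hm⟩ := this
  exact ⟨m, by simpa using congrArg Subtype.val hm⟩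

theorem ss_step {H : Subgroup G} (hH : IsSupersoluble H) {N1 N2 : Subgroup G} (hlt : N1 < N2) (hN : N2 ≤ H) (hn1 : H ≤ Nm N1) (hn2 : H ≤ Nm N2) :
    ∃ w ∈ N2, w ∉ N1 ∧ H ≤ Nm (N1 ⊔ zpowers w) := by
  have h1 : (N1.subgroupOf H).Normal := by
    constructor
    intro n hn' g
    rw [mem_subgroupOf] at *
    exact Nm_conj (hn1 g.2) hn'
  have h2 : (N2.subgroupOf H).Normal := by
    constructor
    intro n hn' g
    rw [mem_subgroupOf] at *
    exact Nm_conj (hn2 g.2) hn'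
  set π := QuotientGroup.mk' (N1.subgroupOf H) with hπ
  have hs := QuotientGroup.mk'_surjective (N1.subgroupOf H)
  obtain ⟨v, hv2, hv1⟩ := SetLike.exists_of_lt hlt
  have hQ : IsSupersoluble (H ⧸ N1.subgroupOf H) := ss_of_surjective π hs hH
  obtain ⟨z, hz, hzp, hzn⟩ := ss_exists_prime hQ (N := (N2.subgroupOf H).map π) (h2.map π hs) (fun hh => hv1 (by
    have : π ⟨v, hN hv2⟩ ∈ (N2.subgroupOf H).map π := mem_map_of_mem _ (mem_subgroupOf.2 hv2)
    rw [hh, mem_bot] at this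
    exact mem_subgroupOf.1 ((QuotientGroup.eq_one_iff _).1 this)))
  obtain ⟨w, hw, rfl⟩ := hz
  refine ⟨w, mem_subgroupOf.1 hw, fun hh => ?_, ?_⟩
  · have : π w = 1 := (QuotientGroup.eq_one_iff _).2 (mem_subgroupOf.2 hh)
    rw [this, orderOf_one] at hzp; exact Nat.not_prime_one hzp
  · intro g hg
    refine Nm_sup_zpowers (hn1 hg) ?_
    obtain ⟨m, hm⟩ := hzn.conj_mem _ (mem_zpowers _) (π ⟨g, hg⟩)
    have hm : π (w ^ m) = π (⟨g, hg⟩ * w * ⟨g, hg⟩⁻¹) := by simpa using hm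
    have h3 := mem_subgroupOf.1 (QuotientGroup.eq.1 hm)
    have h4 : (w : G)^m * (((w : G)^m)⁻¹ * (g * w * g⁻¹)) ∈ N1 ⊔ zpowers (w : G) :=
      mul_mem (mem_sup_right (zpow_mem (mem_zpowers _) m)) (mem_sup_left (by simpa using h3))
    rwa [mul_inv_cancel_left] at h4

/-- quotients by q-groups preserve QC -/
theorem QC_of_quot {N : Subgroup G} [N.Normal] (hN : QG q N) (hQ : QC q (⊤ : Subgroup (G ⧸ N))) : QC q (⊤ : Subgroup G) := by
  intro s _ t _ hs ht
  obtain ⟨k, hk⟩ := hQ _ trivial _ trivial (hs.map' (QuotientGroup.mk' N)) (ht.map' (QuotientGroup.mk' N))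
  rw [← map_mul, ← map_pow] at hk
  have h1 : (s * t) ^ (q ^ k) ∈ N := (QuotientGroup.eq_one_iff _).1 hk
  obtain ⟨l, hl⟩ := hN _ h1
  exact ⟨k + l, by rw [pow_add, pow_mul]; exact hl⟩

structure Ind (G : Type u) [Group G] (q : ℕ) (y : G) : Prop where
  hq : q.Prime
  hd : q ∣ Nat.card G
  hr : ∀ r : ℕ, r.Prime → r ∣ Nat.card G → r ≤ q
  gen : closure (insert y (Ic G)) = ⊤
  sub : ∀ A ⊆ Ic G, ∀ z, closure (insert z A) ≠ ⊤ → IsSupersoluble (closure (insert z A))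
  quo : ∀ N : Subgroup G, ∀ _ : N.Normal, N ≠ ⊥ → IsSupersoluble (G ⧸ N)

variable {y : G}

theorem card_quo_dvd (N : Subgroup G) : Nat.card (G ⧸ N) ∣ Nat.card G := by
  rw [← index_eq_card]; exact index_dvd_card N

theorem Ind.QCquo (h : Ind G q y) (N : Subgroup G) [hN : N.Normal] (hb : N ≠ ⊥) : QC q (⊤ : Subgroup (G ⧸ N)) :=
  S3 h.hq _ _ rfl (h.quo N hN hb) (fun r hr hd => h.hr r hr (hd.trans (card_quo_dvd N)))

theorem Ind.ne (h : Ind G q y) : ∃ s : G, qel q s ∧ s ≠ 1 := by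
  have : Fact q.Prime := ⟨h.hq⟩
  obtain ⟨s, hs⟩ := exists_prime_orderOf_dvd_card' (G := G) q h.hd
  refine ⟨s, ⟨1, by rw [pow_one, ← hs, pow_orderOf_eq_one]⟩, ?_⟩
  rintro rfl; rw [orderOf_one] at hs; exact h.hq.one_lt.ne hs

theorem Ind.CK (h : Ind G q y) (hN : ∀ N : Subgroup G, N.Normal → QG q N → N = ⊥) {k : G} (hk : ∀ s, qel q s → Commute k s) : k = 1 := by
  by_contra hk1
  set N : Subgroup G := centralizer {s | qel q s} with hNd
  have hmem : ∀ g, g ∈ N ↔ ∀ s, qel q s → Commute g s := by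
    intro g; rw [hNd, mem_centralizer_iff]
    exact ⟨fun h s hs => (h s hs).symm, fun h s hs => (h s hs).symm⟩
  have hNn : N.Normal := by
    constructor
    intro n hn g
    rw [hmem] at *
    intro s hs
    have := (hn _ (hs.conj g⁻¹)).conj2 g
    have e : g * (g⁻¹ * s * g⁻¹⁻¹) * g⁻¹ = s := by group
    rwa [e] at this
  have hb : N ≠ ⊥ := by
    intro hh
    have := (hmem k).2 hk
    rw [hh, mem_bot] at this; exact hk1 this
  have hQC : QC q (⊤ : Subgroup G) := by
    intro s _ t _ hs ht
    exact CE h.hq (h.QCquo N hb) hs ht (fun n hn => ((hmem n).1 hn s hs).symm) (fun n hn => ((hmem n).1 hn t ht).symm)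
  have := hN _ (Oq_normal hQC) (Oq_QG hQC)
  obtain ⟨s, hs, hs1⟩ := h.ne
  have h2 : s ∈ Oq q (⊤ : Subgroup G) := (mem_Oq hQC).2 ⟨trivial, hs⟩
  rw [this, mem_bot] at h2
  exact hs1 h2

theorem Ind.toHyp (h : Ind G q y) (hN : ∀ N : Subgroup G, N.Normal → QG q N → N = ⊥) : Hyp G q (Ic G) where
  hq := h.hq
  conj := fun x hx g => Ic_conj hx g
  pow := fun x hx n => Ic_pow hx n
  pair := fun x hx g => ss_QCS h.hq (hx g) h.hr
  prop := fun A hA y hy => ss_QCS h.hq (h.sub A hA y hy) h.hr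
  ch := by
    intro x hx y N1 N2 hlt hle h1 h2 h3 h4
    obtain ⟨w, hw, hw1, hw2⟩ := ss_step (hx y) hlt hle
      (by rw [closure_le]; rintro z (rfl | rfl) <;> assumption)
      (by rw [closure_le]; rintro z (rfl | rfl) <;> assumption)
    exact ⟨w, hw, hw1, hw2 (subset_closure (by simp))⟩
  hN := hN
  hCK := fun k hk => h.CK hN hk
  ne := h.ne

theorem Ind.case1 (h : Ind G q y) (hN : ∀ N : Subgroup G, N.Normal → QG q N → N = ⊥) : IsSupersoluble G := by
  have h1 : ∀ x ∈ Ic G, x = 1 := fun x hx => partH (h.toHyp hN) hx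
  apply ss_cyclic y
  rw [← top_le_iff, ← h.gen, closure_le]
  rintro z (rfl | hz)
  · exact mem_zpowers z
  · rw [h1 z hz]; exact one_mem _

theorem Ind.case2 (h : Ind G q y) (hN : ¬ ∀ N : Subgroup G, N.Normal → QG q N → N = ⊥) : QC q (⊤ : Subgroup G) := by
  push Not at hN
  obtain ⟨N, hNn, hNq, hb⟩ := hN
  exact QC_of_quot hNq (h.QCquo N hb)
end

section
variable {G : Type u} [Group G] [Finite G] {q : ℕ}

theorem card_cop (hq : q.Prime) {E : Subgroup G} (hE : ∀ e ∈ E, cop q e) : (Nat.card E).Coprime q := by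
  have : Fact q.Prime := ⟨hq⟩
  rw [Nat.coprime_comm, Nat.Prime.coprime_iff_not_dvd hq]
  intro hd
  obtain ⟨s, hs⟩ := exists_prime_orderOf_dvd_card' (G := E) q hd
  have h1 : qel q s := ⟨1, by rw [pow_one, ← hs, pow_orderOf_eq_one]⟩
  have := h1.eq_one (cop_sub.1 (hE s s.2))
  rw [this, orderOf_one] at hs
  exact hq.one_lt.ne hs

theorem COC (hq : q.Prime) {V : Subgroup G} (hV : V.Normal) (hc : ∀ v ∈ V, ∀ w ∈ V, Commute v w) (hexp : ∀ v ∈ V, v ^ q = 1)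
    {E : Subgroup G} (hE : ∀ e ∈ E, cop q e) (φ : G →* G) (hφ : ∀ e ∈ E, φ e * e⁻¹ ∈ V) :
    ∃ u ∈ V, ∀ e ∈ E, φ e = u * e * u⁻¹ := by
  let _ : CommGroup V := { (inferInstance : Group V) with mul_comm := fun a b => Subtype.ext (hc a a.2 b b.2) }
  let _ : Fintype E := Fintype.ofFinite E
  let d : E → V := fun e => ⟨φ e * (e : G)⁻¹, hφ e e.2⟩
  let act : G → V →* V := fun e =>
    { toFun := fun v => ⟨e * v * e⁻¹, hV.conj_mem v v.2 e⟩
      map_one' := Subtype.ext (by simp)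
      map_mul' := fun a b => Subtype.ext (by simp) }
  have hd : ∀ e e' : E, d (e * e') = d e * act e (d e') := by
    intro e e'
    apply Subtype.ext
    simp only [d, act, MonoidHom.coe_mk, OneHom.coe_mk, coe_mul, map_mul]
    group
  let W : V := ∏ e : E, d e
  have hW : ∀ e : E, W = d e ^ Fintype.card E * act e W := by
    intro e
    have h1 : W = ∏ e' : E, d (e * e') := (Equiv.prod_comp (Equiv.mulLeft e) d).symm
    calc W = ∏ e' : E, d (e * e') := h1
      _ = _ := by
        simp only [hd]
        rw [Finset.prod_mul_distrib, Finset.prod_const, Finset.card_univ, ← map_prod]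
  obtain ⟨m, -, hm⟩ := Nat.exists_mul_mod_eq_one_of_coprime (card_cop hq hE) hq.one_lt
  have hpow : ∀ v : V, v ^ (Nat.card E * m) = v := by
    intro v
    have hvq : v ^ q = 1 := Subtype.ext (by simpa using hexp v v.2)
    conv_rhs => rw [← pow_one v]
    rw [pow_eq_pow_iff_modEq]
    have : Nat.card E * m ≡ 1 [MOD q] := by
      unfold Nat.ModEq; rw [hm, Nat.mod_eq_of_lt hq.one_lt]
    exact this.of_dvd (orderOf_dvd_of_pow_eq_one hvq)
  refine ⟨(W ^ m : V), (W ^ m).2, ?_⟩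
  intro e he
  have h1 := hW ⟨e, he⟩
  have h2 : d ⟨e, he⟩ ^ Nat.card E = W * (act e W)⁻¹ := by
    rw [Nat.card_eq_fintype_card, eq_mul_inv_iff_mul_eq]; exact h1.symm
  have h3 : d ⟨e, he⟩ = W ^ m * (act e (W ^ m))⁻¹ := by
    rw [← hpow (d ⟨e, he⟩), pow_mul, h2, mul_pow, inv_pow, map_pow]
  have h4 := congrArg Subtype.val h3
  simp only [d, act, MonoidHom.coe_mk, OneHom.coe_mk, coe_mul, coe_inv] at h4
  rw [mul_inv_eq_iff_eq_mul] at h4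
  rw [h4]; group

theorem quot_surj {A : Type u} [CommGroup A] [Finite A] (f : A →* A) {U W : Subgroup A} (hUW : U ≤ W) (hU : U ≤ U.comap f)
    (hs : ∀ a, ∃ w ∈ W, a⁻¹ * f w ∈ U) : W = ⊤ := by
  let F : A ⧸ U →* A ⧸ U := QuotientGroup.map U U f hU
  have h1 : Function.Surjective (fun w : W.map (QuotientGroup.mk' U) => F w) := by
    intro b
    obtain ⟨a, rfl⟩ := QuotientGroup.mk_surjective b
    obtain ⟨w, hw, hw2⟩ := hs a
    exact ⟨⟨_, w, hw, rfl⟩, (QuotientGroup.eq.2 hw2).symm⟩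
  have h2 := Nat.card_le_card_of_surjective _ h1
  have h3 : W.map (QuotientGroup.mk' U) = ⊤ := by
    apply eq_top_of_card_eq
    exact le_antisymm (card_le_card_group _) h2
  rw [eq_top_iff]
  intro a _
  have : QuotientGroup.mk' U a ∈ W.map (QuotientGroup.mk' U) := by rw [h3]; trivial
  obtain ⟨w, hw, he⟩ := this
  have h4 := hUW (QuotientGroup.eq.1 he)
  have := W.mul_mem hw h4
  simpa using this

structure MV (q : ℕ) (V : Subgroup G) : Prop where
  nor : V.Normal
  nb : V ≠ ⊥
  min : ∀ N : Subgroup G, N.Normal → N ≤ V → N ≠ ⊥ → N = V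
  qg : QG q V
  cen : ∀ v ∈ V, ∀ s, qel q s → Commute v s
  exp : ∀ v ∈ V, v ^ q = 1

theorem exists_MV (hq : q.Prime) (hQC : QC q (⊤ : Subgroup G)) (hne : ∃ s : G, qel q s ∧ s ≠ 1) : ∃ V : Subgroup G, MV q V := by
  have hmem : ∀ s : G, s ∈ Oq q (⊤ : Subgroup G) ↔ qel q s := fun s => by rw [mem_Oq hQC]; simp
  have hn := Oq_normal hQC
  set Q := Oq q (⊤ : Subgroup G)
  obtain ⟨s, hs, hs1⟩ := hne
  obtain ⟨z, hz, hz1, hzc⟩ := exists_center hq (Oq_QG hQC) (fun hh => hs1 (by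
    have : s ∈ Oq q (⊤ : Subgroup G) := (hmem s).2 hs
    rw [hh, mem_bot] at this; exact this))
  have hZn : (Q ⊓ centralizer (Q : Set G)).Normal := by
    have : (centralizer (Q : Set G)).Normal := inferInstance
    exact Subgroup.normal_inf_normal _ _
  have hZb : Q ⊓ centralizer (Q : Set G) ≠ ⊥ := by
    intro hh
    have : z ∈ Q ⊓ centralizer (Q : Set G) := ⟨hz, mem_centralizer_iff.2 (fun s hs => (hzc s hs).symm)⟩
    rw [hh, mem_bot] at this; exact hz1 this
  obtain ⟨V, h1, h2⟩ := (Set.toFinite {N : Subgroup G | N.Normal ∧ N ≠ ⊥}).exists_le_minimal (show Q ⊓ centralizer (Q : Set G) ∈ _ from ⟨hZn, hZb⟩)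
  obtain ⟨hVn, hVb⟩ := h2.1
  have hmin : ∀ N : Subgroup G, N.Normal → N ≤ V → N ≠ ⊥ → N = V := fun N hN hNV hb => le_antisymm hNV (h2.2 ⟨hN, hb⟩ hNV)
  have hcen : ∀ v ∈ V, ∀ s, qel q s → Commute v s := fun v hv s hs =>
    ((mem_centralizer_iff.1 (h1 hv).2) s ((hmem s).2 hs)).symm
  have hqg : QG q V := fun v hv => (hmem v).1 (h1 hv).1
  refine ⟨V, hVn, hVb, hmin, hqg, hcen, ?_⟩
  let N : Subgroup G :=
    { carrier := {v | v ∈ V ∧ v ^ q = 1}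
      one_mem' := ⟨one_mem _, one_pow _⟩
      mul_mem' := by
        rintro a b ⟨ha, ha'⟩ ⟨hb, hb'⟩
        exact ⟨mul_mem ha hb, by rw [(hcen a ha b (hqg b hb)).mul_pow, ha', hb', one_mul]⟩
      inv_mem' := by
        rintro a ⟨ha, ha'⟩
        exact ⟨inv_mem ha, by rw [inv_pow, ha', inv_one]⟩ }
  have hN : N = V := by
    refine hmin N ⟨?_⟩ (fun v hv => hv.1) ?_
    · rintro v ⟨hv, hv'⟩ g
      exact ⟨hVn.conj_mem v hv g, by rw [conj_pow, hv']; simp⟩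
    · intro hh
      obtain ⟨v, hv, hv1⟩ := exists_ne_one' hVb
      obtain ⟨k, hk⟩ := hqg v hv
      have : Fact q.Prime := ⟨hq⟩
      have h5 : ∃ k, orderOf v = q ^ k := by
        obtain ⟨m, -, hm⟩ := (Nat.dvd_prime_pow hq).1 (orderOf_dvd_of_pow_eq_one hk)
        exact ⟨m, hm⟩
      obtain ⟨m, hm⟩ := h5
      rcases m with _ | m
      · rw [pow_zero, orderOf_eq_one_iff] at hm; exact hv1 hm
      · have h6 : v ^ (q ^ m) ∈ N := ⟨pow_mem hv _, by rw [← pow_mul, ← pow_succ, ← hm, pow_orderOf_eq_one]⟩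
        rw [hh, mem_bot] at h6
        have h7 := orderOf_dvd_of_pow_eq_one h6
        rw [hm, Nat.pow_dvd_pow_iff_le_right hq.one_lt] at h7
        omega
  intro v hv
  rw [← hN] at hv
  exact hv.2

theorem MV.comm {V : Subgroup G} (hV : MV q V) : ∀ v ∈ V, ∀ w ∈ V, Commute v w := fun v hv w hw => hV.cen v hv w (hV.qg w hw)

/-- action on V is abelian -/
def AbV (V : Subgroup G) : Prop := ∀ g k : G, ∀ v ∈ V, g * (k * v * k⁻¹) * g⁻¹ = k * (g * v * g⁻¹) * k⁻¹

theorem scal {V : Subgroup G} (hV : MV q V) (ha : AbV V) {g v : G} (hv : v ∈ V) (hv1 : v ≠ 1) (hg : g * v * g⁻¹ ∈ zpowers v) :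
    ∀ w ∈ V, g * w * g⁻¹ ∈ zpowers w := by
  obtain ⟨k, hk⟩ := hg
  have hk : v ^ k = g * v * g⁻¹ := hk
  let N : Subgroup G :=
    { carrier := {v | v ∈ V ∧ v ^ k = g * v * g⁻¹}
      one_mem' := ⟨one_mem _, by simp⟩
      mul_mem' := by
        rintro a b ⟨ha, ha'⟩ ⟨hb, hb'⟩
        exact ⟨mul_mem ha hb, by rw [(hV.comm a ha b hb).mul_zpow, ha', hb']; group⟩
      inv_mem' := by
        rintro a ⟨ha, ha'⟩
        exact ⟨inv_mem ha, by rw [inv_zpow, ha']; group⟩ }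
  have hN : N = V := by
    refine hV.min N ⟨?_⟩ (fun v hv => hv.1) ?_
    · rintro w ⟨hw, hw'⟩ l
      exact ⟨hV.nor.conj_mem w hw l, by rw [conj_zpow, hw', ha l g w hw]⟩
    · intro hh
      have : v ∈ N := ⟨hv, hk⟩
      rw [hh, mem_bot] at this; exact hv1 this
  intro w hw
  rw [← hN] at hw
  exact ⟨k, hw.2⟩

theorem line {V : Subgroup G} (hV : MV q V) (ha : AbV V) {S : Set G} (hS : closure S = ⊤)
    (hg : ∀ g ∈ S, ∃ v ∈ V, v ≠ 1 ∧ g * v * g⁻¹ ∈ zpowers v) : ∃ z : G, z ≠ 1 ∧ (zpowers z).Normal := by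
  obtain ⟨z, hz, hz1⟩ := exists_ne_one' hV.nb
  refine ⟨z, hz1, Nm_top ?_⟩
  rw [← top_le_iff, ← hS, closure_le]
  intro g hgS
  obtain ⟨v, hv, hv1, hgv⟩ := hg g hgS
  have := scal hV ha hv hv1 hgv z hz
  rw [SetLike.mem_coe, mem_Nm]
  rintro _ ⟨k, rfl⟩
  simp only
  rw [← conj_zpow]
  exact zpow_mem this k

end

section
open Polynomial in
theorem eigenB {q : ℕ} (hq : q.Prime) {A : Type u} [AddCommGroup A] [Finite A] [Nontrivial A] [Module (ZMod q) A]
    (f : A →+ A) (hf : ∀ x, f^[q] x = f x) : ∃ v : A, v ≠ 0 ∧ ∃ k : ℕ, f v = k • v := by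
  have : Fact q.Prime := ⟨hq⟩
  let F : Module.End (ZMod q) A := f.toZModLinearMap q
  have hF : ∀ x, F x = f x := fun x => rfl
  have hFF : F ^ q = F := by
    ext x
    rw [Module.End.pow_apply, hF, ← hf x]
    rfl
  have hdvd : minpoly (ZMod q) F ∣ X ^ q - X := minpoly.dvd _ _ (by simp [hFF])
  have hne := FiniteField.X_pow_card_sub_X_ne_zero (ZMod q) hq.one_lt
  have hsp : (X ^ q - X : (ZMod q)[X]).Splits := by
    have h1 := FiniteField.roots_X_pow_card_sub_X (ZMod q)
    rw [ZMod.card] at h1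
    rw [splits_iff_card_roots, h1, ← Finset.card_def, Finset.card_univ, ZMod.card,
      FiniteField.X_pow_card_sub_X_natDegree_eq (ZMod q) hq.one_lt]
  have hint : IsIntegral (ZMod q) F := Algebra.IsIntegral.isIntegral F
  obtain ⟨μ, hμ⟩ := (hsp.of_dvd hne hdvd).exists_eval_eq_zero (minpoly.degree_pos hint).ne'
  have h2 := Module.End.hasEigenvalue_of_isRoot (f := F) hμ
  obtain ⟨v, hv⟩ := h2.exists_hasEigenvector
  refine ⟨v, hv.2, μ.val, ?_⟩
  have h3 := hv.apply_eq_smul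
  rw [hF] at h3
  rw [h3, ← Nat.cast_smul_eq_nsmul (ZMod q), ZMod.natCast_zmod_val]

theorem eigenA {q : ℕ} (hq : q.Prime) {A : Type u} [AddCommGroup A] [Finite A] [Nontrivial A] (he : ∀ x : A, q • x = 0)
    (f : A →+ A) (hf : ∀ x, f^[q] x = f x) : ∃ v : A, v ≠ 0 ∧ ∃ k : ℕ, f v = k • v := by
  let _ : Module (ZMod q) A := AddCommGroup.zmodModule he
  exact eigenB hq f hf
end

section
variable {G : Type u} [Group G] [Finite G] {q : ℕ}

theorem eigen (hq : q.Prime) {V : Subgroup G} (hV : MV q V) {a : G} (ha : ∀ v ∈ V, Commute (a ^ (q - 1)) v) :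
    ∃ v ∈ V, v ≠ 1 ∧ a * v * a⁻¹ ∈ zpowers v := by
  let _ : CommGroup V := { (inferInstance : Group V) with mul_comm := fun a b => Subtype.ext (hV.comm a a.2 b b.2) }
  let f : V →* V :=
    { toFun := fun v => ⟨a * v * a⁻¹, hV.nor.conj_mem v v.2 a⟩
      map_one' := Subtype.ext (by simp)
      map_mul' := fun a b => Subtype.ext (by simp) }
  have hfn : ∀ n : ℕ, ∀ v : V, ((f^[n] v : V) : G) = a ^ n * v * (a ^ n)⁻¹ := by
    intro n
    induction n with
    | zero => intro v; simp
    | succ n ih =>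
      intro v
      rw [Function.iterate_succ_apply, ih]
      change a ^ n * (a * v * a⁻¹) * (a^n)⁻¹ = _
      rw [pow_succ]; group
  have hnt : Nontrivial (Additive V) := by
    obtain ⟨v, hv, hv1⟩ := exists_ne_one' hV.nb
    exact ⟨Additive.ofMul ⟨v, hv⟩, 0, fun hh => hv1 (congrArg (fun x : Additive V => ((Additive.toMul x : V) : G)) hh)⟩
  obtain ⟨v, hv, k, hk⟩ := eigenA hq (A := Additive V) (fun x => by
    apply Additive.toMul.injective
    exact Subtype.ext (by simpa using hV.exp _ (Additive.toMul x).2)) (MonoidHom.toAdditive f) (fun x => by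
    have h1 : f^[q] (Additive.toMul x) = f (Additive.toMul x) := by
      apply Subtype.ext
      rw [hfn]
      change _ = a * _ * a⁻¹
      have h2 : a ^ q = a * a ^ (q - 1) := by rw [← pow_succ', Nat.sub_add_cancel hq.one_lt.le]
      have h3 := ha _ (Additive.toMul x).2
      rw [h2, mul_inv_rev, mul_assoc a, h3.eq]; group
    exact h1)
  refine ⟨((Additive.toMul v : V) : G), (Additive.toMul v : V).2, fun hh => hv ?_, ?_⟩
  · apply Additive.toMul.injective
    exact Subtype.ext hh
  · have h4 : f (Additive.toMul v) = (Additive.toMul v) ^ k := hk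
    have h5 := congrArg (Subtype.val) h4
    exact ⟨k, by simpa [f] using h5.symm⟩
end

section
variable {G : Type u} [Group G] [Finite G] {q : ℕ} {y : G}

theorem Egen_le {K : Subgroup G} : Egen q K ≤ K := by
  unfold Egen
  rw [closure_le]
  rintro z ⟨a, ha, b, hb, rfl | rfl⟩
  · exact mul_mem (mul_mem (mul_mem ha hb) (inv_mem ha)) (inv_mem hb)
  · exact pow_mem ha _

theorem Egen_conj {K : Subgroup G} {b e : G} (hb : b ∈ K) (he : e ∈ Egen q K) : b * e * b⁻¹ ∈ Egen q K := by
  have h1 := Egen_map (MulAut.conj b).toMonoidHom he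
  have h2 : K.map (MulAut.conj b).toMonoidHom ≤ K := by
    rintro _ ⟨k, hk, rfl⟩
    exact mul_mem (mul_mem hb hk) (inv_mem hb)
  simpa using Egen_mono h2 h1

theorem Ind.fact (h : Ind G q y) {K : Subgroup G} (hK : ∀ k ∈ K, cop q k) {N : Subgroup G} (hN : N.Normal) (hb : N ≠ ⊥)
    {e s : G} (he : e ∈ Egen q K) (hs : qel q s) : e * s * e⁻¹ * s⁻¹ ∈ N := by
  have hQ := h.QCquo N hb
  have h1 := S4 h.hq _ (G ⧸ N) rfl (h.quo N hN hb) (Oq q ⊤) (Oq_normal hQ) (Oq_QG hQ) (QuotientGroup.mk' N e)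
    (Egen_mono le_top (Egen_map _ he)) ((hK e (Egen_le he)).map _) (QuotientGroup.mk' N s) ((mem_Oq hQ).2 ⟨trivial, hs.map' _⟩)
  have h2 : QuotientGroup.mk' N (e * s * e⁻¹ * s⁻¹) = 1 := by
    rw [map_mul, map_mul, map_mul, map_inv, map_inv, h1.eq]; group
  exact (QuotientGroup.eq_one_iff _).1 h2

theorem MV.act_eq {V : Subgroup G} (hV : MV q V) {g b : G} (hs : qel q (g⁻¹ * b)) : ∀ v ∈ V, g * v * g⁻¹ = b * v * b⁻¹ := by
  intro v hv
  have h1 := (hV.cen v hv _ hs).symm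
  have h2 : b * v * b⁻¹ = g * ((g⁻¹ * b) * v) * (g⁻¹ * b)⁻¹ * g⁻¹ := by group
  rw [h2, h1.eq]; group

theorem MV.act_comm {V : Subgroup G} (hV : MV q V) {a b : G} (hc : ∀ v ∈ V, Commute (a * b * a⁻¹ * b⁻¹) v) :
    ∀ v ∈ V, a * (b * v * b⁻¹) * a⁻¹ = b * (a * v * a⁻¹) * b⁻¹ := by
  intro v hv
  have h1 := hc _ (hV.nor.conj_mem _ (hV.nor.conj_mem v hv a) b)
  have h2 : a * (b * v * b⁻¹) * a⁻¹ = (a * b * a⁻¹ * b⁻¹) * (b * (a * v * a⁻¹) * b⁻¹) * (a * b * a⁻¹ * b⁻¹)⁻¹ := by group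
  rw [h2, h1.eq]; group

theorem Ind.caseE (h : Ind G q y) (hQC : QC q (⊤ : Subgroup G)) {V : Subgroup G} (hV : MV q V) {K : Subgroup G} (hK : ∀ k ∈ K, cop q k)
    (hKs : ∀ g, ∃ b ∈ K, qel q (g⁻¹ * b)) (hE : ∀ e ∈ Egen q K, ∀ v ∈ V, Commute e v) : ∃ z : G, z ≠ 1 ∧ (zpowers z).Normal := by
  refine line hV (S := Set.univ) ?_ (by simp) ?_
  · intro g k v hv
    obtain ⟨a, ha, hga⟩ := hKs g
    obtain ⟨b, hb, hkb⟩ := hKs k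
    rw [hV.act_eq hkb v hv, hV.act_eq hga v hv, hV.act_eq hga _ (hV.nor.conj_mem v hv b), hV.act_eq hkb _ (hV.nor.conj_mem v hv a)]
    exact hV.act_comm (fun w hw => hE _ (subset_closure ⟨a, ha, b, hb, Or.inl rfl⟩) w hw) v hv
  · intro g _
    obtain ⟨a, ha, hga⟩ := hKs g
    obtain ⟨v, hv, hv1, hav⟩ := eigen h.hq hV (a := a) (fun v hv => hE _ (subset_closure ⟨a, ha, a, ha, Or.inr rfl⟩) v hv)
    exact ⟨v, hv, hv1, by rwa [hV.act_eq hga v hv]⟩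

theorem Ind.QV (h : Ind G q y) (hQC : QC q (⊤ : Subgroup G)) {V : Subgroup G} (hV : MV q V) {K : Subgroup G} (hK : ∀ k ∈ K, cop q k)
    (hKs : ∀ g, ∃ b ∈ K, qel q (g⁻¹ * b)) (hE : ¬ ∀ e ∈ Egen q K, ∀ v ∈ V, Commute e v) : ∀ s, qel q s → s ∈ V := by
  have hmC : ∀ t, t ∈ centralizer (Egen q K : Set G) ↔ ∀ e ∈ Egen q K, Commute e t := fun t => mem_centralizer_iff
  have hbC : ∀ b ∈ K, ∀ t ∈ centralizer (Egen q K : Set G), b * t * b⁻¹ ∈ centralizer (Egen q K : Set G) := by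
    intro b hb t ht
    rw [hmC] at *
    intro e he
    have h1 := (ht _ (Egen_conj (inv_mem hb) he)).conj2 b
    have h2 : b * (b⁻¹ * e * b⁻¹⁻¹) * b⁻¹ = e := by group
    rwa [h2] at h1
  set C := centralizer (Egen q K : Set G)
  have hVC : V ⊓ C = ⊥ := by
    by_contra hb
    have := hV.min (V ⊓ C) ⟨by
      rintro v ⟨hv, hvC⟩ g
      have hv : v ∈ V := hv
      have hvC : v ∈ C := hvC
      obtain ⟨b, hb, hgb⟩ := hKs g
      exact ⟨hV.nor.conj_mem v hv g, by rw [hV.act_eq hgb v hv]; exact hbC b hb v hvC⟩⟩ inf_le_left hb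
    apply hE
    intro e he v hv
    rw [← this] at hv
    exact (hmC v).1 hv.2 e he
  have hmem : ∀ s : G, s ∈ Oq q (⊤ : Subgroup G) ↔ qel q s := fun s => by rw [mem_Oq hQC]; simp
  have hQn := Oq_normal hQC
  have hdec : ∀ t, qel q t → ∃ u ∈ V, u⁻¹ * t ∈ Oq q (⊤ : Subgroup G) ⊓ C := by
    intro t ht
    obtain ⟨u, hu, hu2⟩ := COC h.hq hV.nor hV.comm hV.exp (E := Egen q K) (fun e he => hK e (Egen_le he)) (MulAut.conj t).toMonoidHom
      (fun e he => by
        have := inv_mem (h.fact hK hV.nor hV.nb he ht)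
        have e1 : (e * t * e⁻¹ * t⁻¹)⁻¹ = t * e * t⁻¹ * e⁻¹ := by group
        rw [e1] at this
        simpa using this)
    refine ⟨u, hu, (Oq q (⊤ : Subgroup G)).mul_mem ((Oq q (⊤ : Subgroup G)).inv_mem ((hmem u).2 (hV.qg u hu))) ((hmem t).2 ht), (hmC _).2 ?_⟩
    intro e he
    have h3 : t * e * t⁻¹ = u * e * u⁻¹ := by simpa using hu2 e he
    have h4 : u⁻¹ * t * e = e * (u⁻¹ * t) := by
      have : u⁻¹ * t * e = u⁻¹ * (t * e * t⁻¹) * t := by group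
      rw [this, h3]; group
    exact h4.symm
  have hQ0n : (Oq q (⊤ : Subgroup G) ⊓ C).Normal := by
    constructor
    intro n hn g
    obtain ⟨b, hb, hgb⟩ := hKs g
    obtain ⟨u, hu, ht0⟩ := hdec _ hgb.inv
    set t0 := u⁻¹ * (g⁻¹ * b)⁻¹ with ht0d
    have e1 : g = b * (u * t0) := by rw [ht0d]; group
    have h1 : t0 * n * t0⁻¹ ∈ Oq q (⊤ : Subgroup G) ⊓ C := mul_mem (mul_mem ht0 hn) (inv_mem ht0)
    have h1a : t0 * n * t0⁻¹ ∈ Oq q (⊤ : Subgroup G) := h1.1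
    have h1b : t0 * n * t0⁻¹ ∈ C := h1.2
    have h2 := hV.cen u hu _ ((hmem _).1 h1a)
    have e2 : g * n * g⁻¹ = b * (u * (t0 * n * t0⁻¹)) * u⁻¹ * b⁻¹ := by rw [e1]; group
    rw [h2.eq] at e2
    have e3 : g * n * g⁻¹ = b * (t0 * n * t0⁻¹) * b⁻¹ := by rw [e2]; group
    rw [e3]
    exact ⟨hQn.conj_mem _ h1a b, hbC b hb _ h1b⟩
  by_cases hQ0 : Oq q (⊤ : Subgroup G) ⊓ C = ⊥
  · intro s hs
    obtain ⟨u, hu, h1⟩ := hdec s hs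
    rw [hQ0, mem_bot, inv_mul_eq_one] at h1
    rwa [← h1]
  · exfalso
    apply hE
    intro e he v hv
    have h1 := h.fact hK hQ0n hQ0 he (hV.qg v hv)
    have h2 : e * v * e⁻¹ * v⁻¹ ∈ V ⊓ C := ⟨V.mul_mem (hV.nor.conj_mem v hv e) (V.inv_mem hv), h1.2⟩
    rw [hVC, mem_bot, mul_inv_eq_one, mul_inv_eq_iff_eq_mul] at h2
    exact h2

/-- split situation -/
structure Spl (G : Type u) [Group G] (q : ℕ) (V K : Subgroup G) (π : G →* G) : Prop where
  cop : ∀ k ∈ K, cop q k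
  mem : ∀ g, π g ∈ K
  id : ∀ k ∈ K, π k = k
  V : ∀ g, π g * g⁻¹ ∈ V

theorem exists_Spl (hq : q.Prime) {V : Subgroup G} (hV : MV q V) {K : Subgroup G} (hK : ∀ k ∈ K, cop q k)
    (hKs : ∀ g, ∃ b ∈ K, qel q (g⁻¹ * b)) (hQ : ∀ s, qel q s → s ∈ V) : ∃ π : G →* G, Spl G q V K π := by
  have huniq : ∀ a ∈ K, ∀ b ∈ K, a * b⁻¹ ∈ V → a = b := by
    intro a ha b hb hab
    have := (hV.qg _ hab).eq_one (hK _ (mul_mem ha (inv_mem hb)))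
    exact mul_inv_eq_one.1 this
  have hex : ∀ g, ∃ b ∈ K, b * g⁻¹ ∈ V := by
    intro g
    obtain ⟨b, hb, h1⟩ := hKs g
    refine ⟨b, hb, ?_⟩
    have := hV.nor.conj_mem _ (hQ _ h1) g
    have e : g * (g⁻¹ * b) * g⁻¹ = b * g⁻¹ := by group
    rwa [e] at this
  choose p hpK hpV using hex
  refine ⟨MonoidHom.mk' p ?_, ?_⟩
  · intro a b
    refine huniq _ (hpK _) _ (mul_mem (hpK _) (hpK _)) ?_
    have h1 := hpV (a * b)
    have h2 := inv_mem (hV.nor.conj_mem _ (hpV b) (p a))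
    have h3 := mul_mem (mul_mem h1 (inv_mem (hpV a))) h2
    have h4 := h3
    have e : p (a * b) * (a * b)⁻¹ * (p a * a⁻¹)⁻¹ * (p a * (p b * b⁻¹) * (p a)⁻¹)⁻¹ = p (a*b) * b⁻¹ * (p a)⁻¹ * p a * b * (p b)⁻¹ * (p a)⁻¹ := by group
    rw [e] at h4
    have e' : p (a*b) * b⁻¹ * (p a)⁻¹ * p a * b * (p b)⁻¹ * (p a)⁻¹ = p (a * b) * (p a * p b)⁻¹ := by group
    rwa [e'] at h4
  · refine ⟨hK, hpK, fun k hk => huniq _ (hpK k) _ hk (hpV k), hpV⟩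
end

section
variable {G : Type u} [Group G] [Finite G] {q : ℕ} {y : G} {V K : Subgroup G} {π : G →* G}

theorem Spl.qel' (hV : MV q V) (hS : Spl G q V K π) (g : G) : qel q (g⁻¹ * π g) := by
  have h1 := hV.qg _ (hV.nor.conj_mem _ (hS.V g) g⁻¹)
  have e : g⁻¹ * (π g * g⁻¹) * g⁻¹⁻¹ = g⁻¹ * π g := by group
  rwa [e] at h1

theorem Spl.act (hV : MV q V) (hS : Spl G q V K π) (g : G) : ∀ v ∈ V, g * v * g⁻¹ = π g * v * (π g)⁻¹ :=
  hV.act_eq (hS.qel' hV g)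

theorem Spl.ker (hV : MV q V) (hS : Spl G q V K π) {v : G} (hv : v ∈ V) : π v = 1 := by
  have h1 := V.mul_mem (hS.V v) hv
  rw [inv_mul_cancel_right] at h1
  exact (hV.qg _ h1).eq_one (hS.cop _ (hS.mem v))

theorem cop_zpowers {x : G} (hx : cop q x) : ∀ e ∈ zpowers x, cop q e := by
  obtain ⟨m, hm, h1⟩ := hx
  rintro _ ⟨k, rfl⟩
  exact ⟨m, hm, by
    change (x ^ k) ^ m = 1
    rw [← zpow_natCast, zpow_comm, zpow_natCast, h1, one_zpow]⟩

theorem Spl.Ic (hq : q.Prime) (hV : MV q V) (hQ : ∀ s, qel q s → s ∈ V) (hS : Spl G q V K π) {x : G} (hx : x ∈ Ic G) : π x ∈ _root_.Ic G := by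
  obtain ⟨m, n, hm, hn, hmn⟩ := exists_decomp hq x
  obtain ⟨u, hu, h1⟩ := COC hq hV.nor hV.comm hV.exp (cop_zpowers hn) π (fun e _ => hS.V e)
  have h2 := h1 _ (mem_zpowers _)
  have h3 : π x = π (x ^ n) := by
    conv_lhs => rw [← hmn]
    rw [map_mul, hS.ker hV (hQ _ hm), one_mul]
  rw [h3, h2]
  exact Ic_conj (Ic_pow hx n) u

theorem Spl.X (h : Ind G q y) (hV : MV q V) (hQ : ∀ s, qel q s → s ∈ V) (hS : Spl G q V K π) {x g v : G} (hx : x ∈ K) (hg : g ∈ K) (hv : v ∈ V)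
    (hX : IsSupersoluble (closure ({x, g * v} : Set G))) :
    ∃ u ∈ V, ∀ b ∈ closure ({x, g} : Set G), u⁻¹ * b * u ∈ closure ({x, g * v} : Set G) := by
  have hXQ := (ss_QCS h.hq hX h.hr).1
  set X := closure ({x, g * v} : Set G) with hXd
  obtain ⟨B1, hB1, hB1c, hB1s⟩ := SZ h.hq hXQ
  obtain ⟨u, hu, h1⟩ := COC h.hq hV.nor hV.comm hV.exp hB1c π (fun e _ => hS.V e)
  refine ⟨u, hu, ?_⟩
  have key : ∀ t ∈ X, u⁻¹ * π t * u ∈ X := by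
    intro t ht
    obtain ⟨b, hb, h2⟩ := hB1s t ht
    have h3 : t⁻¹ * b ∈ V := hQ _ ((mem_Oq hXQ).1 h2).2
    have h4 := hS.ker hV h3
    rw [map_mul, map_inv, inv_mul_eq_one] at h4
    rw [h4, h1 b hb]
    have e : u⁻¹ * (u * b * u⁻¹) * u = b := by group
    rw [e]; exact hB1 hb
  have h5 : closure ({x, g} : Set G) ≤ X.comap (MulAut.conj u⁻¹).toMonoidHom := by
    rw [closure_le]
    rintro z (rfl | rfl)
    · have := key z (subset_closure (by simp))
      rw [hS.id z hx] at this
      simpa using this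
    · have := key (z * v) (subset_closure (by simp))
      rw [map_mul, hS.ker hV hv, mul_one, hS.id z hg] at this
      simpa using this
  intro b hb
  simpa using h5 hb

theorem Spl.L31 (h : Ind G q y) (hV : MV q V) (hQ : ∀ s, qel q s → s ∈ V) (hS : Spl G q V K π) {x g : G} (hx : x ∈ K) (hxI : x ∈ _root_.Ic G) (hg : g ∈ K)
    {U : Subgroup G} (hUV : U ≤ V) (hxU : x ∈ Nm U) (hgU : g ∈ Nm U)
    (hXU : ∀ v ∈ V, ∀ s ∈ closure ({x, g * v} : Set G), s ∈ V → s ∈ U) : ∀ w ∈ V, w * x * w⁻¹ * x⁻¹ ∈ U := by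
  let _ : CommGroup V := { (inferInstance : Group V) with mul_comm := fun a b => Subtype.ext (hV.comm a a.2 b b.2) }
  let act : G → V →* V := fun e =>
    { toFun := fun v => ⟨e * v * e⁻¹, hV.nor.conj_mem v v.2 e⟩
      map_one' := Subtype.ext (by simp)
      map_mul' := fun a b => Subtype.ext (by simp) }
  let cm : G → V →* V := fun e =>
    { toFun := fun v => v * (act e v)⁻¹
      map_one' := by simp
      map_mul' := fun a b => by rw [map_mul, mul_inv]; exact mul_mul_mul_comm _ _ _ _ }
  have hcm : ∀ (e : G) (v : V), ((cm e v : V) : G) = v * (e * v * e⁻¹)⁻¹ := fun e v => rfl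
  have hle : ∀ e ∈ Nm U, U.subgroupOf V ≤ (U.subgroupOf V).comap (cm e) := by
    intro e he w hw
    rw [mem_subgroupOf] at hw
    rw [mem_comap, mem_subgroupOf, hcm]
    exact mul_mem hw (inv_mem (Nm_conj he hw))
  have key : (U.subgroupOf V).comap (cm x) = ⊤ := by
    refine quot_surj (cm g) (hle x hxU) (hle g hgU) ?_
    intro a
    have hv : g⁻¹ * a * g ∈ V := by simpa using hV.nor.conj_mem a a.2 g⁻¹
    obtain ⟨u, hu, h1⟩ := hS.X h hV hQ hx hg hv (hxI _)
    have h2 := hXU _ hv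
    set X := closure ({x, g * (g⁻¹ * a * g)} : Set G) with hXd
    have hxX : x ∈ X := subset_closure (by simp)
    have hgX : g * (g⁻¹ * a * g) ∈ X := subset_closure (by simp)
    have h3 := h1 x (subset_closure (by simp))
    have h4 := h1 g (subset_closure (by simp))
    refine ⟨⟨u⁻¹, inv_mem hu⟩, ?_, ?_⟩
    · rw [mem_comap, mem_subgroupOf, hcm]
      have e : u⁻¹ * (x * u⁻¹ * x⁻¹)⁻¹ = u⁻¹ * x * u * x⁻¹ := by group
      change u⁻¹ * (x * u⁻¹ * x⁻¹)⁻¹ ∈ U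
      refine h2 _ ?_ (V.mul_mem (inv_mem hu) (inv_mem (hV.nor.conj_mem _ (inv_mem hu) x)))
      rw [e]
      exact mul_mem h3 (inv_mem hxX)
    · rw [mem_subgroupOf]
      have hcg : ((cm g ⟨u⁻¹, inv_mem hu⟩ : V) : G) = u⁻¹ * (g * u⁻¹ * g⁻¹)⁻¹ := rfl
      rw [mul_comm, coe_mul, hcg, coe_inv]
      refine h2 _ ?_ (V.mul_mem (V.mul_mem (inv_mem hu) (inv_mem (hV.nor.conj_mem _ (inv_mem hu) g))) (inv_mem a.2))
      have e : u⁻¹ * (g * u⁻¹ * g⁻¹)⁻¹ * (a : G)⁻¹ = u⁻¹ * g * u * (g * (g⁻¹ * a * g))⁻¹ := by group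
      rw [e]
      exact mul_mem h4 (inv_mem hgX)
  intro w hw
  have h1 : (⟨w, hw⟩ : V) ∈ (U.subgroupOf V).comap (cm x) := by rw [key]; trivial
  rw [mem_comap, mem_subgroupOf, hcm] at h1
  have e : w * (x * w * x⁻¹)⁻¹ = w * x * w⁻¹ * x⁻¹ := by group
  change w * (x * w * x⁻¹)⁻¹ ∈ U at h1
  rwa [e] at h1

theorem Spl.comm (h : Ind G q y) (hV : MV q V) (hQ : ∀ s, qel q s → s ∈ V) (hS : Spl G q V K π) {x g : G} (hx : x ∈ K) (hxI : x ∈ _root_.Ic G) (hg : g ∈ K) :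
    ∀ v ∈ V, Commute (x * g * x⁻¹ * g⁻¹) v := by
  set B := closure ({x, g} : Set G) with hB
  have hxB : x ∈ B := subset_closure (by simp)
  have hgB : g ∈ B := subset_closure (by simp)
  have hBK : B ≤ K := by
    rw [hB, closure_le]; rintro z (rfl | rfl) <;> assumption
  have hmC : ∀ t, t ∈ centralizer (Egen q B : Set G) ↔ ∀ e ∈ Egen q B, Commute e t := fun t => mem_centralizer_iff
  set C := centralizer (Egen q B : Set G)
  have hbC : ∀ b ∈ B, b ∈ Nm (V ⊓ C) := by
    intro b hb
    rw [mem_Nm]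
    rintro t ⟨htV, ht⟩
    refine ⟨hV.nor.conj_mem t htV b, (hmC _).2 ?_⟩
    have ht := (hmC _).1 ht
    intro e he
    have h1 := (ht _ (Egen_conj (inv_mem hb) he)).conj2 b
    have h2 : b * (b⁻¹ * e * b⁻¹⁻¹) * b⁻¹ = e := by group
    rwa [h2] at h1
  have hU := hS.L31 h hV hQ hx hxI hg (U := V ⊓ C) inf_le_left (hbC x hxB) (hbC g hgB) (by
    intro v hv s hsX hsV
    refine ⟨hsV, (hmC s).2 ?_⟩
    intro e he
    obtain ⟨u, hu, h1⟩ := hS.X h hV hQ hx hg hv (hxI _)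
    have h2 : u⁻¹ * e * u ∈ Egen q (closure ({x, g * v} : Set G)) := by
      have h3 := Egen_map (MulAut.conj u⁻¹).toMonoidHom he
      have h4 : B.map (MulAut.conj u⁻¹).toMonoidHom ≤ closure ({x, g * v} : Set G) := by
        rintro _ ⟨k, hk, rfl⟩
        simpa using h1 k hk
      simpa using Egen_mono h4 h3
    have hec := (hS.cop e (hBK (Egen_le he)))
    have h5 := (ss_QCS h.hq (hxI (g * v)) h.hr).2 _ h2 (by simpa using hec.conj u⁻¹) s hsX (hV.qg s hsV)
    have h6 := h5.conj2 u
    have e1 : u * (u⁻¹ * e * u) * u⁻¹ = e := by group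
    have e2 : u * s * u⁻¹ = s := by rw [(hV.comm u hu s hsV).eq]; group
    rwa [e1, e2] at h6)
  set U := V ⊓ C
  intro v hv
  have hk : x * g * x⁻¹ * g⁻¹ ∈ Egen q B := subset_closure ⟨x, hxB, g, hgB, Or.inl rfl⟩
  have hkU : (x * g * x⁻¹ * g⁻¹) * v * (x * g * x⁻¹ * g⁻¹)⁻¹ * v⁻¹ ∈ U := by
    have hv' : g⁻¹ * v * g ∈ V := by simpa using hV.nor.conj_mem v hv g⁻¹
    have h1 := Nm_conj' (hbC x hxB) (hU _ hv')
    have h2 := Nm_conj (hbC g hgB) h1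
    have hp : g * x⁻¹ * g⁻¹ * v * (g * x⁻¹ * g⁻¹)⁻¹ ∈ V := hV.nor.conj_mem v hv _
    have h3 := mul_mem (inv_mem (hU _ hp)) h2
    convert h3 using 1
    group
  exact quadratic' (hS.cop _ (hBK (Egen_le hk))) (hV.qg _ hkU.1) ((hmC _).1 hkU.2 _ hk)

theorem Spl.AbV (h : Ind G q y) (hV : MV q V) (hQ : ∀ s, qel q s → s ∈ V) (hS : Spl G q V K π) : AbV V := by
  have hmC : ∀ t, t ∈ centralizer (V : Set G) ↔ ∀ v ∈ V, Commute v t := fun t => mem_centralizer_iff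
  have hVn := hV.nor
  have hCn : (centralizer (V : Set G)).Normal := inferInstance
  set C := centralizer (V : Set G)
  have h1 : ∀ x ∈ _root_.Ic G, ∀ g, x * g * x⁻¹ * g⁻¹ ∈ C := by
    intro x hx g
    rw [hmC]
    intro v hv
    have h2 := hS.act hV (x * g * x⁻¹ * g⁻¹) v hv
    rw [map_mul, map_mul, map_mul, map_inv, map_inv] at h2
    have h3 := hS.comm h hV hQ (hS.mem x) (hS.Ic h.hq hV hQ hx) (hS.mem g) v hv
    rw [h3.eq, mul_inv_cancel_right, mul_inv_eq_iff_eq_mul] at h2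
    exact Commute.symm h2
  set p := QuotientGroup.mk' C
  have hp : ∀ a b : G, Commute (p a) (p b) ↔ a * b * a⁻¹ * b⁻¹ ∈ C := by
    intro a b
    have : p (a * b * a⁻¹ * b⁻¹) = 1 ↔ a * b * a⁻¹ * b⁻¹ ∈ C := QuotientGroup.eq_one_iff _
    rw [← this, map_mul, map_mul, map_mul, map_inv, map_inv, mul_inv_eq_one, mul_inv_eq_iff_eq_mul]
    rfl
  have h2 : ∀ b : G, Commute (p b) (p y) := by
    intro b
    have : (⊤ : Subgroup G) ≤ (centralizer {p y}).comap p := by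
      rw [← h.gen, closure_le]
      rintro z (rfl | hz)
      · exact mem_Cz.2 (Commute.refl _)
      · exact mem_Cz.2 ((hp _ _).2 (h1 z hz y)).symm
    exact (mem_Cz.1 (this (mem_top b))).symm
  have h3 : ∀ a b : G, Commute (p a) (p b) := by
    intro a b
    have : (⊤ : Subgroup G) ≤ (centralizer {p b}).comap p := by
      rw [← h.gen, closure_le]
      rintro z (rfl | hz)
      · exact mem_Cz.2 (h2 b)
      · exact mem_Cz.2 ((hp _ _).2 (h1 z hz b)).symm
    exact (mem_Cz.1 (this (mem_top a))).symm
  intro a b v hv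
  exact hV.act_comm (fun w hw => ((hmC _).1 ((hp a b).1 (h3 a b)) w hw).symm) v hv

theorem MV.eig (hV : MV q V) {X : Subgroup G} (hX : IsSupersoluble X) {s g : G} (hs : s ∈ X) (hsV : s ∈ V) (hs1 : s ≠ 1) (hg : g ∈ X) :
    ∃ v ∈ V, v ≠ 1 ∧ g * v * g⁻¹ ∈ zpowers v := by
  have hVn := hV.nor
  obtain ⟨z, hz, hzp, hzn⟩ := ss_line hX (N := X ⊓ V) inf_le_left (fun a ha => Nm_inf (le_Nm _ ha) (by
    rw [mem_Nm]; exact fun v hv => hVn.conj_mem v hv a)) (fun hh => hs1 (by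
    have : s ∈ X ⊓ V := ⟨hs, hsV⟩
    rw [hh, mem_bot] at this; exact this))
  refine ⟨z, hz.2, ?_, Nm_conj (hzn hg) (mem_zpowers z)⟩
  rintro rfl
  rw [orderOf_one] at hzp; exact Nat.not_prime_one hzp

theorem Spl.fin (h : Ind G q y) (hV : MV q V) (hQ : ∀ s, qel q s → s ∈ V) (hS : Spl G q V K π) : ∃ z : G, z ≠ 1 ∧ (zpowers z).Normal := by
  obtain ⟨v1, hv1, hv11⟩ := exists_ne_one' hV.nb
  refine line hV (hS.AbV h hV hQ) h.gen ?_
  rintro g (rfl | hg)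
  swap
  · exact hV.eig (hg v1) (subset_closure (by simp)) hv1 hv11 (subset_closure (by simp))
  by_cases hc : ∀ x ∈ _root_.Ic G, ∀ v ∈ V, Commute x v
  · by_cases hvI : ∃ v ∈ V, v ≠ 1 ∧ v ∈ _root_.Ic G
    · obtain ⟨v, hv, hv2, hvI⟩ := hvI
      exact hV.eig (hvI g) (subset_closure (by simp)) hv hv2 (subset_closure (by simp))
    push Not at hvI
    have hcop : ∀ x ∈ _root_.Ic G, _root_.cop q x := by
      intro x hx
      obtain ⟨m, n, hm, hn, hmn⟩ := exists_decomp h.hq x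
      have : x ^ m = 1 := by
        by_contra hne
        exact hvI _ (hQ _ hm) hne (Ic_pow hx m)
      rw [this, one_mul] at hmn
      rwa [hmn] at hn
    set L := closure (_root_.Ic G) with hL
    have hLn : L.Normal := by
      apply Nm_top
      rw [eq_top_iff]
      intro a _
      rw [mem_Nm]
      intro l hl
      have : L ≤ L.comap (MulAut.conj a).toMonoidHom := by
        conv_lhs => rw [hL]
        rw [closure_le]
        intro x hx
        exact subset_closure (by simpa using Ic_conj hx a)
      simpa using this hl
    by_cases hLV : L ⊓ V = ⊥
    · refine ⟨v1, hv1, hv11, ?_⟩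
      have h1 : v1 ∈ L ⊔ zpowers g := by
        have : (⊤ : Subgroup G) ≤ L ⊔ zpowers g := by
          rw [← h.gen, closure_le]
          rintro z (rfl | hz)
          · exact mem_sup_right (mem_zpowers z)
          · exact mem_sup_left (subset_closure hz)
        exact this (mem_top _)
      obtain ⟨l, hl, w, ⟨i, hi⟩, hlw⟩ := Subgroup.mem_sup_of_normal_left.1 h1
      have hi : g ^ i = w := hi
      subst hi
      have h2 : g * v1 * g⁻¹ * v1⁻¹ ∈ L ⊓ V := by
        refine ⟨?_, V.mul_mem (hV.nor.conj_mem v1 hv1 g) (V.inv_mem hv1)⟩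
        have e : g * v1 * g⁻¹ * v1⁻¹ = g * l * g⁻¹ * l⁻¹ := by rw [← hlw]; group
        rw [e]
        exact L.mul_mem (hLn.conj_mem l hl g) (L.inv_mem hl)
      rw [hLV, mem_bot, mul_inv_eq_one] at h2
      rw [h2]; exact mem_zpowers v1
    · exfalso
      have hVn := hV.nor
      have h1 : L ⊓ V = V := hV.min _ (Subgroup.normal_inf_normal _ _) inf_le_right hLV
      have h2 : L ≤ K := by
        rw [hL, closure_le]
        intro x hx
        obtain ⟨u, hu, h3⟩ := COC h.hq hV.nor hV.comm hV.exp (cop_zpowers (hcop x hx)) π (fun e _ => hS.V e)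
        have h4 := h3 x (mem_zpowers x)
        rw [← (hc x hx u hu).eq, mul_inv_cancel_right] at h4
        have := hS.mem x
        rwa [h4] at this
      have h3 : v1 ∈ L := by
        have h5 : v1 ∈ L ⊓ V := by rw [h1]; exact hv1
        exact h5.1
      exact hv11 ((hV.qg v1 hv1).eq_one (hS.cop v1 (h2 h3)))
  · push Not at hc
    obtain ⟨x0, hx0, v0, hv0, hcc⟩ := hc
    by_contra hno
    apply hcc
    have h1 := hS.L31 h hV hQ (hS.mem x0) (hS.Ic h.hq hV hQ hx0) (hS.mem g) (U := ⊥) bot_le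
      (by rw [mem_Nm]; intro t ht; rw [mem_bot] at *; rw [ht]; simp) (by rw [mem_Nm]; intro t ht; rw [mem_bot] at *; rw [ht]; simp) (by
      intro v hv s hs hsV
      rw [mem_bot]
      by_contra hs1
      obtain ⟨w, hw, hw1, hw2⟩ := hV.eig (hS.Ic h.hq hV hQ hx0 _) hs hsV hs1 (g := π g * v) (subset_closure (by simp))
      apply hno
      refine ⟨w, hw, hw1, ?_⟩
      rw [hV.act_eq (b := π g * v) ?_ w hw]
      · exact hw2
      · rw [← mul_assoc]
        exact (hS.qel' hV g).mul (hV.qg v hv) (hV.cen v hv _ (hS.qel' hV g)).symm) v0 hv0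
    rw [mem_bot, mul_inv_eq_one, mul_inv_eq_iff_eq_mul] at h1
    have h2 := hS.act hV x0 v0 hv0
    rw [← h1, mul_inv_cancel_right, mul_inv_eq_iff_eq_mul] at h2
    exact h2

theorem Ind.case2' (h : Ind G q y) (hQC : QC q (⊤ : Subgroup G)) : IsSupersoluble G := by
  obtain ⟨V, hV⟩ := exists_MV h.hq hQC h.ne
  obtain ⟨K, -, hK, hKs⟩ := SZ h.hq hQC
  have hKs : ∀ g, ∃ b ∈ K, qel q (g⁻¹ * b) := fun g => by
    obtain ⟨b, hb, h1⟩ := hKs g trivial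
    exact ⟨b, hb, ((mem_Oq hQC).1 h1).2⟩
  have key : ∃ z : G, z ≠ 1 ∧ (zpowers z).Normal := by
    by_cases hE : ∀ e ∈ Egen q K, ∀ v ∈ V, Commute e v
    · exact h.caseE hQC hV hK hKs hE
    · have hQ := h.QV hQC hV hK hKs hE
      obtain ⟨π, hS⟩ := exists_Spl h.hq hV hK hKs hQ
      exact hS.fin h hV hQ
  obtain ⟨z, hz1, hz⟩ := key
  exact ss_of_cyclic_normal z hz (h.quo _ hz (by rwa [Ne, zpowers_eq_bot]))

theorem gen_Ic_top {A : Set G} (hA : A ⊆ Ic G) (z : G) (hzH : z ∈ closure (insert z A)) :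
    closure (insert (⟨z, hzH⟩ : closure (insert z A)) (Ic (closure (insert z A)))) = ⊤ := by
  have h2 : closure (insert z A) ≤ (closure (insert (⟨z, hzH⟩ : closure (insert z A)) (Ic (closure (insert z A))))).map (closure (insert z A)).subtype := by
    refine (closure_le _).2 ?_
    rintro a (rfl | ha)
    · exact ⟨⟨a, hzH⟩, subset_closure (by simp), rfl⟩
    · have haH : a ∈ closure (insert z A) := subset_closure (Or.inr ha)
      exact ⟨⟨a, haH⟩, subset_closure (Or.inr (Ic_sub (hA ha))), rfl⟩
  rw [eq_top_iff]
  rintro ⟨a, ha⟩ _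
  obtain ⟨b, hb, hba⟩ := h2 ha
  have : b = ⟨a, ha⟩ := Subtype.ext hba
  rwa [← this]

theorem main_ind : ∀ (n : ℕ) (G : Type u) [Group G] [Finite G], Nat.card G = n → ∀ y : G, closure (insert y (Ic G)) = ⊤ → IsSupersoluble G := by
  intro n
  induction n using Nat.strong_induction_on with
  | _ n ih =>
  intro G _ _ hn y hy
  by_cases h1 : Nat.card G = 1
  · apply ss_cyclic (1 : G)
    have : Subsingleton G := (Nat.card_eq_one_iff_unique.1 h1).1
    exact Subsingleton.elim _ _
  have hne : (Nat.card G).primeFactors.Nonempty := Nat.nonempty_primeFactors.2 (by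
    have := Nat.card_pos (α := G); omega)
  let q := (Nat.card G).primeFactors.max' hne
  have hqm : q ∈ (Nat.card G).primeFactors := Finset.max'_mem _ hne
  have hI : Ind G q y := by
    refine ⟨Nat.prime_of_mem_primeFactors hqm, Nat.dvd_of_mem_primeFactors hqm, ?_, hy, ?_, ?_⟩
    · intro r hr hd
      exact Finset.le_max' _ _ (Nat.mem_primeFactors.2 ⟨hr, hd, Nat.card_pos.ne'⟩)
    · intro A hA z hne
      set H := closure (insert z A) with hH
      have hzH : z ∈ H := subset_closure (by simp)
      have hlt : Nat.card H < n := by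
        rw [← hn]
        refine lt_of_le_of_ne (card_le_card_group H) (fun hh => hne (eq_top_of_card_eq H hh))
      exact ih _ hlt H rfl ⟨z, hzH⟩ (gen_Ic_top hA z hzH)
    · intro N hN hb
      have hlt : Nat.card (G ⧸ N) < n := by
        rw [← hn, card_eq_card_quotient_mul_card_subgroup N]
        have : 1 < Nat.card N := by
          rw [one_lt_card_iff_ne_bot]; exact hb
        exact lt_mul_of_one_lt_right Nat.card_pos this
      refine ih _ hlt (G ⧸ N) rfl (QuotientGroup.mk' N y) ?_
      have hs := QuotientGroup.mk'_surjective N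
      rw [eq_top_iff, ← Subgroup.map_top_of_surjective _ hs, ← hy, MonoidHom.map_closure]
      apply Subgroup.closure_mono
      rintro _ ⟨a, (rfl | ha), rfl⟩
      · exact Or.inl rfl
      · exact Or.inr (Ic_map _ hs ha)
  by_cases hN : ∀ N : Subgroup G, N.Normal → QG q N → N = ⊥
  · exact hI.case1 hN
  · exact hI.case2' (hI.case2 hN)

theorem Ic_triple {x1 x2 : G} (h1 : x1 ∈ Ic G) (h2 : x2 ∈ Ic G) (y : G) : IsSupersoluble (closure ({y, x1, x2} : Set G)) := by
  have hA : ({x1, x2} : Set G) ⊆ Ic G := by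
    rintro a (ha | ha)
    · rw [ha]; exact h1
    · rw [Set.mem_singleton_iff.1 ha]; exact h2
  have hy : y ∈ closure (insert y ({x1, x2} : Set G)) := subset_closure (Set.mem_insert _ _)
  exact main_ind _ _ rfl ⟨y, hy⟩ (gen_Ic_top hA y hy)

end

theorem final_thm (G : Type u) [Group G] [Finite G] :
    ∃ H : Subgroup G, (H : Set G) = Ic G := by
  refine ⟨{ carrier := Ic G, one_mem' := ?_, mul_mem' := ?_, inv_mem' := ?_ }, rfl⟩
  · intro a b ha hb y
    refine ss_of_le ?_ (Ic_triple ha hb y)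
    rw [closure_le]
    rintro z (rfl | rfl)
    · exact mul_mem (subset_closure (by simp)) (subset_closure (by simp))
    · exact subset_closure (by simp)
  · intro y
    have hy : y ∈ closure ({1, y} : Set G) := subset_closure (by simp)
    apply ss_cyclic (⟨y, hy⟩ : closure ({1, y} : Set G))
    rw [eq_top_iff]
    rintro ⟨a, ha⟩ _
    have h1 : closure ({1, y} : Set G) ≤ zpowers y := by
      rw [closure_le]
      rintro z (rfl | rfl)
      · exact one_mem _
      · exact mem_zpowers _
    obtain ⟨k, hk⟩ := h1 ha
    exact ⟨k, Subtype.ext (by simpa using hk)⟩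
  · intro a ha y
    refine ss_of_le ?_ (ha y)
    rw [closure_le]
    rintro z (rfl | rfl)
    · exact inv_mem (subset_closure (by simp))
    · exact subset_closure (by simp)

end

theorem supersoluble_semiregular (G : Type u) [Group G] [Finite G] :
    ∃ H : Subgroup G,
      (H : Set G) = {x : G | ∀ y : G, IsSupersoluble ↥(Subgroup.closure {x, y})} := by
  exact final_thm G
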